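/- Let A and B be dg algebras over a field k of characteristic zero and let X be a dg A-B-bimodule. If the sequence 0 → Hom_{B^op}(X,X) ↪ Hom(X,X) →^{(d_H^X)_R} Hom(X⊗B, X) →^{(d_H^X)_R} Hom(X⊗B^{⊗2}, X) → ⋯ is exact, then the map Φ: (Hoch_⊕^•(A, Hom_{B^op}(X,X))[−1], −(d_H+∂)) → (Hoch_⊕^•(A,X,B), d_H^X + ∂_X) is a quasi-isomorphism. Similarly, if the sequence 0 → Hom_A(X,X) ↪ Hom(X,X) →^{(d_H^X)_L} Hom(A⊗X, X) →^{(d_H^X)_L} Hom(A^{⊗2}⊗X, X) → ⋯ is exact, then the analogous map Ψ: (Hoch_⊕^•(B, Hom_A(X,X))[−1], −(d_H+∂)) → (Hoch_⊕^•(A,X,B), d_H^X + ∂_X) is a quasi-isomorphism. -/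

import Mathlib

set_option maxHeartbeats 1000000
set_option synthInstance.maxHeartbeats 400000
set_option linter.unusedVariables false

noncomputable section

namespace KD

open scoped BigOperators TensorProduct

variable (k : Type) [Field k]

def ε (n : ℤ) : k := if Even n then 1 else -1

def ext0 {X : Type} [Zero X] {n : ℕ} (a : Fin n → X) (m : ℕ) : X :=
  if h : m < n then a ⟨m, h⟩ else 0

def compAtF {X : Type} [Zero X] (p₁ p₂ : ℤ)
    (f : (Fin p₁.toNat → X) → X) (g : (Fin p₂.toNat → X) → X)
    (i : ℕ) (a : Fin (p₁ + p₂ - 1).toNat → X) : X :=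
  f (fun j => if (j : ℕ) < i then ext0 a (j : ℕ)
      else if (j : ℕ) = i then g (fun l => ext0 a (i + (l : ℕ)))
      else ext0 a ((j : ℕ) + p₂.toNat - 1))

structure DGAlgebra (A : Type) [Ring A] [Algebra k A] : Type where
  gr : ℤ → Submodule k A
  one_mem : (1 : A) ∈ gr 0
  mul_mem : ∀ {i j : ℤ} {a b : A}, a ∈ gr i → b ∈ gr j → a * b ∈ gr (i + j)
  isInternal : DirectSum.IsInternal gr
  d : A →ₗ[k] A
  d_sq : ∀ a, d (d a) = 0
  d_mem : ∀ {i : ℤ} {a : A}, a ∈ gr i → d a ∈ gr (i + 1)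
  d_leibniz : ∀ {i : ℤ} (a b : A), a ∈ gr i → d (a * b) = d a * b + ε k i • (a * d b)

variable {A : Type} [Ring A] [Algebra k A]

abbrev Coch (A : Type) [Ring A] [Algebra k A] (p : ℤ) : Type :=
  MultilinearMap k (fun _ : Fin p.toNat => A) A

def cochCast {p q : ℤ} (h : p = q) (f : Coch k A p) : Coch k A q :=
  f.domDomCongr (finCongr (congrArg Int.toNat h))

def IsHomog (R : DGAlgebra k A) (p r : ℤ) (f : Coch k A p) : Prop :=
  ∀ (dg : ℕ → ℤ) (a : ℕ → A), (∀ i, a i ∈ R.gr (dg i)) →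
    f (fun i => a (i : ℕ)) ∈ R.gr ((∑ i : Fin p.toNat, dg (i : ℕ)) + r)

/-- The family `dH` is the Hochschild differential of `(A, d_A)`. -/
def IsHochDiff (R : DGAlgebra k A)
    (dH : ∀ p r : ℤ, Coch k A p →ₗ[k] Coch k A (p + 1)) : Prop :=
  ∀ (p : ℤ), 0 ≤ p → ∀ (r : ℤ) (f : Coch k A p) (dg : ℕ → ℤ) (a : ℕ → A),
    (∀ i, a i ∈ R.gr (dg i)) →
    dH p r f (fun i => a (i : ℕ)) =
      ε k (p + r - 1 + r * dg 0) • (a 0 * f (fun i => a ((i : ℕ) + 1)))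
      + ∑ i : Fin p.toNat, ε k (p + r + (i : ℕ)) •
          f (fun j => if (j : ℕ) < (i : ℕ) then a (j : ℕ)
              else if (j : ℕ) = (i : ℕ) then a (i : ℕ) * a ((i : ℕ) + 1)
              else a ((j : ℕ) + 1))
      + ε k r • (f (fun i => a (i : ℕ)) * a p.toNat)

/-- The family `pd` is the internal differential `∂` induced by `d_A`. -/
def IsIntDiff (R : DGAlgebra k A)
    (pd : ∀ p r : ℤ, Coch k A p →ₗ[k] Coch k A p) : Prop :=
  ∀ (p : ℤ), 0 ≤ p → ∀ (r : ℤ) (f : Coch k A p) (dg : ℕ → ℤ) (a : ℕ → A),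
    (∀ i, a i ∈ R.gr (dg i)) →
    pd p r f (fun i => a (i : ℕ)) =
      R.d (f (fun i => a (i : ℕ)))
      - ε k r • ∑ i : Fin p.toNat,
          ε k (∑ j ∈ Finset.range (i : ℕ), dg j) •
            f (fun j => if (j : ℕ) = (i : ℕ) then R.d (a (i : ℕ)) else a (j : ℕ))

/-- The family `cup` is the cup product of Hochschild cochains. -/
def IsCup (R : DGAlgebra k A)
    (cup : ∀ p₁ r₁ p₂ r₂ : ℤ, Coch k A p₁ →ₗ[k] Coch k A p₂ →ₗ[k] Coch k A (p₁ + p₂)) : Prop :=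
  ∀ (p₁ : ℤ), 0 ≤ p₁ → ∀ (p₂ : ℤ), 0 ≤ p₂ → ∀ (r₁ r₂ : ℤ)
    (f : Coch k A p₁) (g : Coch k A p₂) (dg : ℕ → ℤ) (a : ℕ → A),
    (∀ i, a i ∈ R.gr (dg i)) →
    cup p₁ r₁ p₂ r₂ f g (fun i => a (i : ℕ)) =
      ε k (p₁ * p₂ + r₂ * ((∑ j ∈ Finset.range p₁.toNat, dg j) + p₁)) •
        (f (fun i => a (i : ℕ)) * g (fun j => a (p₁.toNat + (j : ℕ))))

/-- The family `br` is the Gerstenhaber bracket of Hochschild cochains. -/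
def IsBracket
    (br : ∀ p₁ r₁ p₂ r₂ : ℤ, Coch k A p₁ →ₗ[k] Coch k A p₂ →ₗ[k] Coch k A (p₁ + p₂ - 1)) : Prop :=
  ∀ (p₁ r₁ p₂ r₂ : ℤ) (f : Coch k A p₁) (g : Coch k A p₂)
    (a : Fin (p₁ + p₂ - 1).toNat → A),
    br p₁ r₁ p₂ r₂ f g a =
      (∑ i : Fin p₁.toNat,
        ε k ((p₁ - 1) * r₂ + (i : ℕ) * (p₂ - 1)) • compAtF p₁ p₂ ⇑f ⇑g (i : ℕ) a)
      - ε k ((p₁ + r₁ - 1) * (p₂ + r₂ - 1)) •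
        ∑ j : Fin p₂.toNat,
          ε k ((p₂ - 1) * r₁ + (j : ℕ) * (p₁ - 1)) •
            compAtF p₂ p₁ ⇑g ⇑f (j : ℕ) (fun m => a (Fin.cast (by omega) m))

/- Total (sum) Hochschild complex -/

abbrev TotCoch (A : Type) [Ring A] [Algebra k A] : Type := ∀ p : ℕ, Coch k A (p : ℤ)

def TotHomog (R : DGAlgebra k A) (n : ℤ) (c : TotCoch k A) : Prop :=
  ∀ p : ℕ, IsHomog k R p (n - p) (c p)

def TotFinSupp (c : TotCoch k A) : Prop := ∃ N : ℕ, ∀ p ≥ N, c p = 0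

/-- The total differential `d_H + ∂` on the sum Hochschild complex,
applied to a total cochain of total degree `n`. -/
def TotD (dH : ∀ p r : ℤ, Coch k A p →ₗ[k] Coch k A (p + 1))
    (pd : ∀ p r : ℤ, Coch k A p →ₗ[k] Coch k A p)
    (n : ℤ) (c : TotCoch k A) : TotCoch k A :=
  fun p => match p with
  | 0 => pd 0 n (c 0)
  | (q+1) => pd ((q : ℤ) + 1) (n - ((q : ℤ) + 1)) (c (q + 1)) + dH (q : ℤ) (n - q) (c q)

def TotIsCocycle (dH : ∀ p r : ℤ, Coch k A p →ₗ[k] Coch k A (p + 1))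
    (pd : ∀ p r : ℤ, Coch k A p →ₗ[k] Coch k A p)
    (n : ℤ) (c : TotCoch k A) : Prop :=
  ∀ p : ℕ, TotD k dH pd n c p = 0

def TotIsCoboundary (R : DGAlgebra k A)
    (dH : ∀ p r : ℤ, Coch k A p →ₗ[k] Coch k A (p + 1))
    (pd : ∀ p r : ℤ, Coch k A p →ₗ[k] Coch k A p)
    (n : ℤ) (c : TotCoch k A) : Prop :=
  ∃ b : TotCoch k A, TotHomog k R (n - 1) b ∧ TotFinSupp k b ∧
    ∀ p : ℕ, c p = TotD k dH pd (n - 1) b p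

/-- Total cup product of total cochains of total degrees `n₁`, `n₂`. -/
def totCup (cup : ∀ p₁ r₁ p₂ r₂ : ℤ, Coch k A p₁ →ₗ[k] Coch k A p₂ →ₗ[k] Coch k A (p₁ + p₂))
    (n₁ n₂ : ℤ) (c c' : TotCoch k A) : TotCoch k A :=
  fun p => ∑ x ∈ (Finset.range (p + 1)).attach,
    cochCast k (by have := Finset.mem_range.mp x.2; omega)
      (cup (x.1 : ℤ) (n₁ - x.1) ((p - x.1 : ℕ) : ℤ) (n₂ - ((p - x.1 : ℕ) : ℤ))
        (c x.1) (c' (p - x.1)))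

/-- Total Gerstenhaber bracket of total cochains of total degrees `n₁`, `n₂`. -/
def totBr (br : ∀ p₁ r₁ p₂ r₂ : ℤ, Coch k A p₁ →ₗ[k] Coch k A p₂ →ₗ[k] Coch k A (p₁ + p₂ - 1))
    (n₁ n₂ : ℤ) (c c' : TotCoch k A) : TotCoch k A :=
  fun p => ∑ x ∈ (Finset.range (p + 2)).attach,
    cochCast k (by have := Finset.mem_range.mp x.2; omega)
      (br (x.1 : ℤ) (n₁ - x.1) ((p + 1 - x.1 : ℕ) : ℤ) (n₂ - ((p + 1 - x.1 : ℕ) : ℤ))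
        (c x.1) (c' (p + 1 - x.1)))

/- ## Differential graded bimodules and Hochschild cochains with coefficients -/

variable {M : Type} [AddCommGroup M] [Module k M]

/-- A dg `A`-`A`-bimodule structure on `M` over a dg algebra `(A, R)`. -/
structure DGBimod (R : DGAlgebra k A) (M : Type) [AddCommGroup M] [Module k M] : Type where
  gr : ℤ → Submodule k M
  isInternal : DirectSum.IsInternal gr
  actL : A →ₗ[k] M →ₗ[k] M
  actR : A →ₗ[k] M →ₗ[k] M
  actL_one : ∀ m, actL 1 m = m
  actL_mul : ∀ a b m, actL (a * b) m = actL a (actL b m)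
  actR_one : ∀ m, actR 1 m = m
  actR_mul : ∀ a b m, actR (a * b) m = actR b (actR a m)
  actLR : ∀ a b m, actR b (actL a m) = actL a (actR b m)
  actL_mem : ∀ {i j : ℤ} {a : A} {m : M}, a ∈ R.gr i → m ∈ gr j → actL a m ∈ gr (i + j)
  actR_mem : ∀ {i j : ℤ} {a : A} {m : M}, a ∈ R.gr i → m ∈ gr j → actR a m ∈ gr (j + i)
  dM : M →ₗ[k] M
  dM_sq : ∀ m, dM (dM m) = 0
  dM_mem : ∀ {j : ℤ} {m : M}, m ∈ gr j → dM m ∈ gr (j + 1)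
  dM_actL : ∀ {i : ℤ} (a : A) (m : M), a ∈ R.gr i →
    dM (actL a m) = actL (R.d a) m + ε k i • actL a (dM m)
  dM_actR : ∀ {j : ℤ} (a : A) (m : M), m ∈ gr j →
    dM (actR a m) = actR a (dM m) + ε k j • actR (R.d a) m

/-- A dg algebra is a dg bimodule over itself. -/
def DGAlgebra.toBimod (R : DGAlgebra k A) : DGBimod k R A where
  gr := R.gr
  isInternal := R.isInternal
  actL := LinearMap.mul k A
  actR := (LinearMap.mul k A).flip
  actL_one := fun m => one_mul m
  actL_mul := fun a b m => mul_assoc a b m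
  actR_one := fun m => mul_one m
  actR_mul := fun a b m => (mul_assoc m a b).symm
  actLR := fun a b m => mul_assoc a m b
  actL_mem := fun ha hm => R.mul_mem ha hm
  actR_mem := fun ha hm => R.mul_mem hm ha
  dM := R.d
  dM_sq := R.d_sq
  dM_mem := R.d_mem
  dM_actL := fun a m ha => R.d_leibniz a m ha
  dM_actR := fun a m hm => R.d_leibniz m a hm

/-- Hochschild `p`-cochains of `A` with values in `M`. -/
abbrev MCoch (A M : Type) [Ring A] [Algebra k A] [AddCommGroup M] [Module k M]
    (p : ℕ) : Type :=
  MultilinearMap k (fun _ : Fin p => A) M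

variable {R : DGAlgebra k A}

/-- `f` is an `M`-valued Hochschild cochain of bidegree `(p, r)`. -/
def IsHomogM (St : DGBimod k R M) (p : ℕ) (r : ℤ) (f : MCoch k A M p) : Prop :=
  ∀ (dg : ℕ → ℤ) (a : ℕ → A), (∀ i, a i ∈ R.gr (dg i)) →
    f (fun i => a (i : ℕ)) ∈ St.gr ((∑ i : Fin p, dg (i : ℕ)) + r)

/-- The family `dHM` is the Hochschild differential with values in the
dg bimodule `M`. -/
def IsHochDiffM (St : DGBimod k R M)
    (dHM : ∀ (p : ℕ) (r : ℤ), MCoch k A M p →ₗ[k] MCoch k A M (p + 1)) : Prop :=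
  ∀ (p : ℕ) (r : ℤ) (f : MCoch k A M p) (dg : ℕ → ℤ) (a : ℕ → A),
    (∀ i, a i ∈ R.gr (dg i)) →
    dHM p r f (fun i => a (i : ℕ)) =
      ε k ((p : ℤ) + r - 1 + r * dg 0) • St.actL (a 0) (f (fun i => a ((i : ℕ) + 1)))
      + ∑ i : Fin p, ε k ((p : ℤ) + r + (i : ℕ)) •
          f (fun j => if (j : ℕ) < (i : ℕ) then a (j : ℕ)
              else if (j : ℕ) = (i : ℕ) then a (i : ℕ) * a ((i : ℕ) + 1)
              else a ((j : ℕ) + 1))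
      + ε k r • St.actR (a p) (f (fun i => a (i : ℕ)))

/-- The family `pdM` is the internal differential `∂` induced by `d_A` and `d_M`. -/
def IsIntDiffM (St : DGBimod k R M)
    (pdM : ∀ (p : ℕ) (r : ℤ), MCoch k A M p →ₗ[k] MCoch k A M p) : Prop :=
  ∀ (p : ℕ) (r : ℤ) (f : MCoch k A M p) (dg : ℕ → ℤ) (a : ℕ → A),
    (∀ i, a i ∈ R.gr (dg i)) →
    pdM p r f (fun i => a (i : ℕ)) =
      St.dM (f (fun i => a (i : ℕ)))
      - ε k r • ∑ i : Fin p,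
          ε k (∑ j ∈ Finset.range (i : ℕ), dg j) •
            f (fun j => if (j : ℕ) = (i : ℕ) then R.d (a (i : ℕ)) else a (j : ℕ))

/-- Recasting an `M`-valued cochain along an equality of arities. -/
def mcochCast {p q : ℕ} (h : p = q) (f : MCoch k A M p) : MCoch k A M q :=
  f.domDomCongr (finCongr h)

/-- Post-composition `H = h∘(−)` on `M`-valued cochains. -/
def Hop (h : M →ₗ[k] M) {p : ℕ} (f : MCoch k A M p) : MCoch k A M p :=
  h.compMultilinearMap f

/-- The operators `𝔥_j = (H ∘ d_H)^j ∘ H` applied to cochains of bidegree `(p,r)`. -/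
def frakh (dHM : ∀ (p : ℕ) (r : ℤ), MCoch k A M p →ₗ[k] MCoch k A M (p + 1))
    (h : M →ₗ[k] M) (p : ℕ) (r : ℤ) : (j : ℕ) → MCoch k A M p → MCoch k A M (p + j)
  | 0, f => Hop k h f
  | (j + 1), f => Hop k h (dHM (p + j) (r - j - 1) (frakh dHM h p r j f))

/-- `h` is a contracting homotopy for the dg bimodule `M` (a degree `-1` map
with `d_M ∘ h + h ∘ d_M = id`). -/
def IsContracting (St : DGBimod k R M) (h : M →ₗ[k] M) : Prop :=
  (∀ m, St.dM (h m) + h (St.dM m) = m) ∧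
  ∀ {j : ℤ} {m : M}, m ∈ St.gr j → h m ∈ St.gr (j - 1)

/-- The acyclic dg bimodule `M` is pointwisely nilpotent: some contracting
homotopy `h` satisfies that for every Hochschild cochain `f` with values in `M`
there is `N` with `𝔥_j f = 0` for all `j > N`. -/
def PointwiseNilpotent (St : DGBimod k R M)
    (dHM : ∀ (p : ℕ) (r : ℤ), MCoch k A M p →ₗ[k] MCoch k A M (p + 1)) : Prop :=
  ∃ h : M →ₗ[k] M, IsContracting k St h ∧
    ∀ (p : ℕ) (r : ℤ) (f : MCoch k A M p), IsHomogM k St p r f →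
      ∃ N : ℕ, ∀ j : ℕ, j > N → frakh k dHM h p r j f = 0

/- Total complex with values in `M` -/

abbrev TotMCoch (A M : Type) [Ring A] [Algebra k A] [AddCommGroup M] [Module k M] : Type :=
  ∀ p : ℕ, MCoch k A M p

def TotHomogM (St : DGBimod k R M) (n : ℤ) (c : TotMCoch k A M) : Prop :=
  ∀ p : ℕ, IsHomogM k St p (n - p) (c p)

def TotFinSuppM (c : TotMCoch k A M) : Prop := ∃ N : ℕ, ∀ p ≥ N, c p = 0

def TotDM (dHM : ∀ (p : ℕ) (r : ℤ), MCoch k A M p →ₗ[k] MCoch k A M (p + 1))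
    (pdM : ∀ (p : ℕ) (r : ℤ), MCoch k A M p →ₗ[k] MCoch k A M p)
    (n : ℤ) (c : TotMCoch k A M) : TotMCoch k A M :=
  fun p => match p with
  | 0 => pdM 0 n (c 0)
  | (q + 1) => pdM (q + 1) (n - ((q : ℤ) + 1)) (c (q + 1)) + dHM q (n - q) (c q)

def TotIsCocycleM (dHM : ∀ (p : ℕ) (r : ℤ), MCoch k A M p →ₗ[k] MCoch k A M (p + 1))
    (pdM : ∀ (p : ℕ) (r : ℤ), MCoch k A M p →ₗ[k] MCoch k A M p)
    (n : ℤ) (c : TotMCoch k A M) : Prop :=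
  ∀ p : ℕ, TotDM k dHM pdM n c p = 0

def TotIsCoboundaryM (St : DGBimod k R M)
    (dHM : ∀ (p : ℕ) (r : ℤ), MCoch k A M p →ₗ[k] MCoch k A M (p + 1))
    (pdM : ∀ (p : ℕ) (r : ℤ), MCoch k A M p →ₗ[k] MCoch k A M p)
    (n : ℤ) (c : TotMCoch k A M) : Prop :=
  ∃ b : TotMCoch k A M, TotHomogM k St (n - 1) b ∧ TotFinSuppM k b ∧
    ∀ p : ℕ, c p = TotDM k dHM pdM (n - 1) b p

/- Morphisms of dg bimodules, quasi-isomorphisms, mapping cones -/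

variable {N : Type} [AddCommGroup N] [Module k N]

/-- Morphism of dg `A`-`A`-bimodules (degree-preserving, chain map, bilinear). -/
def IsBimodHom (StM : DGBimod k R M) (StN : DGBimod k R N) (φ : M →ₗ[k] N) : Prop :=
  (∀ (i : ℤ) (m : M), m ∈ StM.gr i → φ m ∈ StN.gr i)
  ∧ (∀ m, φ (StM.dM m) = StN.dM (φ m))
  ∧ (∀ a m, φ (StM.actL a m) = StN.actL a (φ m))
  ∧ (∀ a m, φ (StM.actR a m) = StN.actR a (φ m))

/-- `φ` is a quasi-isomorphism of dg bimodules (bijective on cohomology). -/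
def IsQuasiIso (StM : DGBimod k R M) (StN : DGBimod k R N) (φ : M →ₗ[k] N) : Prop :=
  (∀ (i : ℤ) (n : N), n ∈ StN.gr i → StN.dM n = 0 →
    ∃ m ∈ StM.gr i, StM.dM m = 0 ∧ ∃ n' ∈ StN.gr (i - 1), φ m - n = StN.dM n')
  ∧ (∀ (i : ℤ) (m : M), m ∈ StM.gr i → StM.dM m = 0 →
    (∃ n' ∈ StN.gr (i - 1), φ m = StN.dM n') →
    ∃ m' ∈ StM.gr (i - 1), m = StM.dM m')

/-- `(C, SC, inM, inN)` is a model for the mapping cone `Cone(φ) = M[1] ⊕ N`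
as a dg `A`-`A`-bimodule. -/
def IsConeModel (StM : DGBimod k R M) (StN : DGBimod k R N) (φ : M →ₗ[k] N)
    {C : Type} [AddCommGroup C] [Module k C] (SC : DGBimod k R C)
    (inM : M →ₗ[k] C) (inN : N →ₗ[k] C) : Prop :=
  Function.Bijective (fun mn : M × N => inM mn.1 + inN mn.2)
  ∧ (∀ m, SC.dM (inM m) = - inM (StM.dM m) + inN (φ m))
  ∧ (∀ n, SC.dM (inN n) = inN (StN.dM n))
  ∧ (∀ (i : ℤ) (m : M), m ∈ StM.gr (i + 1) → inM m ∈ SC.gr i)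
  ∧ (∀ (i : ℤ) (n : N), n ∈ StN.gr i → inN n ∈ SC.gr i)
  ∧ (∀ (i : ℤ) (c : C), c ∈ SC.gr i → ∃ m ∈ StM.gr (i + 1), ∃ n ∈ StN.gr i,
      c = inM m + inN n)
  ∧ (∀ (i : ℤ) (a : A) (m : M), a ∈ R.gr i →
      SC.actL a (inM m) = ε k i • inM (StM.actL a m))
  ∧ (∀ (a : A) (n : N), SC.actL a (inN n) = inN (StN.actL a n))
  ∧ (∀ (a : A) (m : M), SC.actR a (inM m) = inM (StM.actR a m))
  ∧ (∀ (a : A) (n : N), SC.actR a (inN n) = inN (StN.actR a n))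

/-- A bundled model of the mapping cone of `φ`. -/
structure ConeData (StM : DGBimod k R M) (StN : DGBimod k R N) (φ : M →ₗ[k] N) where
  C : Type
  [instAdd : AddCommGroup C]
  [instMod : Module k C]
  SC : DGBimod k R C
  inM : M →ₗ[k] C
  inN : N →ₗ[k] C
  isCone : IsConeModel k StM StN φ SC inM inN

attribute [instance] ConeData.instAdd ConeData.instMod

/-- The mapping cone of `φ` is pointwisely nilpotent. -/
def ConePN (StM : DGBimod k R M) (StN : DGBimod k R N) (φ : M →ₗ[k] N) : Prop :=
  ∃ D : ConeData k StM StN φ,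
    ∃ dHC : ∀ (p : ℕ) (r : ℤ), MCoch k A D.C p →ₗ[k] MCoch k A D.C (p + 1),
      IsHochDiffM k D.SC dHC ∧ PointwiseNilpotent k D.SC dHC

/-- `φ` is weakly cone-nilpotent: its mapping cone is pointwisely nilpotent, or
it admits a right (resp. left) inverse morphism of dg bimodules whose mapping
cone is pointwisely nilpotent. -/
def WeaklyConeNilpotent (StM : DGBimod k R M) (StN : DGBimod k R N) (φ : M →ₗ[k] N) : Prop :=
  ConePN k StM StN φ
  ∨ (∃ ψ : N →ₗ[k] M, IsBimodHom k StN StM ψ ∧ (∀ n, φ (ψ n) = n) ∧ ConePN k StN StM ψ)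
  ∨ (∃ ψ : N →ₗ[k] M, IsBimodHom k StN StM ψ ∧ (∀ m, ψ (φ m) = m) ∧ ConePN k StN StM ψ)
/- ## Pairs of dg algebras and dg `A`-`B`-bimodules -/

variable {B : Type} [Ring B] [Algebra k B]
variable {X : Type} [AddCommGroup X] [Module k X]

/-- A dg `A`-`B`-bimodule structure on `X`. -/
structure ABBimod (RA : DGAlgebra k A) (RB : DGAlgebra k B)
    (X : Type) [AddCommGroup X] [Module k X] : Type where
  gr : ℤ → Submodule k X
  isInternal : DirectSum.IsInternal gr
  actL : A →ₗ[k] X →ₗ[k] X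
  actR : B →ₗ[k] X →ₗ[k] X
  actL_one : ∀ x, actL 1 x = x
  actL_mul : ∀ a a' x, actL (a * a') x = actL a (actL a' x)
  actR_one : ∀ x, actR 1 x = x
  actR_mul : ∀ b b' x, actR (b * b') x = actR b' (actR b x)
  actLR : ∀ a b x, actR b (actL a x) = actL a (actR b x)
  actL_mem : ∀ {i j : ℤ} {a : A} {x : X}, a ∈ RA.gr i → x ∈ gr j → actL a x ∈ gr (i + j)
  actR_mem : ∀ {i j : ℤ} {b : B} {x : X}, b ∈ RB.gr i → x ∈ gr j → actR b x ∈ gr (j + i)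
  dX : X →ₗ[k] X
  dX_sq : ∀ x, dX (dX x) = 0
  dX_mem : ∀ {j : ℤ} {x : X}, x ∈ gr j → dX x ∈ gr (j + 1)
  dX_actL : ∀ {i : ℤ} (a : A) (x : X), a ∈ RA.gr i →
    dX (actL a x) = actL (RA.d a) x + ε k i • actL a (dX x)
  dX_actR : ∀ {j : ℤ} (b : B) (x : X), x ∈ gr j →
    dX (actR b x) = actR b (dX x) + ε k j • actR (RB.d b) x

/-- Hochschild cochains of type `Hom(A^{⊗p} ⊗ X ⊗ B^{⊗q}, X)`, in curried form. -/
abbrev XCoch (A B X : Type) [Ring A] [Algebra k A] [Ring B] [Algebra k B]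
    [AddCommGroup X] [Module k X] (p q : ℕ) : Type :=
  MultilinearMap k (fun _ : Fin p => A)
    (X →ₗ[k] MultilinearMap k (fun _ : Fin q => B) X)

variable {RA : DGAlgebra k A} {RB : DGAlgebra k B}

/-- `f ∈ Hoch^{p,q,r}(A,X,B)`: homogeneity of internal degree `r`. -/
def IsHomogX (SX : ABBimod k RA RB X) (p q : ℕ) (r : ℤ) (f : XCoch k A B X p q) : Prop :=
  ∀ (dga : ℕ → ℤ) (a : ℕ → A), (∀ i, a i ∈ RA.gr (dga i)) →
  ∀ (ix : ℤ) (x : X), x ∈ SX.gr ix →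
  ∀ (dgb : ℕ → ℤ) (b : ℕ → B), (∀ j, b j ∈ RB.gr (dgb j)) →
    f (fun i => a (i : ℕ)) x (fun j => b (j : ℕ))
      ∈ SX.gr ((∑ i : Fin p, dga (i : ℕ)) + ix + (∑ j : Fin q, dgb (j : ℕ)) + r)

/-- `dXL` is the left part `(d_H^X)_L` of the Hochschild differential of the
dg `A`-`B`-bimodule `X`. -/
def IsDXL (SX : ABBimod k RA RB X)
    (dXL : ∀ (p q : ℕ) (r : ℤ), XCoch k A B X p q →ₗ[k] XCoch k A B X (p + 1) q) : Prop :=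
  ∀ (p q : ℕ) (r : ℤ) (f : XCoch k A B X p q)
    (dga : ℕ → ℤ) (a : ℕ → A), (∀ i, a i ∈ RA.gr (dga i)) →
    ∀ (x : X) (b : ℕ → B),
    dXL p q r f (fun i => a (i : ℕ)) x (fun j => b (j : ℕ)) =
      ε k ((p : ℤ) + q + r + r * dga 0) •
        SX.actL (a 0) (f (fun i => a ((i : ℕ) + 1)) x (fun j => b (j : ℕ)))
      + ∑ i : Fin p, ε k ((p : ℤ) + q + r + (i : ℕ) + 1) •
          f (fun j => if (j : ℕ) < (i : ℕ) then a (j : ℕ)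
              else if (j : ℕ) = (i : ℕ) then a (i : ℕ) * a ((i : ℕ) + 1)
              else a ((j : ℕ) + 1)) x (fun j => b (j : ℕ))
      + ε k ((q : ℤ) + r + 1) •
          f (fun i => a (i : ℕ)) (SX.actL (a p) x) (fun j => b (j : ℕ))

/-- `dXR` is the right part `(d_H^X)_R` of the Hochschild differential of `X`. -/
def IsDXR (SX : ABBimod k RA RB X)
    (dXR : ∀ (p q : ℕ) (r : ℤ), XCoch k A B X p q →ₗ[k] XCoch k A B X p (q + 1)) : Prop :=
  ∀ (p q : ℕ) (r : ℤ) (f : XCoch k A B X p q) (a : ℕ → A) (x : X) (b : ℕ → B),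
    dXR p q r f (fun i => a (i : ℕ)) x (fun j => b (j : ℕ)) =
      ε k ((q : ℤ) + r - 1) •
        f (fun i => a (i : ℕ)) (SX.actR (b 0) x) (fun j => b ((j : ℕ) + 1))
      + ∑ j : Fin q, ε k ((q : ℤ) + r + (j : ℕ)) •
          f (fun i => a (i : ℕ)) x
            (fun l => if (l : ℕ) < (j : ℕ) then b (l : ℕ)
              else if (l : ℕ) = (j : ℕ) then b (j : ℕ) * b ((j : ℕ) + 1)
              else b ((l : ℕ) + 1))
      + ε k r • SX.actR (b q) (f (fun i => a (i : ℕ)) x (fun j => b (j : ℕ)))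

/-- `pdX` is the internal differential `∂_X` on `Hoch(A,X,B)`. -/
def IsPdX (SX : ABBimod k RA RB X)
    (pdX : ∀ (p q : ℕ) (r : ℤ), XCoch k A B X p q →ₗ[k] XCoch k A B X p q) : Prop :=
  ∀ (p q : ℕ) (r : ℤ) (f : XCoch k A B X p q)
    (dga : ℕ → ℤ) (a : ℕ → A), (∀ i, a i ∈ RA.gr (dga i)) →
    ∀ (ix : ℤ) (x : X), x ∈ SX.gr ix →
    ∀ (dgb : ℕ → ℤ) (b : ℕ → B), (∀ j, b j ∈ RB.gr (dgb j)) →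
    pdX p q r f (fun i => a (i : ℕ)) x (fun j => b (j : ℕ)) =
      SX.dX (f (fun i => a (i : ℕ)) x (fun j => b (j : ℕ)))
      - ε k r • (
        (∑ i : Fin p, ε k (∑ j ∈ Finset.range (i : ℕ), dga j) •
          f (fun j => if (j : ℕ) = (i : ℕ) then RA.d (a (i : ℕ)) else a (j : ℕ)) x
            (fun j => b (j : ℕ)))
        + ε k (∑ j ∈ Finset.range p, dga j) •
            f (fun i => a (i : ℕ)) (SX.dX x) (fun j => b (j : ℕ))
        + ∑ j : Fin q, ε k ((∑ l ∈ Finset.range p, dga l) + ix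
              + (∑ l ∈ Finset.range (j : ℕ), dgb l)) •
            f (fun i => a (i : ℕ)) x
              (fun l => if (l : ℕ) = (j : ℕ) then RB.d (b (j : ℕ)) else b (l : ℕ)))

/-- `dAX` is the connecting component `d_H^{AX} : Hoch(A) → Hoch(A,X,B)`. -/
def IsDAX (SX : ABBimod k RA RB X)
    (dAX : ∀ (p : ℕ) (r : ℤ), Coch k A (p : ℤ) →ₗ[k] XCoch k A B X p 0) : Prop :=
  ∀ (p : ℕ) (r : ℤ) (fA : Coch k A (p : ℤ)) (a : ℕ → A) (x : X) (b : Fin 0 → B),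
    dAX p r fA (fun i => a (i : ℕ)) x b =
      ε k r • SX.actL (fA (fun i => a (i : ℕ))) x

/-- `dXB` is the connecting component `d_H^{XB} : Hoch(B) → Hoch(A,X,B)`. -/
def IsDXB (SX : ABBimod k RA RB X)
    (dXB : ∀ (q : ℕ) (r : ℤ), Coch k B (q : ℤ) →ₗ[k] XCoch k A B X 0 q) : Prop :=
  ∀ (q : ℕ) (r : ℤ) (fB : Coch k B (q : ℤ)) (a : Fin 0 → A)
    (ix : ℤ) (x : X), x ∈ SX.gr ix → ∀ (b : ℕ → B),
    dXB q r fB a x (fun j => b (j : ℕ)) =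
      ε k ((q : ℤ) + r - 1 + r * ix) • SX.actR (fB (fun j => b (j : ℕ))) x

/- ### The partial Hochschild sequences -/

/-- Cochains of type `Hom(X ⊗ B^{⊗q}, X)`. -/
abbrev YCoch (B X : Type) [Ring B] [Algebra k B] [AddCommGroup X] [Module k X]
    (q : ℕ) : Type :=
  X →ₗ[k] MultilinearMap k (fun _ : Fin q => B) X

/-- Cochains of type `Hom(A^{⊗p} ⊗ X, X)`. -/
abbrev ZCoch (A X : Type) [Ring A] [Algebra k A] [AddCommGroup X] [Module k X]
    (p : ℕ) : Type :=
  MultilinearMap k (fun _ : Fin p => A) (X →ₗ[k] X)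

def IsHomogY (SX : ABBimod k RA RB X) (q : ℕ) (r : ℤ) (f : YCoch k B X q) : Prop :=
  ∀ (ix : ℤ) (x : X), x ∈ SX.gr ix →
  ∀ (dgb : ℕ → ℤ) (b : ℕ → B), (∀ j, b j ∈ RB.gr (dgb j)) →
    f x (fun j => b (j : ℕ)) ∈ SX.gr (ix + (∑ j : Fin q, dgb (j : ℕ)) + r)

def IsHomogZ (SX : ABBimod k RA RB X) (p : ℕ) (r : ℤ) (f : ZCoch k A X p) : Prop :=
  ∀ (dga : ℕ → ℤ) (a : ℕ → A), (∀ i, a i ∈ RA.gr (dga i)) →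
  ∀ (ix : ℤ) (x : X), x ∈ SX.gr ix →
    f (fun i => a (i : ℕ)) x ∈ SX.gr ((∑ i : Fin p, dga (i : ℕ)) + ix + r)

/-- `dR` is the partial Hochschild differential `(d_H^X)_R` on `Hom(X⊗B^{⊗•}, X)`. -/
def IsDR (SX : ABBimod k RA RB X)
    (dR : ∀ (q : ℕ) (r : ℤ), YCoch k B X q →ₗ[k] YCoch k B X (q + 1)) : Prop :=
  ∀ (q : ℕ) (r : ℤ) (f : YCoch k B X q) (x : X) (b : ℕ → B),
    dR q r f x (fun j => b (j : ℕ)) =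
      ε k ((q : ℤ) + r - 1) • f (SX.actR (b 0) x) (fun j => b ((j : ℕ) + 1))
      + ∑ j : Fin q, ε k ((q : ℤ) + r + (j : ℕ)) •
          f x (fun l => if (l : ℕ) < (j : ℕ) then b (l : ℕ)
              else if (l : ℕ) = (j : ℕ) then b (j : ℕ) * b ((j : ℕ) + 1)
              else b ((l : ℕ) + 1))
      + ε k r • SX.actR (b q) (f x (fun j => b (j : ℕ)))

/-- `dL` is the partial Hochschild differential `(d_H^X)_L` on `Hom(A^{⊗•}⊗X, X)`. -/
def IsDL (SX : ABBimod k RA RB X)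
    (dL : ∀ (p : ℕ) (r : ℤ), ZCoch k A X p →ₗ[k] ZCoch k A X (p + 1)) : Prop :=
  ∀ (p : ℕ) (r : ℤ) (f : ZCoch k A X p)
    (dga : ℕ → ℤ) (a : ℕ → A), (∀ i, a i ∈ RA.gr (dga i)) → ∀ (x : X),
    dL p r f (fun i => a (i : ℕ)) x =
      ε k ((p : ℤ) + r + r * dga 0) • SX.actL (a 0) (f (fun i => a ((i : ℕ) + 1)) x)
      + ∑ i : Fin p, ε k ((p : ℤ) + r + (i : ℕ) + 1) •
          f (fun j => if (j : ℕ) < (i : ℕ) then a (j : ℕ)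
              else if (j : ℕ) = (i : ℕ) then a (i : ℕ) * a ((i : ℕ) + 1)
              else a ((j : ℕ) + 1)) x
      + ε k (r + 1) • f (fun i => a (i : ℕ)) (SX.actL (a p) x)

/-- Exactness of the sequence
`0 → Hom_{B^op}(X,X) ↪ Hom(X,X) → Hom(X⊗B,X) → Hom(X⊗B^{⊗2},X) → ⋯`. -/
def ExactR (SX : ABBimod k RA RB X)
    (dR : ∀ (q : ℕ) (r : ℤ), YCoch k B X q →ₗ[k] YCoch k B X (q + 1)) : Prop :=
  (∀ (r : ℤ) (f : YCoch k B X 0), IsHomogY k SX 0 r f →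
    (dR 0 r f = 0 ↔ ∀ (b : B) (x : X),
      f (SX.actR b x) (fun j => j.elim0) = SX.actR b (f x (fun j => j.elim0))))
  ∧ (∀ (q : ℕ) (r : ℤ) (f : YCoch k B X (q + 1)), IsHomogY k SX (q + 1) r f →
      dR (q + 1) r f = 0 →
      ∃ g : YCoch k B X q, IsHomogY k SX q r g ∧ dR q r g = f)

/-- Exactness of the sequence
`0 → Hom_A(X,X) ↪ Hom(X,X) → Hom(A⊗X,X) → Hom(A^{⊗2}⊗X,X) → ⋯`. -/
def ExactL (SX : ABBimod k RA RB X)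
    (dL : ∀ (p : ℕ) (r : ℤ), ZCoch k A X p →ₗ[k] ZCoch k A X (p + 1)) : Prop :=
  (∀ (r : ℤ) (f : ZCoch k A X 0), IsHomogZ k SX 0 r f →
    (dL 0 r f = 0 ↔ ∀ (i : ℤ) (a : A) (x : X), a ∈ RA.gr i →
      f (fun j => j.elim0) (SX.actL a x) = ε k (r * i) • SX.actL a (f (fun j => j.elim0) x)))
  ∧ (∀ (p : ℕ) (r : ℤ) (f : ZCoch k A X (p + 1)), IsHomogZ k SX (p + 1) r f →
      dL (p + 1) r f = 0 →
      ∃ g : ZCoch k A X p, IsHomogZ k SX p r g ∧ dL p r g = f)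

/- ### Models of `Hom_{B^op}(X,X)` and `Hom_A(X,X)` as dg bimodules -/

/-- A model `E` for the dg `A`-`A`-bimodule `Hom_{B^op}(X,X)` of graded right
`B`-linear endomorphisms of `X`, with differential `∂_X = [d_X, −]`. -/
structure EndBModel (SX : ABBimod k RA RB X) (E : Type)
    [AddCommGroup E] [Module k E] : Type where
  SE : DGBimod k RA E
  toEnd : E →ₗ[k] X →ₗ[k] X
  inj : Function.Injective toEnd
  rlin : ∀ {r : ℤ} {e : E}, e ∈ SE.gr r → ∀ (b : B) (x : X),
    toEnd e (SX.actR b x) = SX.actR b (toEnd e x)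
  graded : ∀ {r i : ℤ} {e : E} {x : X}, e ∈ SE.gr r → x ∈ SX.gr i →
    toEnd e x ∈ SX.gr (i + r)
  surj : ∀ (r : ℤ) (φ : X →ₗ[k] X),
    (∀ (b : B) (x : X), φ (SX.actR b x) = SX.actR b (φ x)) →
    (∀ (i : ℤ) (x : X), x ∈ SX.gr i → φ x ∈ SX.gr (i + r)) →
    ∃ e ∈ SE.gr r, toEnd e = φ
  d_eq : ∀ {r : ℤ} (e : E), e ∈ SE.gr r → ∀ x,
    toEnd (SE.dM e) x = SX.dX (toEnd e x) - ε k r • toEnd e (SX.dX x)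
  actL_eq : ∀ (a : A) (e : E) (x : X), toEnd (SE.actL a e) x = SX.actL a (toEnd e x)
  actR_eq : ∀ (a : A) (e : E) (x : X), toEnd (SE.actR a e) x = toEnd e (SX.actL a x)

/-- A model `E'` for the dg `B`-`B`-bimodule `Hom_A(X,X)` of graded left
`A`-linear endomorphisms of `X`, with differential `∂_X = [d_X, −]`. -/
structure EndAModel (SX : ABBimod k RA RB X) (E' : Type)
    [AddCommGroup E'] [Module k E'] : Type where
  SE : DGBimod k RB E'
  toEnd : E' →ₗ[k] X →ₗ[k] X
  inj : Function.Injective toEnd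
  llin : ∀ {r i : ℤ} {e : E'} {a : A}, e ∈ SE.gr r → a ∈ RA.gr i → ∀ x,
    toEnd e (SX.actL a x) = ε k (r * i) • SX.actL a (toEnd e x)
  graded : ∀ {r i : ℤ} {e : E'} {x : X}, e ∈ SE.gr r → x ∈ SX.gr i →
    toEnd e x ∈ SX.gr (i + r)
  surj : ∀ (r : ℤ) (φ : X →ₗ[k] X),
    (∀ (i : ℤ) (a : A) (x : X), a ∈ RA.gr i →
      φ (SX.actL a x) = ε k (r * i) • SX.actL a (φ x)) →
    (∀ (i : ℤ) (x : X), x ∈ SX.gr i → φ x ∈ SX.gr (i + r)) →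
    ∃ e ∈ SE.gr r, toEnd e = φ
  d_eq : ∀ {r : ℤ} (e : E'), e ∈ SE.gr r → ∀ x,
    toEnd (SE.dM e) x = SX.dX (toEnd e x) - ε k r • toEnd e (SX.dX x)
  actL_eq : ∀ {j r i : ℤ} (b : B) (e : E') (x : X),
    b ∈ RB.gr j → e ∈ SE.gr r → x ∈ SX.gr i →
    toEnd (SE.actL b e) x = ε k (j * (r + i)) • toEnd e (SX.actR b x)
  actR_eq : ∀ {j i : ℤ} (b : B) (e : E') (x : X), b ∈ RB.gr j → x ∈ SX.gr i →
    toEnd (SE.actR b e) x = ε k (j * i) • SX.actR b (toEnd e x)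

/-- `ρ_A : A → Hom_{B^op}(X,X)` is the left action map `ρ_A(a)(x) = a·x`. -/
def IsRhoA {E : Type} [AddCommGroup E] [Module k E] (SX : ABBimod k RA RB X)
    (EM : EndBModel k SX E) (ρA : A →ₗ[k] E) : Prop :=
  ∀ (a : A) (x : X), EM.toEnd (ρA a) x = SX.actL a x

/-- `ρ_B : B^op → Hom_A(X,X)` is the right action map
`ρ_B(b)(x) = (-1)^{|x||b|} x·b`. -/
def IsRhoB {E' : Type} [AddCommGroup E'] [Module k E'] (SX : ABBimod k RA RB X)
    (EM : EndAModel k SX E') (ρB : B →ₗ[k] E') : Prop :=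
  ∀ {j i : ℤ} (b : B) (x : X), b ∈ RB.gr j → x ∈ SX.gr i →
    EM.toEnd (ρB b) x = ε k (i * j) • SX.actR b x

/- ### The canonical embedding `Φ` -/

/-- The constant-multilinear-map inclusion. -/
def constML : X →ₗ[k] MultilinearMap k (fun _ : Fin 0 => B) X where
  toFun x := MultilinearMap.constOfIsEmpty k _ x
  map_add' x y := by ext m; simp
  map_smul' c x := by ext m; simp

/-- The embedding `Φ^{p,r} : Hoch^{p,r}(A, Hom_{B^op}(X,X)) → Hoch^{p,0,r}(A,X,B)`
(including the sign `(-1)^r`). -/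
def PhiMap {E : Type} [AddCommGroup E] [Module k E] (SX : ABBimod k RA RB X)
    (EM : EndBModel k SX E) (p : ℕ) (r : ℤ) (f : MCoch k A E p) :
    XCoch k A B X p 0 :=
  ε k r • ((((LinearMap.llcomp k X X (MultilinearMap k (fun _ : Fin 0 => B) X))
      (constML k)).comp EM.toEnd).compMultilinearMap f)

/-- The embedding `Ψ : Hoch^{q,r}(B, Hom_A(X,X)) → Hoch^{0,q,r}(A,X,B)`,
`Ψ(f)(x; b₁,…,b_q) = (-1)^{q+r-1}(-1)^{|x|(|b₁|+⋯+|b_q|)} f(b₁⊗⋯⊗b_q)(x)`. -/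
def IsPsi {E' : Type} [AddCommGroup E'] [Module k E'] (SX : ABBimod k RA RB X)
    (EM : EndAModel k SX E')
    (Psi : ∀ (q : ℕ) (r : ℤ), MCoch k B E' q →ₗ[k] XCoch k A B X 0 q) : Prop :=
  ∀ (q : ℕ) (r : ℤ) (f : MCoch k B E' q) (a : Fin 0 → A)
    (ix : ℤ) (x : X), x ∈ SX.gr ix →
    ∀ (dgb : ℕ → ℤ) (b : ℕ → B), (∀ j, b j ∈ RB.gr (dgb j)) →
    Psi q r f a x (fun j => b (j : ℕ)) =
      (ε k ((q : ℤ) + r - 1) * ε k (ix * ∑ j ∈ Finset.range q, dgb j)) •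
        EM.toEnd (f (fun j => b (j : ℕ))) x

/- ### The total Hochschild complex of the dg `A`-`B`-bimodule `X` -/

abbrev TotXCoch (A B X : Type) [Ring A] [Algebra k A] [Ring B] [Algebra k B]
    [AddCommGroup X] [Module k X] : Type := ∀ p q : ℕ, XCoch k A B X p q

def TotHomogX (SX : ABBimod k RA RB X) (n : ℤ) (cx : TotXCoch k A B X) : Prop :=
  ∀ p q : ℕ, IsHomogX k SX p q (n - p - q - 1) (cx p q)

def TotFinSuppX (cx : TotXCoch k A B X) : Prop :=
  ∃ N : ℕ, ∀ p q : ℕ, p + q ≥ N → cx p q = 0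

/-- The `X`-component of the total differential of the Hochschild complex
`Hoch_⊕(X) = Hoch_⊕(A) ⊕ Hoch_⊕(A,X,B) ⊕ Hoch_⊕(B)`, applied to an element of
total degree `n`. -/
def TotDXpart
    (dXL : ∀ (p q : ℕ) (r : ℤ), XCoch k A B X p q →ₗ[k] XCoch k A B X (p + 1) q)
    (dXR : ∀ (p q : ℕ) (r : ℤ), XCoch k A B X p q →ₗ[k] XCoch k A B X p (q + 1))
    (pdX : ∀ (p q : ℕ) (r : ℤ), XCoch k A B X p q →ₗ[k] XCoch k A B X p q)
    (dAX : ∀ (p : ℕ) (r : ℤ), Coch k A (p : ℤ) →ₗ[k] XCoch k A B X p 0)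
    (dXB : ∀ (q : ℕ) (r : ℤ), Coch k B (q : ℤ) →ₗ[k] XCoch k A B X 0 q)
    (n : ℤ) (cA : TotCoch k A) (cx : TotXCoch k A B X) (cB : TotCoch k B) :
    TotXCoch k A B X :=
  fun p q => match p, q with
  | 0, 0 => pdX 0 0 (n - 1) (cx 0 0) + dAX 0 n (cA 0) + dXB 0 n (cB 0)
  | (p + 1), 0 => pdX (p + 1) 0 (n - (p + 1) - 1) (cx (p + 1) 0)
      + dXL p 0 (n - p - 1) (cx p 0) + dAX (p + 1) (n - (p + 1)) (cA (p + 1))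
  | 0, (q + 1) => pdX 0 (q + 1) (n - (q + 1) - 1) (cx 0 (q + 1))
      + dXR 0 q (n - q - 1) (cx 0 q) + dXB (q + 1) (n - (q + 1)) (cB (q + 1))
  | (p + 1), (q + 1) => pdX (p + 1) (q + 1) (n - (p + 1) - (q + 1) - 1) (cx (p + 1) (q + 1))
      + dXL p (q + 1) (n - p - (q + 1) - 1) (cx p (q + 1))
      + dXR (p + 1) q (n - (p + 1) - q - 1) (cx (p + 1) q)

/-- A total cocycle of `Hoch_⊕(X)`, given componentwise by families
`(cA, cx, cB)` of total degree `n`. -/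
def TotXIsCocycle
    (dHA : ∀ p r : ℤ, Coch k A p →ₗ[k] Coch k A (p + 1))
    (pdA : ∀ p r : ℤ, Coch k A p →ₗ[k] Coch k A p)
    (dHB : ∀ p r : ℤ, Coch k B p →ₗ[k] Coch k B (p + 1))
    (pdB : ∀ p r : ℤ, Coch k B p →ₗ[k] Coch k B p)
    (dXL : ∀ (p q : ℕ) (r : ℤ), XCoch k A B X p q →ₗ[k] XCoch k A B X (p + 1) q)
    (dXR : ∀ (p q : ℕ) (r : ℤ), XCoch k A B X p q →ₗ[k] XCoch k A B X p (q + 1))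
    (pdX : ∀ (p q : ℕ) (r : ℤ), XCoch k A B X p q →ₗ[k] XCoch k A B X p q)
    (dAX : ∀ (p : ℕ) (r : ℤ), Coch k A (p : ℤ) →ₗ[k] XCoch k A B X p 0)
    (dXB : ∀ (q : ℕ) (r : ℤ), Coch k B (q : ℤ) →ₗ[k] XCoch k A B X 0 q)
    (n : ℤ) (cA : TotCoch k A) (cx : TotXCoch k A B X) (cB : TotCoch k B) : Prop :=
  (∀ p : ℕ, TotD k dHA pdA n cA p = 0)
  ∧ (∀ q : ℕ, TotD k dHB pdB n cB q = 0)
  ∧ (∀ p q : ℕ, TotDXpart k dXL dXR pdX dAX dXB n cA cx cB p q = 0)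

/-- `(cA, cx, cB)` (of total degree `n`) is a total coboundary in `Hoch_⊕(X)`. -/
def TotXIsCoboundary (SX : ABBimod k RA RB X)
    (dHA : ∀ p r : ℤ, Coch k A p →ₗ[k] Coch k A (p + 1))
    (pdA : ∀ p r : ℤ, Coch k A p →ₗ[k] Coch k A p)
    (dHB : ∀ p r : ℤ, Coch k B p →ₗ[k] Coch k B (p + 1))
    (pdB : ∀ p r : ℤ, Coch k B p →ₗ[k] Coch k B p)
    (dXL : ∀ (p q : ℕ) (r : ℤ), XCoch k A B X p q →ₗ[k] XCoch k A B X (p + 1) q)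
    (dXR : ∀ (p q : ℕ) (r : ℤ), XCoch k A B X p q →ₗ[k] XCoch k A B X p (q + 1))
    (pdX : ∀ (p q : ℕ) (r : ℤ), XCoch k A B X p q →ₗ[k] XCoch k A B X p q)
    (dAX : ∀ (p : ℕ) (r : ℤ), Coch k A (p : ℤ) →ₗ[k] XCoch k A B X p 0)
    (dXB : ∀ (q : ℕ) (r : ℤ), Coch k B (q : ℤ) →ₗ[k] XCoch k A B X 0 q)
    (n : ℤ) (cA : TotCoch k A) (cx : TotXCoch k A B X) (cB : TotCoch k B) : Prop :=
  ∃ (bA : TotCoch k A) (bx : TotXCoch k A B X) (bB : TotCoch k B),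
    TotHomog k RA (n - 1) bA ∧ TotFinSupp k bA ∧
    TotHomogX k SX (n - 1) bx ∧ TotFinSuppX k bx ∧
    TotHomog k RB (n - 1) bB ∧ TotFinSupp k bB ∧
    (∀ p : ℕ, cA p = TotD k dHA pdA (n - 1) bA p)
    ∧ (∀ q : ℕ, cB q = TotD k dHB pdB (n - 1) bB q)
    ∧ (∀ p q : ℕ, cx p q = TotDXpart k dXL dXR pdX dAX dXB (n - 1) bA bx bB p q)

/-- The total differential `d_H^X + ∂_X` of the complex `Hoch_⊕(A,X,B)` alone. -/
def TotDXonly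
    (dXL : ∀ (p q : ℕ) (r : ℤ), XCoch k A B X p q →ₗ[k] XCoch k A B X (p + 1) q)
    (dXR : ∀ (p q : ℕ) (r : ℤ), XCoch k A B X p q →ₗ[k] XCoch k A B X p (q + 1))
    (pdX : ∀ (p q : ℕ) (r : ℤ), XCoch k A B X p q →ₗ[k] XCoch k A B X p q)
    (n : ℤ) (cx : TotXCoch k A B X) : TotXCoch k A B X :=
  TotDXpart k dXL dXR pdX (fun _ _ => 0) (fun _ _ => 0) n (fun _ => 0) cx (fun _ => 0)

def TotXonlyCocycle
    (dXL : ∀ (p q : ℕ) (r : ℤ), XCoch k A B X p q →ₗ[k] XCoch k A B X (p + 1) q)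
    (dXR : ∀ (p q : ℕ) (r : ℤ), XCoch k A B X p q →ₗ[k] XCoch k A B X p (q + 1))
    (pdX : ∀ (p q : ℕ) (r : ℤ), XCoch k A B X p q →ₗ[k] XCoch k A B X p q)
    (n : ℤ) (cx : TotXCoch k A B X) : Prop :=
  ∀ p q : ℕ, TotDXonly k dXL dXR pdX n cx p q = 0

def TotXonlyCoboundary (SX : ABBimod k RA RB X)
    (dXL : ∀ (p q : ℕ) (r : ℤ), XCoch k A B X p q →ₗ[k] XCoch k A B X (p + 1) q)
    (dXR : ∀ (p q : ℕ) (r : ℤ), XCoch k A B X p q →ₗ[k] XCoch k A B X p (q + 1))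
    (pdX : ∀ (p q : ℕ) (r : ℤ), XCoch k A B X p q →ₗ[k] XCoch k A B X p q)
    (n : ℤ) (cx : TotXCoch k A B X) : Prop :=
  ∃ bx : TotXCoch k A B X, TotHomogX k SX (n - 1) bx ∧ TotFinSuppX k bx ∧
    ∀ p q : ℕ, cx p q = TotDXonly k dXL dXR pdX (n - 1) bx p q

/-- The totalization of `Φ` (resp. of `Ψ`-type maps), taking a total cochain of
`Hoch_⊕(A, Hom_{B^op}(X,X))` of total degree `m` to a total cochain of
`Hoch_⊕(A,X,B)` of total degree `m + 1`, supported in `q = 0`. -/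
def PhiTot {E : Type} [AddCommGroup E] [Module k E] (SX : ABBimod k RA RB X)
    (EM : EndBModel k SX E) (m : ℤ) (α : TotMCoch k A E) : TotXCoch k A B X :=
  fun p q => match q with
  | 0 => PhiMap k SX EM p (m - p) (α p)
  | _ + 1 => 0

def PsiTot {E' : Type} [AddCommGroup E'] [Module k E']
    (Psi : ∀ (q : ℕ) (r : ℤ), MCoch k B E' q →ₗ[k] XCoch k A B X 0 q)
    (m : ℤ) (β : TotMCoch k B E') : TotXCoch k A B X :=
  fun p q => match p with
  | 0 => Psi q (m - q) (β q)
  | _ + 1 => 0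

section Reduction

/- ### Signs -/

theorem ε_congr {m n : ℤ} (h : Even m ↔ Even n) : ε k m = ε k n := by
  simp only [ε, h]

theorem ε_mul_ε (m n : ℤ) : ε k m * ε k n = ε k (m + n) := by
  by_cases hm : Even m <;> by_cases hn : Even n <;> simp [ε, hm, hn, Int.even_add]

theorem ε_succ (m : ℤ) : ε k (m + 1) = -ε k m := by
  by_cases hm : Even m <;> simp [ε, hm]

theorem ε_zero : ε k 0 = 1 := by simp [ε]

theorem ε_mul_self (m : ℤ) : ε k m * ε k m = 1 := by
  by_cases hm : Even m <;> simp [ε, hm]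

theorem ε_smul_smul (m n : ℤ) (x : M) : ε k m • ε k n • x = ε k (m + n) • x := by
  rw [smul_smul, ε_mul_ε]

theorem ε_smul_self (m : ℤ) (x : M) : ε k m • ε k m • x = x := by
  rw [smul_smul, ε_mul_self, one_smul]

theorem neg_ε_smul (m : ℤ) (x : M) : -(ε k m • x) = ε k (m + 1) • x := by
  rw [ε_succ, neg_smul]

/-- An alternating double sum whose terms agree under the cosimplicial exchange vanishes. -/
theorem sum_alternating_exchange_eq_zero (n : ℕ) (T : ℕ → ℕ → M)
    (hT : ∀ i j, i < j → j < n + 1 → T j i = T i (j - 1)) :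
    ∑ j ∈ Finset.range (n + 1), ∑ i ∈ Finset.range n, ε k ((j : ℤ) + i) • T j i = 0 := by
  rw [← Finset.sum_product']
  refine Finset.sum_involution
    (fun x _ => if x.2 < x.1 then (x.2, x.1 - 1) else (x.2 + 1, x.1)) ?_ ?_ ?_ ?_
  · rintro ⟨j, i⟩ h
    simp only [Finset.mem_product, Finset.mem_range] at h
    by_cases hij : i < j
    · simp only [hij, if_true]
      obtain ⟨j, rfl⟩ : ∃ l, j = l + 1 := ⟨j - 1, by omega⟩
      rw [hT i (j + 1) hij h.1]
      simp only [Nat.add_sub_cancel]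
      rw [show (((j + 1 : ℕ) : ℤ) + i) = (i + j : ℤ) + 1 by push_cast; ring, ε_succ]
      simp
    · simp only [hij, if_false]
      rw [hT j (i + 1) (by omega) (by omega)]
      simp only [Nat.add_sub_cancel]
      rw [show (((i + 1 : ℕ) : ℤ) + j) = (j + i : ℤ) + 1 by push_cast; ring, ε_succ]
      simp
  · rintro ⟨j, i⟩ h _
    by_cases hij : i < j <;> simp only [hij, if_true, if_false, ne_eq, Prod.mk.injEq] <;> omega
  · rintro ⟨j, i⟩ h
    simp only [Finset.mem_product, Finset.mem_range] at h ⊢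
    by_cases hij : i < j <;> simp only [hij, if_true, if_false] <;> omega
  · rintro ⟨j, i⟩ h
    by_cases hij : i < j
    · simp only [hij, if_true]
      rw [if_neg (by simp; omega)]
      simp only [Prod.mk.injEq, and_true]; omega
    · simp only [hij, if_false]
      rw [if_pos (by simp; omega)]
      simp

/-- An antisymmetric double sum vanishes in characteristic zero. -/
theorem sum_antisymm_eq_zero [CharZero k] (s : Finset ℕ) (T : ℕ → ℕ → M)
    (hT : ∀ i ∈ s, ∀ j ∈ s, T i j = -T j i) : ∑ i ∈ s, ∑ j ∈ s, T i j = 0 := by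
  have h : ∑ i ∈ s, ∑ j ∈ s, T i j = -∑ i ∈ s, ∑ j ∈ s, T i j := by
    conv_rhs => rw [Finset.sum_comm]
    rw [← Finset.sum_neg_distrib]
    refine Finset.sum_congr rfl fun i hi => ?_
    rw [← Finset.sum_neg_distrib]
    exact Finset.sum_congr rfl fun j hj => hT i hi j hj
  have h2 : (2 : k) • ∑ i ∈ s, ∑ j ∈ s, T i j = 0 := by
    rw [two_smul]; nth_rewrite 1 [h]; simp
  exact (smul_eq_zero.mp h2).resolve_left two_ne_zero

/- ### Cochains on words of homogeneous letters -/

/-- A (not necessarily unital) dg algebra `T` together with a dg bimodule `M`. -/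
structure WordData (T M : Type) [AddCommGroup T] [Module k T] [AddCommGroup M] [Module k M] where
  mul : T →ₗ[k] T →ₗ[k] T
  mul_assoc : ∀ s t u, mul (mul s t) u = mul s (mul t u)
  d : T →ₗ[k] T
  d_sq : ∀ t, d (d t) = 0
  gr : ℤ → Submodule k T
  mul_mem : ∀ {i j : ℤ} {s t : T}, s ∈ gr i → t ∈ gr j → mul s t ∈ gr (i + j)
  d_mem : ∀ {i : ℤ} {t : T}, t ∈ gr i → d t ∈ gr (i + 1)
  d_mul : ∀ {i : ℤ} (s t : T), s ∈ gr i → d (mul s t) = mul (d s) t + ε k i • mul s (d t)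
  actL : T →ₗ[k] M →ₗ[k] M
  actR : T →ₗ[k] M →ₗ[k] M
  actL_mul : ∀ s t m, actL (mul s t) m = actL s (actL t m)
  actR_mul : ∀ s t m, actR (mul s t) m = actR t (actR s m)
  actLR : ∀ s t m, actR t (actL s m) = actL s (actR t m)
  grM : ℤ → Submodule k M
  actL_mem : ∀ {i j : ℤ} {t : T} {m : M}, t ∈ gr i → m ∈ grM j → actL t m ∈ grM (i + j)
  actR_mem : ∀ {i j : ℤ} {t : T} {m : M}, t ∈ gr i → m ∈ grM j → actR t m ∈ grM (j + i)
  dM : M →ₗ[k] M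
  dM_sq : ∀ m, dM (dM m) = 0
  dM_mem : ∀ {j : ℤ} {m : M}, m ∈ grM j → dM m ∈ grM (j + 1)
  dM_actL : ∀ {i : ℤ} (t : T) (m : M), t ∈ gr i →
    dM (actL t m) = actL (d t) m + ε k i • actL t (dM m)
  dM_actR : ∀ {j : ℤ} (t : T) (m : M), m ∈ grM j →
    dM (actR t m) = actR t (dM m) + ε k j • actR (d t) m

namespace WordData

variable {k}
variable {T : Type} [AddCommGroup T] [Module k T] (S : WordData k T M)

/-- Product of two letters, adding the recorded degrees. -/
def lmul (s t : T × ℤ) : T × ℤ := (S.mul s.1 t.1, s.2 + t.2)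

/-- Differential of a letter. -/
def ld (s : T × ℤ) : T × ℤ := (S.d s.1, s.2 + 1)

/-- Multiply the letters in positions `i` and `i + 1`. -/
def merge (i : ℕ) (w : ℕ → T × ℤ) : ℕ → T × ℤ := fun j =>
  if j < i then w j else if j = i then S.lmul (w i) (w (i + 1)) else w (j + 1)

/-- Apply the differential to the letter in position `i`. -/
def ins (i : ℕ) (w : ℕ → T × ℤ) : ℕ → T × ℤ := fun j => if j = i then S.ld (w i) else w j

/-- Remove the first letter. -/
def shift (w : ℕ → T × ℤ) : ℕ → T × ℤ := fun j => w (j + 1)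

/-- Total degree of the first `n` letters. -/
def deg (n : ℕ) (w : ℕ → T × ℤ) : ℤ := ∑ j ∈ Finset.range n, (w j).2

/-- Every letter is homogeneous of its recorded degree. -/
def Good (w : ℕ → T × ℤ) : Prop := ∀ j, (w j).1 ∈ S.gr (w j).2

/-- The Hochschild differential of a function on words of length `n` and degree `r`. -/
def H (n : ℕ) (r : ℤ) (E : (ℕ → T × ℤ) → M) (w : ℕ → T × ℤ) : M :=
  ε k ((n : ℤ) + r - 1 + r * (w 0).2) • S.actL (w 0).1 (E (shift w))
  + ∑ i ∈ Finset.range n, ε k ((n : ℤ) + r + i) • E (S.merge i w)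
  + ε k r • S.actR (w n).1 (E w)

/-- The internal differential of a function on words of length `n` and degree `r`. -/
def P (n : ℕ) (r : ℤ) (E : (ℕ → T × ℤ) → M) (w : ℕ → T × ℤ) : M :=
  S.dM (E w) - ε k r • ∑ i ∈ Finset.range n, ε k (deg i w) • E (S.ins i w)

variable (k) in
/-- `E` is a multilinear function of the first `n` letters. -/
structure IsCoch (n : ℕ) (E : (ℕ → T × ℤ) → M) : Prop where
  dep : ∀ w w' : ℕ → T × ℤ, (∀ j < n, (w j).1 = (w' j).1) → E w = E w'
  add : ∀ (i : ℕ), i < n → ∀ (w w₁ w₂ : ℕ → T × ℤ) (c : k),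
    (w i).1 = (w₁ i).1 + c • (w₂ i).1 →
    (∀ j < n, j ≠ i → (w j).1 = (w₁ j).1 ∧ (w j).1 = (w₂ j).1) → E w = E w₁ + c • E w₂

/-- `E` is homogeneous of degree `r` on words of length `n`. -/
def IsHom (n : ℕ) (r : ℤ) (E : (ℕ → T × ℤ) → M) : Prop :=
  ∀ w, S.Good w → E w ∈ S.grM (deg n w + r)

variable {S}

theorem IsCoch.zero {n : ℕ} {E : (ℕ → T × ℤ) → M} (hE : IsCoch k n E) {i : ℕ} (hi : i < n)
    {w : ℕ → T × ℤ} (h : (w i).1 = 0) : E w = 0 := by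
  have := hE.add i hi w w w 1 (by simp [h]) (fun j _ _ => ⟨rfl, rfl⟩)
  simpa using this

theorem deg_succ (n : ℕ) (w : ℕ → T × ℤ) : deg (n + 1) w = deg n w + (w n).2 :=
  Finset.sum_range_succ _ _

theorem deg_zero (w : ℕ → T × ℤ) : deg 0 w = 0 := rfl

theorem deg_shift (n : ℕ) (w : ℕ → T × ℤ) : deg (n + 1) w = (w 0).2 + deg n (shift w) := by
  rw [deg, Finset.sum_range_succ', add_comm]; rfl

theorem deg_congr {n : ℕ} {w w' : ℕ → T × ℤ} (h : ∀ j < n, (w j).2 = (w' j).2) :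
    deg n w = deg n w' :=
  Finset.sum_congr rfl fun j hj => h j (Finset.mem_range.mp hj)

theorem deg_merge_of_le {n i : ℕ} (h : n ≤ i) (w : ℕ → T × ℤ) :
    deg n (S.merge i w) = deg n w :=
  deg_congr fun j hj => by simp [merge, show j < i by omega]

theorem deg_merge_of_lt {n i : ℕ} (h : i < n) (w : ℕ → T × ℤ) :
    deg n (S.merge i w) = deg (n + 1) w := by
  induction n with
  | zero => omega
  | succ n ih =>
    rw [deg_succ, deg_succ (n + 1)]
    by_cases hi : i < n
    · rw [ih hi]; simp [merge, show ¬ n < i by omega, show n ≠ i by omega]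
    · obtain rfl : i = n := by omega
      rw [deg_merge_of_le le_rfl, deg_succ]; simp [merge, lmul, add_assoc]

theorem deg_ins_of_le {n i : ℕ} (h : n ≤ i) (w : ℕ → T × ℤ) :
    deg n (S.ins i w) = deg n w :=
  deg_congr fun j hj => by simp [ins, show j ≠ i by omega]

theorem deg_ins_of_lt {n i : ℕ} (h : i < n) (w : ℕ → T × ℤ) :
    deg n (S.ins i w) = deg n w + 1 := by
  induction n with
  | zero => omega
  | succ n ih =>
    rw [deg_succ, deg_succ]
    by_cases hi : i < n
    · rw [ih hi]; simp [ins, show n ≠ i by omega]; ring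
    · obtain rfl : i = n := by omega
      rw [deg_ins_of_le le_rfl]; simp [ins, ld]; ring

theorem Good.merge {w : ℕ → T × ℤ} (hw : S.Good w) (i : ℕ) : S.Good (S.merge i w) := by
  intro j
  simp only [WordData.merge]
  split_ifs
  · exact hw j
  · exact S.mul_mem (hw i) (hw (i + 1))
  · exact hw (j + 1)

theorem Good.ins {w : ℕ → T × ℤ} (hw : S.Good w) (i : ℕ) : S.Good (S.ins i w) := by
  intro j
  simp only [WordData.ins]
  split_ifs with h
  · exact S.d_mem (hw i)
  · exact hw j

theorem Good.shift {w : ℕ → T × ℤ} (hw : S.Good w) : S.Good (shift w) := fun j => hw (j + 1)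

theorem IsHom.H {n : ℕ} {r : ℤ} {E : (ℕ → T × ℤ) → M} (hE : S.IsHom n r E) :
    S.IsHom (n + 1) r (S.H n r E) := by
  intro w hw
  refine add_mem (add_mem ?_ (Submodule.sum_mem _ fun i hi => ?_)) ?_
  · refine Submodule.smul_mem _ _ ?_
    have := S.actL_mem (hw 0) (hE _ hw.shift)
    rwa [← add_assoc, ← deg_shift] at this
  · refine Submodule.smul_mem _ _ ?_
    have := hE _ (hw.merge i)
    rwa [deg_merge_of_lt (Finset.mem_range.mp hi)] at this
  · refine Submodule.smul_mem _ _ ?_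
    have := S.actR_mem (hw n) (hE _ hw)
    rwa [show deg n w + r + (w n).2 = deg (n + 1) w + r by rw [deg_succ]; ring] at this

theorem IsHom.P {n : ℕ} {r : ℤ} {E : (ℕ → T × ℤ) → M} (hE : S.IsHom n r E) :
    S.IsHom n (r + 1) (S.P n r E) := by
  intro w hw
  refine sub_mem ?_ (Submodule.smul_mem _ _ (Submodule.sum_mem _ fun i hi =>
    Submodule.smul_mem _ _ ?_))
  · have := S.dM_mem (hE _ hw)
    rwa [add_assoc] at this
  · have := hE _ (hw.ins i)
    rwa [deg_ins_of_lt (Finset.mem_range.mp hi), add_assoc, add_comm 1 r] at this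

theorem P_P [CharZero k] {n : ℕ} {r : ℤ} {E : (ℕ → T × ℤ) → M} (hE : IsCoch k n E)
    (w : ℕ → T × ℤ) : S.P n (r + 1) (S.P n r E) w = 0 := by
  simp only [P, map_sub, S.dM_sq, map_smul, map_sum, smul_sub, Finset.sum_sub_distrib, ε_succ,
    neg_smul]
  have h : ∑ i ∈ Finset.range n, ε k (deg i w) • ε k r • ∑ j ∈ Finset.range n,
      ε k (deg j (S.ins i w)) • E (S.ins j (S.ins i w)) = 0 := by
    simp only [Finset.smul_sum]
    refine sum_antisymm_eq_zero k _ _ fun i hi j hj => ?_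
    rcases eq_or_ne i j with rfl | hij
    · rw [hE.zero (Finset.mem_range.mp hi) (w := S.ins i (S.ins i w)) (by simp [ins, ld, S.d_sq])]
      simp
    · have hc : S.ins j (S.ins i w) = S.ins i (S.ins j w) := by
        funext l
        simp only [ins]
        split_ifs <;> simp_all
      rw [hc]
      simp only [ε_smul_smul, neg_ε_smul]
      congr 1
      apply ε_congr
      rcases lt_or_gt_of_ne hij with h | h
      · rw [deg_ins_of_lt h, deg_ins_of_le h.le]
        simp only [Int.even_add, Int.not_even_one]; tauto
      · rw [deg_ins_of_le h.le, deg_ins_of_lt h]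
        simp only [Int.even_add, Int.not_even_one]; tauto
  rw [h]
  simp

/-- The Leibniz rule for the total letter differential across a merge. -/
theorem sum_merge_ins {n : ℕ} {E : (ℕ → T × ℤ) → M} (hE : IsCoch k n E) {m : ℕ} (hm : m < n)
    {w : ℕ → T × ℤ} (hw : S.Good w) :
    ∑ i ∈ Finset.range (n + 1), ε k (deg i w) • E (S.merge m (S.ins i w)) =
      ∑ i ∈ Finset.range n, ε k (deg i (S.merge m w)) • E (S.ins i (S.merge m w)) := by
  obtain ⟨l, rfl⟩ : ∃ l, n = m + 1 + l := ⟨n - (m + 1), by omega⟩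
  rw [show m + 1 + l + 1 = m + 1 + 1 + l by ring, Finset.sum_range_add _ (m + 1 + 1) l,
    Finset.sum_range_add _ (m + 1) l, Finset.sum_range_succ _ (m + 1), Finset.sum_range_succ _ m,
    Finset.sum_range_succ _ m, add_assoc (∑ i ∈ Finset.range m, _)]
  congr 1
  · congr 1
    · refine Finset.sum_congr rfl fun i hi => ?_
      have hi := Finset.mem_range.mp hi
      rw [deg_merge_of_le hi.le]
      congr 2
      funext j
      simp only [merge, ins]
      split_ifs <;> first | rfl | omega
    · rw [deg_merge_of_le le_rfl, deg_succ, ← ε_mul_ε, mul_smul, ← smul_add]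
      congr 1
      symm
      refine hE.add m (by omega) _ _ _ _ ?_ ?_
      · simp [merge, ins, lmul, ld, S.d_mul _ _ (hw m)]
      · intro j _ hj
        simp only [merge, ins]
        split_ifs <;> first | exact ⟨rfl, rfl⟩ | omega
  · refine Finset.sum_congr rfl fun i _ => ?_
    rw [deg_merge_of_lt (by omega), show m + 1 + i + 1 = m + 1 + 1 + i by ring]
    congr 2
    funext j
    simp only [merge, ins]
    split_ifs <;> first | rfl | omega | (congr 2; omega)

theorem P_H_add_H_P {n : ℕ} {r : ℤ} {E : (ℕ → T × ℤ) → M} (hE : IsCoch k n E)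
    (hh : S.IsHom n r E) {w : ℕ → T × ℤ} (hw : S.Good w) :
    S.P (n + 1) r (S.H n r E) w + S.H n (r + 1) (S.P n r E) w = 0 := by
  have hmerge : ∀ (i : ℕ), ε k (deg i w) • ∑ m ∈ Finset.range n,
      ε k ((n : ℤ) + r + m) • E (S.merge m (S.ins i w)) =
      ∑ m ∈ Finset.range n, ε k ((n : ℤ) + r + m) • ε k (deg i w) • E (S.merge m (S.ins i w)) := by
    intro i
    rw [Finset.smul_sum]
    exact Finset.sum_congr rfl fun m _ => smul_comm _ _ _
  have hmid : ∑ i ∈ Finset.range (n + 1), ε k (deg i w) • ∑ m ∈ Finset.range n,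
      ε k ((n : ℤ) + r + m) • E (S.merge m (S.ins i w)) =
      ∑ m ∈ Finset.range n, ε k ((n : ℤ) + r + m) • ∑ i ∈ Finset.range n,
        ε k (deg i (S.merge m w)) • E (S.ins i (S.merge m w)) := by
    rw [Finset.sum_congr rfl fun i _ => hmerge i, Finset.sum_comm]
    refine Finset.sum_congr rfl fun m hm => ?_
    rw [← Finset.smul_sum, sum_merge_ins hE (Finset.mem_range.mp hm) hw]
  have hleft : ∑ i ∈ Finset.range (n + 1), ε k (deg i w) •
      ε k ((n : ℤ) + r - 1 + r * (S.ins i w 0).2) •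
        S.actL (S.ins i w 0).1 (E (shift (S.ins i w))) =
      ε k ((n : ℤ) + r - 1 + r * (w 0).2 + r) • S.actL (S.d (w 0).1) (E (shift w))
      + ε k ((n : ℤ) + r - 1 + r * (w 0).2 + (w 0).2) • S.actL (w 0).1
        (∑ i ∈ Finset.range n, ε k (deg i (shift w)) • E (S.ins i (shift w))) := by
    rw [Finset.sum_range_succ', add_comm]
    congr 1
    · rw [deg_zero, ε_zero, one_smul]
      have : shift (S.ins 0 w) = shift w := by funext j; simp [shift, ins]
      rw [this]
      simp only [ins, ld, if_true]
      congr 1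
      apply ε_congr
      simp only [Int.even_add, Int.even_sub, Int.even_mul, Int.not_even_one]; tauto
    · rw [map_sum, Finset.smul_sum]
      refine Finset.sum_congr rfl fun i _ => ?_
      have h1 : shift (S.ins (i + 1) w) = S.ins i (shift w) := by
        funext j; simp [shift, ins]
      have h2 : S.ins (i + 1) w 0 = w 0 := by simp [ins]
      rw [h1, h2, deg_shift, map_smul, ε_smul_smul, ε_smul_smul]
      congr 1
      apply ε_congr
      simp only [Int.even_add, Int.even_sub, Int.even_mul, Int.not_even_one]; tauto
  have hright : ∑ i ∈ Finset.range (n + 1), ε k (deg i w) • ε k r •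
        S.actR (S.ins i w n).1 (E (S.ins i w)) =
      ε k r • S.actR (w n).1 (∑ i ∈ Finset.range n, ε k (deg i w) • E (S.ins i w))
      + ε k (deg n w + r) • S.actR (S.d (w n).1) (E w) := by
    rw [Finset.sum_range_succ]
    congr 1
    · rw [map_sum, Finset.smul_sum]
      refine Finset.sum_congr rfl fun i hi => ?_
      have hi := Finset.mem_range.mp hi
      have h2 : S.ins i w n = w n := by simp [ins, show n ≠ i by omega]
      rw [h2, map_smul, smul_comm]
    · rw [ε_smul_smul, hE.dep (S.ins n w) w fun j hj => by simp [ins, show j ≠ n by omega]]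
      simp [ins, ld]
  have hexp : S.P (n + 1) r (S.H n r E) w =
      ε k ((n : ℤ) + r - 1 + r * (w 0).2) • S.dM (S.actL (w 0).1 (E (shift w)))
      + ∑ i ∈ Finset.range n, ε k ((n : ℤ) + r + i) • S.dM (E (S.merge i w))
      + ε k r • S.dM (S.actR (w n).1 (E w))
      - ε k r • (
        ∑ i ∈ Finset.range (n + 1), ε k (deg i w) •
          ε k ((n : ℤ) + r - 1 + r * (S.ins i w 0).2) •
            S.actL (S.ins i w 0).1 (E (shift (S.ins i w)))
        + ∑ i ∈ Finset.range (n + 1), ε k (deg i w) • ∑ m ∈ Finset.range n,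
            ε k ((n : ℤ) + r + m) • E (S.merge m (S.ins i w))
        + ∑ i ∈ Finset.range (n + 1), ε k (deg i w) • ε k r •
            S.actR (S.ins i w n).1 (E (S.ins i w))) := by
    simp only [P, H, map_add, map_smul, map_sum, ← Finset.sum_add_distrib, smul_add]
  rw [hexp, hleft, hmid, hright, S.dM_actL _ _ (hw 0), S.dM_actR _ _ (hh w hw)]
  simp only [H, P, map_sub, map_smul, smul_sub, Finset.sum_sub_distrib, smul_add]
  have e1 : ∀ i : ℕ, ε k ((n : ℤ) + (r + 1) + i) = -ε k ((n : ℤ) + r + i) := fun i => by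
    rw [← ε_succ]; congr 1; ring
  have e2 : ε k ((n : ℤ) + (r + 1) - 1 + (r + 1) * (w 0).2) =
      -ε k ((n : ℤ) + r - 1 + r * (w 0).2 + (w 0).2) := by
    rw [← ε_succ]; congr 1; ring
  simp only [e1, e2, ε_succ, neg_smul, Finset.sum_neg_distrib, ε_smul_smul]
  have e3 : ε k (r + ((n : ℤ) + r - 1 + r * (w 0).2 + r)) =
      ε k ((n : ℤ) + r - 1 + r * (w 0).2) := by
    apply ε_congr
    simp only [Int.even_add, Int.even_sub, Int.even_mul, Int.not_even_one]; tauto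
  have e4 : ∑ m ∈ Finset.range n, ε k ((n : ℤ) + r + m + r) • ∑ i ∈ Finset.range n,
        ε k (deg i (S.merge m w)) • E (S.ins i (S.merge m w)) =
      ε k r • ∑ m ∈ Finset.range n, ε k ((n : ℤ) + r + m) • ∑ i ∈ Finset.range n,
        ε k (deg i (S.merge m w)) • E (S.ins i (S.merge m w)) := by
    rw [Finset.smul_sum]
    refine Finset.sum_congr rfl fun m _ => ?_
    rw [ε_smul_smul, add_comm r]
  rw [e3, e4, add_comm r (deg n w + r), add_comm r (_ + (w 0).2)]
  abel

/-- The cofaces whose alternating sum is the Hochschild differential. -/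
def coface (S : WordData k T M) (n : ℕ) (r : ℤ) (m : ℕ) (E : (ℕ → T × ℤ) → M)
    (w : ℕ → T × ℤ) : M :=
  if m = 0 then ε k (r * (w 0).2) • S.actL (w 0).1 (E (shift w))
  else if m ≤ n then E (S.merge (m - 1) w) else S.actR (w n).1 (E w)

theorem H_eq_sum_coface (n : ℕ) (r : ℤ) (E : (ℕ → T × ℤ) → M) (w : ℕ → T × ℤ) :
    S.H n r E w = ε k ((n : ℤ) + r - 1) •
      ∑ m ∈ Finset.range (n + 2), ε k m • S.coface n r m E w := by
  rw [Finset.sum_range_succ, Finset.sum_range_succ', smul_add, smul_add, Finset.smul_sum, H]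
  rw [add_comm (∑ i ∈ Finset.range n, _)]
  congr 1
  · congr 1
    · simp only [coface, if_true, Nat.cast_zero, ε_zero, one_smul, ε_smul_smul]
    · refine Finset.sum_congr rfl fun i hi => ?_
      have hi := Finset.mem_range.mp hi
      simp only [coface, Nat.add_eq_zero_iff, one_ne_zero, and_false, if_false,
        show i + 1 ≤ n by omega, if_true, ε_smul_smul, Nat.add_sub_cancel]
      congr 2
      push_cast; ring
  · simp only [coface, Nat.add_eq_zero_iff, one_ne_zero, and_false, if_false,
      show ¬ n + 1 ≤ n by omega, ε_smul_smul]
    congr 1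
    apply ε_congr
    push_cast
    simp only [Int.even_add, Int.even_sub, Int.not_even_one]; tauto

theorem coface_coface {n : ℕ} {r : ℤ} {E : (ℕ → T × ℤ) → M} (hE : IsCoch k n E)
    (w : ℕ → T × ℤ) {i j : ℕ} (hij : i < j) (hj : j < n + 3) :
    S.coface (n + 1) r j (S.coface n r i E) w =
      S.coface (n + 1) r i (S.coface n r (j - 1) E) w := by
  obtain ⟨j, rfl⟩ : ∃ l, j = l + 1 := ⟨j - 1, by omega⟩
  simp only [Nat.add_sub_cancel]
  rcases Nat.eq_zero_or_pos i with rfl | hi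
  · rcases Nat.eq_zero_or_pos j with rfl | hj0
    · have h : S.merge 0 w 0 = S.lmul (w 0) (w 1) := by simp [merge]
      have h' : shift (S.merge 0 w) = shift (shift w) := by funext l; simp [shift, merge]
      simp only [coface, if_true, zero_add, one_ne_zero, if_false, Nat.le_add_left, Nat.sub_self]
      rw [h, h', map_smul, ε_smul_smul]
      simp only [lmul, S.actL_mul, shift, zero_add, mul_add]
    · by_cases hjn : j ≤ n
      · have h : S.merge j w 0 = w 0 := by simp [merge, hj0]
        have h' : shift (S.merge j w) = S.merge (j - 1) (shift w) := by
          obtain ⟨j, rfl⟩ : ∃ l, j = l + 1 := ⟨j - 1, by omega⟩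
          funext l; simp [shift, merge]
        simp only [coface, if_true, Nat.add_eq_zero_iff, one_ne_zero, and_false, if_false,
          Nat.add_le_add_iff_right, hjn, Nat.add_sub_cancel, show j ≠ 0 by omega, h, h']
      · obtain rfl : j = n + 1 := by omega
        simp [coface, S.actLR, shift]
  · by_cases hjn : j ≤ n
    · simp only [coface, Nat.add_eq_zero_iff, one_ne_zero, and_false, if_false,
          Nat.add_le_add_iff_right, hjn, if_true, Nat.add_sub_cancel, show i ≠ 0 by omega,
          show i ≤ n by omega, show i ≤ n + 1 by omega, show j ≠ 0 by omega]
      congr 1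
      obtain ⟨i, rfl⟩ : ∃ l, i = l + 1 := ⟨i - 1, by omega⟩
      obtain ⟨j, rfl⟩ : ∃ l, j = l + 1 := ⟨j - 1, by omega⟩
      simp only [Nat.add_sub_cancel]
      funext l
      simp only [merge]
      split_ifs <;> first
        | rfl
        | omega
        | (subst_vars; simp only [lmul, S.mul_assoc, add_assoc])
    · obtain rfl : j = n + 1 := by omega
      by_cases hin : i ≤ n
      · have h : S.merge (i - 1) w n = w (n + 1) := by
          simp [merge, show ¬ n < i - 1 by omega, show n ≠ i - 1 by omega]
        simp only [coface, Nat.add_eq_zero_iff, one_ne_zero, and_false, if_false, hin, if_true,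
          show i ≠ 0 by omega, show i ≤ n + 1 by omega, show ¬ n + 1 + 1 ≤ n + 1 by omega,
          show ¬ n + 1 ≤ n by omega, h]
      · obtain rfl : i = n + 1 := by omega
        have h : S.merge n w n = S.lmul (w n) (w (n + 1)) := by simp [merge]
        have h' : E (S.merge n w) = E w := hE.dep _ _ fun j hj => by simp [merge, hj]
        simp only [coface, Nat.add_eq_zero_iff, one_ne_zero, and_false, if_false, le_refl, if_true,
          show ¬ n + 1 + 1 ≤ n + 1 by omega, show ¬ n + 1 ≤ n by omega, Nat.add_sub_cancel, h, h']
        simp only [lmul, S.actR_mul]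

theorem coface_smul_sum (n : ℕ) (r : ℤ) (j : ℕ) (s : Finset ℕ) (c : ℕ → k) (c' : k)
    (E : ℕ → (ℕ → T × ℤ) → M) (w : ℕ → T × ℤ) :
    S.coface n r j (fun w => c' • ∑ m ∈ s, c m • E m w) w =
      c' • ∑ m ∈ s, c m • S.coface n r j (E m) w := by
  simp only [coface]
  split_ifs
  · simp only [map_smul, map_sum, Finset.smul_sum, smul_comm (ε k _)]
  · rfl
  · simp only [map_smul, map_sum]

theorem H_H {n : ℕ} {r : ℤ} {E : (ℕ → T × ℤ) → M} (hE : IsCoch k n E) (w : ℕ → T × ℤ) :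
    S.H (n + 1) r (S.H n r E) w = 0 := by
  have hH : S.H n r E = fun w => ε k ((n : ℤ) + r - 1) •
      ∑ m ∈ Finset.range (n + 2), ε k m • S.coface n r m E w :=
    funext fun w => H_eq_sum_coface n r E w
  rw [H_eq_sum_coface, hH]
  simp only [coface_smul_sum, smul_comm (ε k (Nat.cast _)) (ε k ((n : ℤ) + r - 1))]
  rw [← Finset.smul_sum]
  simp only [Finset.smul_sum (s := Finset.range (n + 2)), ε_smul_smul (k := k) (Nat.cast _)]
  rw [sum_alternating_exchange_eq_zero k (n + 2) (fun j i => S.coface (n + 1) r j (S.coface n r i E) w)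
    fun i j hij hj => coface_coface hE w hij (by omega)]
  simp

/-- The total differential of a family of functions on words, of total degree `N`. -/
def D (S : WordData k T M) (N : ℤ) (E : ℕ → (ℕ → T × ℤ) → M) (n : ℕ) (w : ℕ → T × ℤ) : M :=
  match n with
  | 0 => S.P 0 N (E 0) w
  | n + 1 => S.P (n + 1) (N - (n + 1)) (E (n + 1)) w + S.H n (N - n) (E n) w

theorem H_add (n : ℕ) (r : ℤ) (E E' : (ℕ → T × ℤ) → M) (w : ℕ → T × ℤ) :
    S.H n r (fun w => E w + E' w) w = S.H n r E w + S.H n r E' w := by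
  simp only [H, map_add, smul_add, Finset.sum_add_distrib]; abel

theorem P_add (n : ℕ) (r : ℤ) (E E' : (ℕ → T × ℤ) → M) (w : ℕ → T × ℤ) :
    S.P n r (fun w => E w + E' w) w = S.P n r E w + S.P n r E' w := by
  simp only [P, map_add, smul_add, Finset.sum_add_distrib]; abel

theorem D_D [CharZero k] {N : ℤ} {E : ℕ → (ℕ → T × ℤ) → M} (hE : ∀ n, IsCoch k n (E n))
    (hh : ∀ n : ℕ, S.IsHom n (N - n) (E n)) (n : ℕ) {w : ℕ → T × ℤ} (hw : S.Good w) :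
    S.D (N + 1) (S.D N E) n w = 0 := by
  have hP : ∀ n : ℕ, S.P (n + 1) (N + 1 - (n + 1)) (S.P (n + 1) (N - (n + 1)) (E (n + 1))) w = 0 := by
    intro n
    rw [show N + 1 - ((n : ℤ) + 1) = N - (n + 1) + 1 by ring]
    exact P_P (hE (n + 1)) w
  have hPH : ∀ n : ℕ, S.P (n + 1) (N + 1 - (n + 1)) (S.H n (N - n) (E n)) w
      + S.H n (N + 1 - n) (S.P n (N - n) (E n)) w = 0 := by
    intro n
    rw [show N + 1 - ((n : ℤ) + 1) = N - n by ring, show N + 1 - (n : ℤ) = N - n + 1 by ring]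
    exact P_H_add_H_P (hE n) (hh n) hw
  rcases n with _ | _ | n
  · exact P_P (hE 0) w
  · have h1 := hP 0
    have h2 := hPH 0
    have h0 : S.D N E 0 = S.P 0 (N - (0 : ℕ)) (E 0) := by funext w; simp [D]
    change S.P 1 _ (fun w => S.P 1 _ (E 1) w + S.H 0 _ (E 0) w) w + S.H 0 _ (S.D N E 0) w = 0
    rw [P_add, h0, add_assoc]
    exact (congrArg₂ (· + ·) h1 h2).trans (add_zero 0)
  · have h1 := hP (n + 1)
    have h2 := hPH (n + 1)
    have h3 : S.H (n + 1) (N + 1 - ((n + 1 : ℕ) : ℤ)) (S.H n (N - n) (E n)) w = 0 := by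
      rw [show N + 1 - ((n + 1 : ℕ) : ℤ) = N - n by push_cast; ring]
      exact H_H (hE n) w
    change S.P (n + 2) _ (fun w => S.P (n + 2) _ (E (n + 2)) w + S.H (n + 1) _ (E (n + 1)) w) w
      + S.H (n + 1) _ (fun w => S.P (n + 1) _ (E (n + 1)) w + S.H n _ (E n) w) w = 0
    rw [P_add, H_add, h3, add_zero, add_assoc]
    refine (congrArg₂ (· + ·) h1 ?_).trans (add_zero 0)
    rw [← h2]
    push_cast
    rfl

theorem IsHom.D {N : ℤ} {E : ℕ → (ℕ → T × ℤ) → M} (hh : ∀ n : ℕ, S.IsHom n (N - n) (E n))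
    (n : ℕ) : S.IsHom n (N + 1 - n) (S.D N E n) := by
  intro w hw
  cases n with
  | zero =>
    have := (hh 0).P w hw
    simpa [WordData.D] using this
  | succ n =>
    refine add_mem ?_ ?_
    · have := (hh (n + 1)).P w hw
      push_cast at this ⊢
      rwa [show N - ((n : ℤ) + 1) + 1 = N + 1 - (n + 1) by ring] at this
    · have := (hh n).H w hw
      have h : deg (n + 1) w + (N - n) = deg (n + 1) w + (N + 1 - ((n + 1 : ℕ) : ℤ)) := by
        push_cast; ring
      rw [← h]
      exact this

end WordData

/- ### The triangular dg algebra of a dg `A`-`B`-bimodule -/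

/-- The upper triangular dg algebra with diagonal `A`, `B` and corner `X`, acting on `X`. -/
def triData (SX : ABBimod k RA RB X) : WordData k (A × X × B) X where
  mul := LinearMap.mk₂ k
    (fun s t => (s.1 * t.1, SX.actL s.1 t.2.1 + SX.actR t.2.2 s.2.1, s.2.2 * t.2.2))
    (fun s s' t => by ext <;> simp [add_mul]; abel)
    (fun c s t => by ext <;> simp)
    (fun s t t' => by ext <;> simp [mul_add]; abel)
    (fun c s t => by ext <;> simp)
  mul_assoc s t u := by
    ext <;> simp [mul_assoc, SX.actL_mul, SX.actR_mul, SX.actLR, add_assoc]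
  d := RA.d.prodMap (SX.dX.prodMap RB.d)
  d_sq t := by ext <;> simp [RA.d_sq, SX.dX_sq, RB.d_sq]
  gr i := (RA.gr i).prod ((SX.gr i).prod (RB.gr i))
  mul_mem hs ht := ⟨RA.mul_mem hs.1 ht.1,
    add_mem (SX.actL_mem hs.1 ht.2.1) (SX.actR_mem ht.2.2 hs.2.1), RB.mul_mem hs.2.2 ht.2.2⟩
  d_mem h := ⟨RA.d_mem h.1, SX.dX_mem h.2.1, RB.d_mem h.2.2⟩
  d_mul s t hs := by
    ext
    · simp [RA.d_leibniz _ _ hs.1]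
    · simp [SX.dX_actL _ _ hs.1, SX.dX_actR _ _ hs.2.1]; abel
    · simp [RB.d_leibniz _ _ hs.2.2]
  actL := SX.actL ∘ₗ LinearMap.fst k A (X × B)
  actR := SX.actR ∘ₗ LinearMap.snd k X B ∘ₗ LinearMap.snd k A (X × B)
  actL_mul s t m := by simp [SX.actL_mul]
  actR_mul s t m := by simp [SX.actR_mul]
  actLR s t m := by simp [SX.actLR]
  grM := SX.gr
  actL_mem ht hm := SX.actL_mem ht.1 hm
  actR_mem ht hm := SX.actR_mem ht.2.2 hm
  dM := SX.dX
  dM_sq := SX.dX_sq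
  dM_mem h := SX.dX_mem h
  dM_actL t m ht := SX.dX_actL _ _ ht.1
  dM_actR t m hm := SX.dX_actR _ _ hm

/-- The word `a₀ ⋯ a_{p-1} x b₀ b₁ ⋯` of the triangular algebra. -/
def word (p : ℕ) (a : ℕ → A × ℤ) (x : X × ℤ) (b : ℕ → B × ℤ) : ℕ → (A × X × B) × ℤ := fun j =>
  if j < p then (((a j).1, 0, 0), (a j).2)
  else if j = p then ((0, x.1, 0), x.2)
  else ((0, 0, (b (j - p - 1)).1), (b (j - p - 1)).2)

/-- Multiply two letters of a sequence in a dg algebra. -/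
def seqMerge (i : ℕ) (a : ℕ → A × ℤ) : ℕ → A × ℤ := fun j =>
  if j < i then a j else if j = i then ((a i).1 * (a (i + 1)).1, (a i).2 + (a (i + 1)).2)
  else a (j + 1)

variable {k}

/-- Apply the differential to a letter of a sequence in a dg algebra. -/
def seqIns (R : DGAlgebra k A) (i : ℕ) (a : ℕ → A × ℤ) : ℕ → A × ℤ := fun j =>
  if j = i then (R.d (a i).1, (a i).2 + 1) else a j

/-- Every letter of the sequence is homogeneous of its recorded degree. -/
def SeqGood (R : DGAlgebra k A) (a : ℕ → A × ℤ) : Prop := ∀ j, (a j).1 ∈ R.gr (a j).2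

theorem SeqGood.merge {a : ℕ → A × ℤ} (ha : SeqGood R a) (i : ℕ) : SeqGood R (seqMerge i a) := by
  intro j
  simp only [seqMerge]
  split_ifs
  · exact ha j
  · exact R.mul_mem (ha i) (ha (i + 1))
  · exact ha (j + 1)

theorem SeqGood.ins {a : ℕ → A × ℤ} (ha : SeqGood R a) (i : ℕ) : SeqGood R (seqIns R i a) := by
  intro j
  simp only [seqIns]
  split_ifs with h
  · exact R.d_mem (ha i)
  · exact ha j

theorem SeqGood.shift {a : ℕ → A × ℤ} (ha : SeqGood R a) : SeqGood R (fun j => a (j + 1)) :=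
  fun j => ha (j + 1)

variable {SX : ABBimod k RA RB X}

theorem good_word {p : ℕ} {a : ℕ → A × ℤ} {x : X × ℤ} {b : ℕ → B × ℤ} (ha : SeqGood RA a)
    (hx : x.1 ∈ SX.gr x.2) (hb : SeqGood RB b) : (triData k SX).Good (word p a x b) := by
  intro j
  simp only [word]
  split_ifs
  · exact ⟨ha j, zero_mem _, zero_mem _⟩
  · exact ⟨zero_mem _, hx, zero_mem _⟩
  · exact ⟨zero_mem _, zero_mem _, hb _⟩

section words

variable {p i : ℕ} {a : ℕ → A × ℤ} {x : X × ℤ} {b : ℕ → B × ℤ}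

theorem triData_lmul (s t : (A × X × B) × ℤ) : (triData k SX).lmul s t =
    ((s.1.1 * t.1.1, SX.actL s.1.1 t.1.2.1 + SX.actR t.1.2.2 s.1.2.1, s.1.2.2 * t.1.2.2),
      s.2 + t.2) := rfl

theorem triData_ld (s : (A × X × B) × ℤ) : (triData k SX).ld s =
    ((RA.d s.1.1, SX.dX s.1.2.1, RB.d s.1.2.2), s.2 + 1) := rfl

theorem shift_word : WordData.shift (word (p + 1) a x b) = word p (fun j => a (j + 1)) x b := by
  funext j
  simp only [WordData.shift, word]
  split_ifs <;> first | rfl | omega | (rw [show j + 1 - (p + 1) - 1 = j - p - 1 by omega])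

theorem merge_word_of_lt (h : i < p) :
    (triData k SX).merge i (word (p + 1) a x b) = word p (seqMerge i a) x b := by
  funext j
  simp only [WordData.merge, word, seqMerge, triData_lmul]
  split_ifs <;> first | rfl | omega | simp

theorem merge_word_left :
    (triData k SX).merge p (word (p + 1) a x b)
      = word p a (SX.actL (a p).1 x.1, (a p).2 + x.2) b := by
  funext j
  simp only [WordData.merge, word, triData_lmul]
  split_ifs <;> first
    | rfl | omega | (subst_vars; simp)

theorem merge_word_right :
    (triData k SX).merge p (word p a x b)
      = word p a (SX.actR (b 0).1 x.1, x.2 + (b 0).2) (fun j => b (j + 1)) := by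
  funext j
  simp only [WordData.merge, word, triData_lmul]
  split_ifs <;> first
    | rfl | omega | (subst_vars; simp; done)
    | (rw [show j + 1 - p - 1 = j - p - 1 + 1 by omega])

theorem merge_word_of_gt :
    (triData k SX).merge (p + (i + 1)) (word p a x b) = word p a x (seqMerge i b) := by
  funext j
  simp only [WordData.merge, word, seqMerge, triData_lmul]
  split_ifs <;> first
    | rfl | omega
    | (simp [show p + (i + 1) + 1 - p - 1 = i + 1 by omega]; done)
    | (rw [show j + 1 - p - 1 = j - p - 1 + 1 by omega])

theorem ins_word_of_lt (h : i < p) :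
    (triData k SX).ins i (word p a x b) = word p (seqIns RA i a) x b := by
  funext j
  simp only [WordData.ins, word, seqIns, triData_ld]
  split_ifs <;> first | rfl | omega | simp

theorem ins_word_self :
    (triData k SX).ins p (word p a x b) = word p a (SX.dX x.1, x.2 + 1) b := by
  funext j
  simp only [WordData.ins, word, triData_ld]
  split_ifs <;> first | rfl | omega | simp

theorem ins_word_of_gt :
    (triData k SX).ins (p + 1 + i) (word p a x b) = word p a x (seqIns RB i b) := by
  funext j
  simp only [WordData.ins, word, seqIns, triData_ld]
  split_ifs <;> first | rfl | omega | simp [show p + 1 + i - p - 1 = i by omega]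

end words

/- ### Cochains of a bimodule as functions on words -/

/-- The function on words defined by a cochain of type `(p, q)`. -/
def wordEval (p q : ℕ) (f : XCoch k A B X p q) (w : ℕ → (A × X × B) × ℤ) : X :=
  f (fun i => (w i).1.1) (w p).1.2.1 (fun j => (w (p + 1 + j)).1.2.2)

/-- The function on words of length `n` defined by a total cochain. -/
def wordTot (c : TotXCoch k A B X) (n : ℕ) (w : ℕ → (A × X × B) × ℤ) : X :=
  ∑ p ∈ Finset.range n, wordEval p (n - 1 - p) (c p (n - 1 - p)) w

theorem isCoch_wordEval {p q n : ℕ} (hn : n = p + q + 1) (f : XCoch k A B X p q) :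
    WordData.IsCoch k n (wordEval p q f) where
  dep w w' h := by
    simp only [wordEval]
    rw [h p (by omega)]
    congr 2
    · congr 1
      funext i
      rw [h i (by omega)]
    · funext j
      rw [h _ (by omega)]
  add i hi w w₁ w₂ c h hne := by
    have key : ∀ l < n, l ≠ i → (w₁ l).1 = (w l).1 ∧ (w₂ l).1 = (w l).1 := fun l hl hli =>
      ⟨(hne l hl hli).1.symm, (hne l hl hli).2.symm⟩
    simp only [wordEval]
    rcases lt_trichotomy i p with hip | rfl | hip
    · have e : ∀ v : ℕ → (A × X × B) × ℤ, (∀ l < n, l ≠ i → (v l).1 = (w l).1) →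
          (fun j : Fin p => (v j).1.1)
            = Function.update (fun j : Fin p => (w j).1.1) ⟨i, hip⟩ (v i).1.1 := by
        intro v hv
        funext j
        by_cases hj : j = ⟨i, hip⟩
        · subst hj; simp
        · rw [Function.update_of_ne hj, hv j (by omega) (fun h' => hj (Fin.ext h'))]
      rw [e w (fun _ _ _ => rfl), e w₁ (fun l hl h' => (key l hl h').1),
        e w₂ (fun l hl h' => (key l hl h').2), h, (key p (by omega) (by omega)).1,
        (key p (by omega) (by omega)).2, Prod.fst_add, Prod.smul_fst, f.map_update_add,
        f.map_update_smul]
      simp only [LinearMap.add_apply, LinearMap.smul_apply, add_apply,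
        smul_apply]
      congr 3 <;> · funext j; first
                      | rw [(key _ (by omega) (by omega)).1] | rw [(key _ (by omega) (by omega)).2]
    · have e : ∀ v : ℕ → (A × X × B) × ℤ, (∀ l < n, l ≠ i → (v l).1 = (w l).1) →
          (fun j : Fin i => (v j).1.1) = (fun j : Fin i => (w j).1.1) := by
        intro v hv
        funext j
        rw [hv j (by omega) (by omega)]
      rw [e w₁ (fun l hl h' => (key l hl h').1), e w₂ (fun l hl h' => (key l hl h').2), h]
      simp only [Prod.snd_add, Prod.fst_add, Prod.smul_snd, Prod.smul_fst, map_add, map_smul,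
        add_apply, smul_apply]
      congr 3 <;> · funext j; first
                      | rw [(key _ (by omega) (by omega)).1] | rw [(key _ (by omega) (by omega)).2]
    · obtain ⟨j, rfl⟩ : ∃ j, i = p + 1 + j := ⟨i - p - 1, by omega⟩
      have hj : j < q := by omega
      have e : ∀ v : ℕ → (A × X × B) × ℤ, (∀ l < n, l ≠ p + 1 + j → (v l).1 = (w l).1) →
          (fun l : Fin q => (v (p + 1 + l)).1.2.2)
            = Function.update (fun l : Fin q => (w (p + 1 + l)).1.2.2) ⟨j, hj⟩
              (v (p + 1 + j)).1.2.2 := by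
        intro v hv
        funext l
        by_cases hl : l = ⟨j, hj⟩
        · subst hl; simp
        · have : (l : ℕ) ≠ j := fun h' => hl (Fin.ext h')
          rw [Function.update_of_ne hl, hv (p + 1 + l) (by omega) (by omega)]
      have e' : ∀ v : ℕ → (A × X × B) × ℤ, (∀ l < n, l ≠ p + 1 + j → (v l).1 = (w l).1) →
          (fun j : Fin p => (v j).1.1) = (fun j : Fin p => (w j).1.1) := by
        intro v hv
        funext l
        rw [hv l (by omega) (by omega)]
      have h₁ := fun l hl h' => (key l hl h').1
      have h₂ := fun l hl h' => (key l hl h').2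
      rw [e w (fun _ _ _ => rfl), e w₁ h₁, e w₂ h₂, e' w₁ h₁, e' w₂ h₂, h,
        h₁ p (by omega) (by omega), h₂ p (by omega) (by omega)]
      simp only [Prod.snd_add, Prod.smul_snd, MultilinearMap.map_update_add,
        MultilinearMap.map_update_smul]

theorem isCoch_wordTot (c : TotXCoch k A B X) (n : ℕ) : WordData.IsCoch k n (wordTot c n) := by
  have h : ∀ p ∈ Finset.range n, WordData.IsCoch k n (wordEval p (n - 1 - p) (c p (n - 1 - p))) :=
    fun p hp => isCoch_wordEval (by have := Finset.mem_range.mp hp; omega) _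
  refine ⟨fun w w' hw => Finset.sum_congr rfl fun p hp => (h p hp).dep w w' hw,
    fun i hi w w₁ w₂ e he hne => ?_⟩
  simp only [wordTot, Finset.smul_sum, ← Finset.sum_add_distrib]
  exact Finset.sum_congr rfl fun p hp => (h p hp).add i hi w w₁ w₂ e he hne

theorem isHom_wordTot {N : ℤ} {c : TotXCoch k A B X} (hc : TotHomogX k SX N c) (n : ℕ) :
    (triData k SX).IsHom n (N - n) (wordTot c n) := by
  intro w hw
  refine sum_mem fun p hp => ?_
  have hp' := Finset.mem_range.mp hp
  obtain ⟨q, rfl⟩ : ∃ q, n = p + 1 + q := ⟨n - 1 - p, by omega⟩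
  rw [show p + 1 + q - 1 - p = q by omega]
  have := hc p q (fun i => (w i).2) (fun i => (w i).1.1) (fun i => (hw i).1)
    (w p).2 (w p).1.2.1 (hw p).2.1 (fun j => (w (p + 1 + j)).2) (fun j => (w (p + 1 + j)).1.2.2)
    (fun j => (hw _).2.2)
  have hdeg : WordData.deg (p + 1 + q) w + (N - ((p + 1 + q : ℕ) : ℤ))
      = (∑ i : Fin p, (w i).2) + (w p).2 + (∑ j : Fin q, (w (p + 1 + j)).2)
        + (N - p - q - 1) := by
    rw [WordData.deg, Finset.sum_range_add, Finset.sum_range_succ,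
      Fin.sum_univ_eq_sum_range (fun i => (w i).2),
      Fin.sum_univ_eq_sum_range (fun i => (w (p + 1 + i)).2)]
    push_cast
    ring
  rw [hdeg]
  exact this

theorem wordTot_word (c : TotXCoch k A B X) (p q : ℕ) (a : ℕ → A × ℤ) (x : X × ℤ)
    (b : ℕ → B × ℤ) : wordTot c (p + q + 1) (word p a x b)
      = c p q (fun i => (a i).1) x.1 (fun j => (b j).1) := by
  rw [wordTot, Finset.sum_eq_single p]
  · rw [show p + q + 1 - 1 - p = q by omega, wordEval]
    congr 2
    · congr 1
      funext i
      simp [word]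
    · simp [word]
    · funext j
      simp only [word, show ¬ p + 1 + (j : ℕ) < p by omega, show ¬ p + 1 + (j : ℕ) = p by omega,
        if_false]
      rw [show p + 1 + (j : ℕ) - p - 1 = j by omega]
  · intro p' hp' hne
    rw [wordEval]
    rcases lt_or_gt_of_ne hne with h | h
    · have : (word p a x b p').1.2.1 = 0 := by simp [word, h]
      rw [this]
      simp
    · rw [MultilinearMap.map_coord_zero _ (⟨p, h⟩ : Fin p') (by simp [word])]
      simp
  · simp

section differential

variable {dXL : ∀ (p q : ℕ) (r : ℤ), XCoch k A B X p q →ₗ[k] XCoch k A B X (p + 1) q}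
variable {dXR : ∀ (p q : ℕ) (r : ℤ), XCoch k A B X p q →ₗ[k] XCoch k A B X p (q + 1)}
variable {pdX : ∀ (p q : ℕ) (r : ℤ), XCoch k A B X p q →ₗ[k] XCoch k A B X p q}

/-- The left Hochschild part of the total differential in degree `N`. -/
def totL (dXL : ∀ (p q : ℕ) (r : ℤ), XCoch k A B X p q →ₗ[k] XCoch k A B X (p + 1) q)
    (N : ℤ) (c : TotXCoch k A B X) : TotXCoch k A B X
  | 0, _ => 0
  | p + 1, q => dXL p q (N - p - q - 1) (c p q)

/-- The right Hochschild part of the total differential in degree `N`. -/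
def totR (dXR : ∀ (p q : ℕ) (r : ℤ), XCoch k A B X p q →ₗ[k] XCoch k A B X p (q + 1))
    (N : ℤ) (c : TotXCoch k A B X) : TotXCoch k A B X
  | _, 0 => 0
  | p, q + 1 => dXR p q (N - p - q - 1) (c p q)

theorem totDXonly_apply (N : ℤ) (c : TotXCoch k A B X) (p q : ℕ) :
    TotDXonly k dXL dXR pdX N c p q
      = pdX p q (N - p - q - 1) (c p q) + totL dXL N c p q + totR dXR N c p q := by
  rcases p with _ | p <;> rcases q with _ | q <;>
    simp [TotDXonly, TotDXpart, totL, totR]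

theorem totL_word (hL : IsDXL k SX dXL) {N : ℤ} {c : TotXCoch k A B X} (p q : ℕ)
    {a : ℕ → A × ℤ} (x : X × ℤ) (b : ℕ → B × ℤ) (ha : SeqGood RA a) :
    totL dXL N c (p + 1) q (fun i => (a i).1) x.1 (fun j => (b j).1)
      = ε k (((p + 1 + q : ℕ) : ℤ) + (N - ((p + 1 + q : ℕ) : ℤ)) - 1
            + (N - ((p + 1 + q : ℕ) : ℤ)) * (a 0).2) •
          SX.actL (a 0).1 (wordTot c (p + q + 1) (word p (fun j => a (j + 1)) x b))
        + ∑ i ∈ Finset.range p, ε k (((p + 1 + q : ℕ) : ℤ) + (N - ((p + 1 + q : ℕ) : ℤ)) + i) •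
            wordTot c (p + q + 1) (word p (seqMerge i a) x b)
        + ε k (((p + 1 + q : ℕ) : ℤ) + (N - ((p + 1 + q : ℕ) : ℤ)) + p) •
            wordTot c (p + q + 1) (word p a (SX.actL (a p).1 x.1, (a p).2 + x.2) b) := by
  rw [totL, hL p q _ (c p q) (fun i => (a i).2) (fun i => (a i).1) ha x.1 (fun j => (b j).1)]
  simp only [wordTot_word]
  rw [← Fin.sum_univ_eq_sum_range (fun i => ε k (((p + 1 + q : ℕ) : ℤ)
    + (N - ((p + 1 + q : ℕ) : ℤ)) + i) •
      c p q (fun l => (seqMerge i a l).1) x.1 (fun j => (b j).1))]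
  congr 1
  congr 1
  · rw [show (N - (p : ℤ) - q - 1) = N - ((p + 1 + q : ℕ) : ℤ) by push_cast; ring]
    congr 2
    push_cast; ring
  · refine Finset.sum_congr rfl fun i _ => ?_
    congr 2
    · push_cast; ring
    · congr 2
      funext l
      simp only [seqMerge]
      split_ifs <;> rfl
  · congr 1
    refine ε_congr k ?_
    push_cast
    rw [show (q : ℤ) + (N - p - q - 1) + 1 = (p + 1 + q + (N - (p + 1 + q)) + p) + 2 * (-p) by ring]
    simp [Int.even_add]

theorem totR_word (hR : IsDXR k SX dXR) {N : ℤ} {c : TotXCoch k A B X} (p q : ℕ)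
    (a : ℕ → A × ℤ) (x : X × ℤ) (b : ℕ → B × ℤ) :
    totR dXR N c p (q + 1) (fun i => (a i).1) x.1 (fun j => (b j).1)
      = ε k (((p + (q + 1) : ℕ) : ℤ) + (N - ((p + (q + 1) : ℕ) : ℤ)) + ((p + 0 : ℕ) : ℤ)) •
          wordTot c (p + q + 1)
            (word p a (SX.actR (b 0).1 x.1, x.2 + (b 0).2) (fun j => b (j + 1)))
        + ∑ j ∈ Finset.range q,
            ε k (((p + (q + 1) : ℕ) : ℤ) + (N - ((p + (q + 1) : ℕ) : ℤ))
              + ((p + (j + 1) : ℕ) : ℤ)) •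
            wordTot c (p + q + 1) (word p a x (seqMerge j b))
        + ε k (N - ((p + (q + 1) : ℕ) : ℤ)) •
          SX.actR (b q).1 (wordTot c (p + q + 1) (word p a x b)) := by
  rw [totR, hR p q _ (c p q) (fun i => (a i).1) x.1 (fun j => (b j).1)]
  simp only [wordTot_word]
  rw [← Fin.sum_univ_eq_sum_range (fun j => ε k (((p + (q + 1) : ℕ) : ℤ)
    + (N - ((p + (q + 1) : ℕ) : ℤ)) + ((p + (j + 1) : ℕ) : ℤ)) •
      c p q (fun l => (a l).1) x.1 (fun l => (seqMerge j b l).1))]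
  congr 1
  congr 1
  · congr 1
    refine ε_congr k ?_
    push_cast
    rw [show (q : ℤ) + (N - p - q - 1) - 1
      = (p + (q + 1) + (N - (p + (q + 1))) + (p + 0)) + 2 * (-p - 1) by ring]
    simp [Int.even_add]
  · refine Finset.sum_congr rfl fun i _ => ?_
    congr 1
    · refine ε_congr k ?_
      push_cast
      rw [show (q : ℤ) + (N - p - q - 1) + i
        = (p + (q + 1) + (N - (p + (q + 1))) + (p + (i + 1))) + 2 * (-p - 1) by ring]
      simp [Int.even_add]
    · congr 1
      funext l
      simp only [seqMerge]
      split_ifs <;> rfl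
  · congr 2
    push_cast; ring

theorem H_word (hL : IsDXL k SX dXL) (hR : IsDXR k SX dXR) (N : ℤ) (c : TotXCoch k A B X)
    (p q : ℕ) {a : ℕ → A × ℤ} (x : X × ℤ) (b : ℕ → B × ℤ) (ha : SeqGood RA a) :
    (triData k SX).H (p + q) (N - ((p + q : ℕ) : ℤ)) (wordTot c (p + q)) (word p a x b)
      = totL dXL N c p q (fun i => (a i).1) x.1 (fun j => (b j).1)
        + totR dXR N c p q (fun i => (a i).1) x.1 (fun j => (b j).1) := by
  have h0 : ∀ t m, (triData k SX).actL t m = SX.actL t.1 m := fun _ _ => rfl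
  have h1 : ∀ t m, (triData k SX).actR t m = SX.actR t.2.2 m := fun _ _ => rfl
  have hleft : ε k (((p + q : ℕ) : ℤ) + (N - ((p + q : ℕ) : ℤ)) - 1
        + (N - ((p + q : ℕ) : ℤ)) * (word p a x b 0).2) •
        (triData k SX).actL (word p a x b 0).1
          (wordTot c (p + q) (WordData.shift (word p a x b)))
      + ∑ i ∈ Finset.range p, ε k (((p + q : ℕ) : ℤ) + (N - ((p + q : ℕ) : ℤ)) + i) •
          wordTot c (p + q) ((triData k SX).merge i (word p a x b))
      = totL dXL N c p q (fun i => (a i).1) x.1 (fun j => (b j).1) := by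
    cases p with
    | zero => simp [h0, word, totL]
    | succ p =>
      rw [totL_word hL p q x b ha, Finset.sum_range_succ, merge_word_left, shift_word, h0,
        ← add_assoc, Nat.add_right_comm p 1 q]
      congr 2
      refine Finset.sum_congr rfl fun i hi => ?_
      rw [merge_word_of_lt (Finset.mem_range.mp hi)]
  have hright : ∑ j ∈ Finset.range q, ε k (((p + q : ℕ) : ℤ) + (N - ((p + q : ℕ) : ℤ))
          + ((p + j : ℕ) : ℤ)) •
          wordTot c (p + q) ((triData k SX).merge (p + j) (word p a x b))
      + ε k (N - ((p + q : ℕ) : ℤ)) • (triData k SX).actR (word p a x b (p + q)).1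
          (wordTot c (p + q) (word p a x b))
      = totR dXR N c p q (fun i => (a i).1) x.1 (fun j => (b j).1) := by
    cases q with
    | zero => simp [h1, word, totR]
    | succ q =>
      rw [totR_word hR p q a x b, Finset.sum_range_succ',
        show (triData k SX).merge (p + 0) (word p a x b) = _ from merge_word_right, h1]
      have hq : (word p a x b (p + (q + 1))).1.2.2 = (b q).1 := by
        simp [word]
      rw [hq, add_comm (Finset.sum _ _)]
      congr 2
      refine Finset.sum_congr rfl fun j _ => ?_
      rw [merge_word_of_gt]
      rfl
  rw [← hleft, ← hright, WordData.H, Finset.sum_range_add]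
  abel

theorem deg_word_of_le {p i : ℕ} (h : i ≤ p) (a : ℕ → A × ℤ) (x : X × ℤ) (b : ℕ → B × ℤ) :
    WordData.deg i (word p a x b) = ∑ j ∈ Finset.range i, (a j).2 :=
  Finset.sum_congr rfl fun j hj => by
    have := Finset.mem_range.mp hj
    simp [word, show j < p by omega]

theorem deg_word_of_gt (p i : ℕ) (a : ℕ → A × ℤ) (x : X × ℤ) (b : ℕ → B × ℤ) :
    WordData.deg (p + 1 + i) (word p a x b)
      = (∑ j ∈ Finset.range p, (a j).2) + x.2 + ∑ j ∈ Finset.range i, (b j).2 := by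
  rw [WordData.deg, Finset.sum_range_add]
  change WordData.deg (p + 1) (word p a x b) + _ = _
  rw [WordData.deg_succ, deg_word_of_le le_rfl]
  congr 1
  · simp [word]
  · refine Finset.sum_congr rfl fun j _ => ?_
    simp [word, show ¬ p + 1 + j < p by omega, show ¬ p + 1 + j = p by omega,
      show p + 1 + j - p - 1 = j by omega]

theorem P_word (hP : IsPdX k SX pdX) (r : ℤ) (c : TotXCoch k A B X)
    (p q : ℕ) {a : ℕ → A × ℤ} {x : X × ℤ} {b : ℕ → B × ℤ} (ha : SeqGood RA a)
    (hx : x.1 ∈ SX.gr x.2) (hb : SeqGood RB b) :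
    (triData k SX).P (p + q + 1) r (wordTot c (p + q + 1)) (word p a x b)
      = pdX p q r (c p q) (fun i => (a i).1) x.1 (fun j => (b j).1) := by
  have hd : ∀ m, (triData k SX).dM m = SX.dX m := fun _ => rfl
  rw [hP p q r (c p q) (fun i => (a i).2) (fun i => (a i).1) ha x.2 x.1 hx (fun i => (b i).2)
    (fun i => (b i).1) hb, WordData.P, hd, wordTot_word]
  congr 2
  rw [Nat.add_right_comm p q 1, Finset.sum_range_add, Finset.sum_range_succ,
    Nat.add_right_comm p 1 q]
  congr 1
  · congr 1
    · rw [Finset.sum_range]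
      refine Finset.sum_congr rfl fun i _ => ?_
      rw [ins_word_of_lt i.2, deg_word_of_le i.2.le, wordTot_word]
      congr 3
      congr 1
      funext l
      simp only [seqIns]
      split_ifs <;> rfl
    · rw [ins_word_self, deg_word_of_le le_rfl, wordTot_word]
  · rw [Finset.sum_range]
    refine Finset.sum_congr rfl fun i _ => ?_
    rw [ins_word_of_gt, deg_word_of_gt, wordTot_word]
    congr 2
    funext l
    simp only [seqIns]
    split_ifs <;> rfl

theorem D_wordTot (hL : IsDXL k SX dXL) (hR : IsDXR k SX dXR) (hP : IsPdX k SX pdX) (N : ℤ)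
    (c : TotXCoch k A B X) (p q : ℕ) {a : ℕ → A × ℤ} {x : X × ℤ} {b : ℕ → B × ℤ}
    (ha : SeqGood RA a) (hx : x.1 ∈ SX.gr x.2) (hb : SeqGood RB b) :
    (triData k SX).D N (wordTot c) (p + q + 1) (word p a x b)
      = TotDXonly k dXL dXR pdX N c p q (fun i => (a i).1) x.1 (fun j => (b j).1) := by
  rw [WordData.D, H_word hL hR N c p q x b ha, P_word hP _ c p q ha hx hb, totDXonly_apply,
    show N - (((p + q : ℕ) : ℤ) + 1) = N - p - q - 1 by push_cast; ring]
  simp only [LinearMap.add_apply, add_apply]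
  abel

theorem D_congr_word {E E' : ℕ → (ℕ → (A × X × B) × ℤ) → X} (N : ℤ)
    (h : ∀ (p q : ℕ) (a : ℕ → A × ℤ) (x : X × ℤ) (b : ℕ → B × ℤ), SeqGood RA a →
      x.1 ∈ SX.gr x.2 → SeqGood RB b →
      E (p + q + 1) (word p a x b) = E' (p + q + 1) (word p a x b))
    (p q : ℕ) {a : ℕ → A × ℤ} {x : X × ℤ} {b : ℕ → B × ℤ}
    (ha : SeqGood RA a) (hx : x.1 ∈ SX.gr x.2) (hb : SeqGood RB b) :
    (triData k SX).D N E (p + q + 1) (word p a x b)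
      = (triData k SX).D N E' (p + q + 1) (word p a x b) := by
  have h' : ∀ (n p : ℕ) (a : ℕ → A × ℤ) (x : X × ℤ) (b : ℕ → B × ℤ), p < n → SeqGood RA a →
      x.1 ∈ SX.gr x.2 → SeqGood RB b → E n (word p a x b) = E' n (word p a x b) := by
    intro n p a x b hp
    obtain ⟨q, rfl⟩ : ∃ q, n = p + q + 1 := ⟨n - 1 - p, by omega⟩
    exact h p q a x b
  have h0 : ∀ t m, (triData k SX).actL t m = SX.actL t.1 m := fun _ _ => rfl
  have h1 : ∀ t m, (triData k SX).actR t m = SX.actR t.2.2 m := fun _ _ => rfl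
  rw [WordData.D, WordData.D, WordData.P, WordData.P, WordData.H, WordData.H]
  congr 1
  · rw [h p q a x b ha hx hb]
    congr 2
    refine Finset.sum_congr rfl fun i hi => ?_
    congr 1
    rcases lt_trichotomy i p with hip | rfl | hip
    · rw [ins_word_of_lt hip]
      exact h p q _ _ _ (ha.ins i) hx hb
    · rw [ins_word_self]
      exact h i q _ _ _ ha (SX.dX_mem hx) hb
    · obtain ⟨j, rfl⟩ : ∃ j, i = p + 1 + j := ⟨i - p - 1, by omega⟩
      rw [ins_word_of_gt]
      exact h p q _ _ _ ha hx (hb.ins j)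
  · congr 1
    · congr 1
      · congr 1
        rw [h0, h0]
        cases p with
        | zero => simp [word]
        | succ p =>
          rw [shift_word, h' _ _ _ _ _ (by omega) ha.shift hx hb]
      · refine Finset.sum_congr rfl fun i hi => ?_
        have hi' := Finset.mem_range.mp hi
        congr 1
        rcases lt_or_ge i p with hip | hip
        · obtain ⟨p, rfl⟩ : ∃ l, p = l + 1 := ⟨p - 1, by omega⟩
          rcases Nat.lt_succ_iff_lt_or_eq.mp hip with hip | rfl
          · rw [merge_word_of_lt hip]
            exact h' _ _ _ _ _ (by omega) (ha.merge i) hx hb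
          · rw [merge_word_left]
            exact h' _ _ _ _ _ (by omega) ha (SX.actL_mem (ha i) hx) hb
        · obtain ⟨j, rfl⟩ : ∃ j, i = p + j := ⟨i - p, by omega⟩
          cases j with
          | zero =>
            rw [show (triData k SX).merge (p + 0) (word p a x b) = _ from merge_word_right]
            exact h' _ _ _ _ _ (by omega) ha (SX.actR_mem (hb 0) hx) hb.shift
          | succ j =>
            rw [merge_word_of_gt]
            exact h' _ _ _ _ _ (by omega) ha hx (hb.merge j)
    · congr 1
      rw [h1, h1]
      cases q with
      | zero => simp [word]
      | succ q => rw [h' _ _ _ _ _ (by omega) ha hx hb]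

end differential

/- ### Extensionality on homogeneous elements -/

theorem multilinear_ext_of_span {V W : Type} [AddCommGroup V] [Module k V] [AddCommGroup W]
    [Module k W] {s : Set V} (hs : ⊤ ≤ Submodule.span k s) {p : ℕ}
    {f g : MultilinearMap k (fun _ : Fin p => V) W}
    (h : ∀ v : Fin p → V, (∀ i, v i ∈ s) → f v = g v) : f = g := by
  refine Module.Basis.ext_multilinear (fun _ => Module.Basis.ofSpan hs) fun v => h _ fun i => ?_
  exact Module.Basis.ofSpan_subset hs ⟨v i, rfl⟩

theorem top_le_span_homogeneous {V : Type} [AddCommGroup V] [Module k V] {gr : ℤ → Submodule k V}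
    (h : DirectSum.IsInternal gr) : ⊤ ≤ Submodule.span k (⋃ i, (gr i : Set V)) := by
  rw [← h.submodule_iSup_eq_top, Submodule.iSup_eq_span]

theorem multilinear_ext_of_homogeneous {V W : Type} [AddCommGroup V] [Module k V] [AddCommGroup W]
    [Module k W] {gr : ℤ → Submodule k V} (hgr : DirectSum.IsInternal gr) {p : ℕ}
    {f g : MultilinearMap k (fun _ : Fin p => V) W}
    (h : ∀ (dg : ℕ → ℤ) (v : ℕ → V), (∀ i, v i ∈ gr (dg i)) →
      f (fun i => v i) = g (fun i => v i)) : f = g := by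
  refine multilinear_ext_of_span (top_le_span_homogeneous hgr) fun v hv => ?_
  choose dg hdg using fun i => Set.mem_iUnion.mp (hv i)
  have := h (fun i => if hi : i < p then dg ⟨i, hi⟩ else 0)
    (fun i => if hi : i < p then v ⟨i, hi⟩ else 0) (fun i => by
      split_ifs with hi
      · exact hdg _
      · exact zero_mem _)
  simpa using this

theorem linear_ext_of_homogeneous {V W : Type} [AddCommGroup V] [Module k V] [AddCommGroup W]
    [Module k W] {gr : ℤ → Submodule k V} (hgr : DirectSum.IsInternal gr) {f g : V →ₗ[k] W}
    (h : ∀ (i : ℤ) (v : V), v ∈ gr i → f v = g v) : f = g := by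
  refine LinearMap.ext_on (eq_top_iff.mpr (top_le_span_homogeneous hgr)) fun v hv => ?_
  obtain ⟨i, hi⟩ := Set.mem_iUnion.mp hv
  exact h i v hi

theorem xcoch_ext (SX : ABBimod k RA RB X) {p q : ℕ} {f g : XCoch k A B X p q}
    (h : ∀ (dga : ℕ → ℤ) (a : ℕ → A), (∀ i, a i ∈ RA.gr (dga i)) →
      ∀ (ix : ℤ) (x : X), x ∈ SX.gr ix →
      ∀ (dgb : ℕ → ℤ) (b : ℕ → B), (∀ j, b j ∈ RB.gr (dgb j)) →
      f (fun i => a i) x (fun j => b j) = g (fun i => a i) x (fun j => b j)) : f = g :=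
  multilinear_ext_of_homogeneous RA.isInternal fun dga a ha =>
    linear_ext_of_homogeneous SX.isInternal fun ix x hx =>
      multilinear_ext_of_homogeneous RB.isInternal fun dgb b hb => h dga a ha ix x hx dgb b hb

section differential

variable {dXL : ∀ (p q : ℕ) (r : ℤ), XCoch k A B X p q →ₗ[k] XCoch k A B X (p + 1) q}
variable {dXR : ∀ (p q : ℕ) (r : ℤ), XCoch k A B X p q →ₗ[k] XCoch k A B X p (q + 1)}
variable {pdX : ∀ (p q : ℕ) (r : ℤ), XCoch k A B X p q →ₗ[k] XCoch k A B X p q}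

theorem totDXonly_totDXonly [CharZero k] (hL : IsDXL k SX dXL) (hR : IsDXR k SX dXR)
    (hP : IsPdX k SX pdX) {N : ℤ} {c : TotXCoch k A B X} (hc : TotHomogX k SX N c) :
    TotDXonly k dXL dXR pdX (N + 1) (TotDXonly k dXL dXR pdX N c) = 0 := by
  funext p q
  refine xcoch_ext SX fun dga a ha ix x hx dgb b hb => ?_
  have ha' : SeqGood RA (fun i => (a i, dga i)) := ha
  have hb' : SeqGood RB (fun i => (b i, dgb i)) := hb
  have hx' : ((x, ix) : X × ℤ).1 ∈ SX.gr ((x, ix) : X × ℤ).2 := hx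
  have h1 := D_wordTot hL hR hP (N + 1) (TotDXonly k dXL dXR pdX N c) p q ha' hx' hb'
  have h2 := WordData.D_D (S := triData k SX) (isCoch_wordTot c) (isHom_wordTot hc)
    (n := p + q + 1) (good_word (p := p) ha' hx' hb')
  refine h1.symm.trans ?_
  rw [D_congr_word (N + 1) (fun p q a x b ha hx hb => ?_) p q ha' hx' hb', h2]
  · rfl
  · rw [wordTot_word, D_wordTot hL hR hP N c p q ha hx hb]

theorem TotHomogX.totDXonly (hL : IsDXL k SX dXL) (hR : IsDXR k SX dXR)
    (hP : IsPdX k SX pdX) {N : ℤ} {c : TotXCoch k A B X} (hc : TotHomogX k SX N c) :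
    TotHomogX k SX (N + 1) (TotDXonly k dXL dXR pdX N c) := by
  intro p q dga a ha ix x hx dgb b hb
  have ha' : SeqGood RA (fun i => (a i, dga i)) := ha
  have hb' : SeqGood RB (fun i => (b i, dgb i)) := hb
  have hx' : ((x, ix) : X × ℤ).1 ∈ SX.gr ((x, ix) : X × ℤ).2 := hx
  have h1 := D_wordTot hL hR hP N c p q ha' hx' hb'
  have h2 := WordData.IsHom.D (S := triData k SX) (isHom_wordTot hc) (p + q + 1) _
    (good_word (p := p) ha' hx' hb')
  rw [h1] at h2
  change _ ∈ SX.gr _ at h2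
  convert h2 using 2
  rw [Nat.add_right_comm p q 1, deg_word_of_gt, Fin.sum_univ_eq_sum_range (fun i => dga i),
    Fin.sum_univ_eq_sum_range (fun i => dgb i)]
  push_cast
  ring

theorem totDXonly_add (N : ℤ) (c c' : TotXCoch k A B X) :
    TotDXonly k dXL dXR pdX N (c + c')
      = TotDXonly k dXL dXR pdX N c + TotDXonly k dXL dXR pdX N c' := by
  funext p q
  simp only [Pi.add_apply, totDXonly_apply]
  rcases p with _ | p <;> rcases q with _ | q <;> simp [totL, totR] <;> abel

theorem TotFinSuppX.totDXonly {c : TotXCoch k A B X} (hc : TotFinSuppX k c) (N : ℤ) :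
    TotFinSuppX k (TotDXonly k dXL dXR pdX N c) := by
  obtain ⟨n, hn⟩ := hc
  refine ⟨n + 1, fun p q hpq => ?_⟩
  rw [totDXonly_apply, hn p q (by omega)]
  rcases p with _ | p <;> rcases q with _ | q <;> simp only [totL, totR, map_zero, add_zero]
  · rw [hn 0 q (by omega), map_zero, add_zero]
  · rw [hn p 0 (by omega), map_zero, add_zero]
  · rw [hn p (q + 1) (by omega), hn (p + 1) q (by omega), map_zero, map_zero, add_zero, add_zero]

end differential

/- ### Linear maps defined on graded pieces -/

section graded

variable {V W : Type} [AddCommGroup V] [Module k V] [AddCommGroup W] [Module k W]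

theorem exists_linearMap_of_pieces {K : ℤ → Submodule k W} (hK : iSupIndep K)
    (f : ∀ t, K t →ₗ[k] V) : ∃ F : W →ₗ[k] V, ∀ t (y : K t), F y = f t y := by
  obtain ⟨L, hL⟩ := LinearMap.exists_leftInverse_of_injective (DirectSum.coeLinearMap K)
    (LinearMap.ker_eq_bot.mpr hK.dfinsupp_lsum_injective)
  refine ⟨DirectSum.toModule k ℤ V f ∘ₗ L, fun t y => ?_⟩
  have h := LinearMap.congr_fun hL (DirectSum.lof k ℤ (fun t => K t) t y)
  rw [LinearMap.comp_apply, DirectSum.coeLinearMap_lof] at h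
  rw [LinearMap.comp_apply, h, LinearMap.id_apply, DirectSum.toModule_lof]

theorem exists_graded_section (δ : V →ₗ[k] W) (Vg : ℤ → Submodule k V) {K : ℤ → Submodule k W}
    (hK : iSupIndep K) (h : ∀ t, ∀ y ∈ K t, ∃ v ∈ Vg t, δ v = y) :
    ∃ s : W →ₗ[k] V, ∀ t, ∀ y ∈ K t, s y ∈ Vg t ∧ δ (s y) = y := by
  have hs : ∀ t, ∃ s : K t →ₗ[k] V, ∀ y, s y ∈ Vg t ∧ δ (s y) = y := by
    intro t
    let U : Submodule k V := Vg t ⊓ (K t).comap δ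
    let δ' : U →ₗ[k] K t := δ.restrict fun v hv => hv.2
    have hsurj : LinearMap.range δ' = ⊤ := by
      rw [LinearMap.range_eq_top]
      rintro ⟨y, hy⟩
      obtain ⟨v, hv, rfl⟩ := h t y hy
      exact ⟨⟨v, hv, hy⟩, rfl⟩
    obtain ⟨s, hs⟩ := δ'.exists_rightInverse_of_surjective hsurj
    refine ⟨U.subtype ∘ₗ s, fun y => ⟨(s y).2.1, ?_⟩⟩
    exact congrArg Subtype.val (LinearMap.congr_fun hs y)
  choose s hs using hs
  obtain ⟨S, hS⟩ := exists_linearMap_of_pieces hK s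
  exact ⟨S, fun t y hy => by rw [hS t ⟨y, hy⟩]; exact hs t ⟨y, hy⟩⟩

/-- A linear operator multiplying homogeneous elements of degree `i` by `(-1)^{m i}`. -/
theorem exists_sign {gr : ℤ → Submodule k V} (h : DirectSum.IsInternal gr) (m : ℤ) :
    ∃ σ : V →ₗ[k] V, ∀ i, ∀ v ∈ gr i, σ v = ε k (m * i) • v := by
  obtain ⟨σ, hσ⟩ := exists_linearMap_of_pieces h.submodule_iSupIndep
    (fun i => ε k (m * i) • (gr i).subtype)
  exact ⟨σ, fun i v hv => hσ i ⟨v, hv⟩⟩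

theorem iSupIndep_of_eval {J : Type} {gr : ℤ → Submodule k V} (hgr : iSupIndep gr)
    (ev : J → W →ₗ[k] V) (hev : ∀ w, (∀ j, ev j w = 0) → w = 0) (deg : J → ℤ)
    {Wg : ℤ → Submodule k W} (h : ∀ t, ∀ w ∈ Wg t, ∀ j, ev j w ∈ gr (deg j + t)) :
    iSupIndep Wg := by
  rw [iSupIndep_def]
  intro t
  rw [Submodule.disjoint_def]
  intro w hw hw'
  refine hev w fun j => ?_
  refine Submodule.disjoint_def.mp (hgr (deg j + t)) _ (h t w hw j) ?_
  have hmap : (⨆ (l) (_ : l ≠ t), Wg l) ≤ (⨆ (l) (_ : l ≠ deg j + t), gr l).comap (ev j) := by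
    refine iSup₂_le fun l hl v hv => ?_
    exact Submodule.mem_iSup_of_mem (deg j + l)
      (Submodule.mem_iSup_of_mem (by omega) (h l v hv j))
  exact hmap hw'

end graded

/-- The tuple of the first `p` entries determines no more than a sequence. -/
theorem exists_seq {V : Type} [Zero V] {p : ℕ} (v : Fin p → V) :
    ∃ v' : ℕ → V, v = fun i : Fin p => v' (i : ℕ) :=
  ⟨fun i => if h : i < p then v ⟨i, h⟩ else 0, by funext i; simp⟩

/-- Homogeneous cochains on `X ⊗ B^{⊗q}` of degree `t`. -/
def homY (SX : ABBimod k RA RB X) (q : ℕ) (t : ℤ) : Submodule k (YCoch k B X q) where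
  carrier := {f | IsHomogY k SX q t f}
  add_mem' hf hg ix x hx dgb b hb := add_mem (hf ix x hx dgb b hb) (hg ix x hx dgb b hb)
  zero_mem' _ _ _ _ _ _ := zero_mem _
  smul_mem' c _ hf ix x hx dgb b hb := Submodule.smul_mem _ c (hf ix x hx dgb b hb)

/-- Homogeneous cochains on `A^{⊗p} ⊗ X` of degree `t`. -/
def homZ (SX : ABBimod k RA RB X) (p : ℕ) (t : ℤ) : Submodule k (ZCoch k A X p) where
  carrier := {f | IsHomogZ k SX p t f}
  add_mem' hf hg dga a ha ix x hx := add_mem (hf dga a ha ix x hx) (hg dga a ha ix x hx)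
  zero_mem' _ _ _ _ _ _ := zero_mem _
  smul_mem' c _ hf dga a ha ix x hx := Submodule.smul_mem _ c (hf dga a ha ix x hx)

theorem iSupIndep_homY (SX : ABBimod k RA RB X) (q : ℕ) : iSupIndep (homY SX q) := by
  refine iSupIndep_of_eval (J := {j : (X × ℤ) × (ℕ → B × ℤ) // j.1.1 ∈ SX.gr j.1.2 ∧
      SeqGood RB j.2}) SX.isInternal.submodule_iSupIndep
    (fun j => ⟨⟨fun f => f j.1.1.1 (fun i => (j.1.2 i).1), fun _ _ => rfl⟩, fun _ _ => rfl⟩) ?_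
    (fun j => j.1.1.2 + ∑ i : Fin q, (j.1.2 i).2) ?_
  · intro f hf
    refine linear_ext_of_homogeneous SX.isInternal fun ix x hx =>
      multilinear_ext_of_homogeneous RB.isInternal fun dgb b hb => ?_
    exact hf ⟨((x, ix), fun i => (b i, dgb i)), hx, hb⟩
  · rintro t f hf ⟨⟨⟨x, ix⟩, b⟩, hx, hb⟩
    exact hf ix x hx (fun i => (b i).2) (fun i => (b i).1) hb

theorem iSupIndep_homZ (SX : ABBimod k RA RB X) (p : ℕ) : iSupIndep (homZ SX p) := by
  refine iSupIndep_of_eval (J := {j : (X × ℤ) × (ℕ → A × ℤ) // j.1.1 ∈ SX.gr j.1.2 ∧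
      SeqGood RA j.2}) SX.isInternal.submodule_iSupIndep
    (fun j => ⟨⟨fun f => f (fun i => (j.1.2 i).1) j.1.1.1, fun _ _ => rfl⟩, fun _ _ => rfl⟩) ?_
    (fun j => (∑ i : Fin p, (j.1.2 i).2) + j.1.1.2) ?_
  · intro f hf
    refine multilinear_ext_of_homogeneous RA.isInternal fun dga a ha =>
      linear_ext_of_homogeneous SX.isInternal fun ix x hx => ?_
    exact hf ⟨((x, ix), fun i => (a i, dga i)), hx, ha⟩
  · rintro t f hf ⟨⟨⟨x, ix⟩, a⟩, hx, ha⟩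
    exact hf (fun i => (a i).2) (fun i => (a i).1) ha ix x hx

/- ### Exactness with coefficients -/

section exactR

variable {dXR : ∀ (p q : ℕ) (r : ℤ), XCoch k A B X p q →ₗ[k] XCoch k A B X p (q + 1)}
variable {dR : ∀ (q : ℕ) (r : ℤ), YCoch k B X q →ₗ[k] YCoch k B X (q + 1)}

theorem dXR_apply_eq_dR (hR : IsDXR k SX dXR) (hdR : IsDR k SX dR) (p q : ℕ) (r : ℤ)
    (f : XCoch k A B X p q) (a : Fin p → A) : dXR p q r f a = dR q r (f a) := by
  obtain ⟨a, rfl⟩ := exists_seq a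
  refine LinearMap.ext fun x => multilinear_ext_of_homogeneous RB.isInternal fun dgb b hb => ?_
  rw [hR, hdR]

theorem dR_eq_sign_smul (hdR : IsDR k SX dR) (q : ℕ) (r t : ℤ) (f : YCoch k B X q) :
    dR q r f = ε k (r - t) • dR q t f := by
  refine LinearMap.ext fun x => multilinear_ext_of_homogeneous RB.isInternal fun dgb b hb => ?_
  rw [LinearMap.smul_apply, smul_apply, hdR, hdR]
  simp only [smul_add, Finset.smul_sum, ε_smul_smul]
  congr 1
  · congr 1
    · congr 2; ring
    · refine Finset.sum_congr rfl fun j _ => ?_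
      congr 2; ring
  · congr 2; ring

theorem exists_dXR_eq (hR : IsDXR k SX dXR) (hdR : IsDR k SX dR) (hex : ExactR k SX dR)
    {p q : ℕ} {r : ℤ} {f : XCoch k A B X p (q + 1)} (hf : IsHomogX k SX p (q + 1) r f)
    (h0 : dXR p (q + 1) r f = 0) :
    ∃ g : XCoch k A B X p q, IsHomogX k SX p q r g ∧ dXR p q r g = f := by
  obtain ⟨s, hs⟩ := exists_graded_section (dR q r) (homY SX q)
    (K := fun t => homY SX (q + 1) t ⊓ LinearMap.ker (dR (q + 1) r))
    ((iSupIndep_homY SX (q + 1)).mono fun t => inf_le_left) (by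
      rintro t y ⟨hy, hy0⟩
      have hy0' : dR (q + 1) t y = 0 := by
        rw [dR_eq_sign_smul hdR _ t r, LinearMap.mem_ker.mp hy0, smul_zero]
      obtain ⟨g, hg, rfl⟩ := hex.2 q t y hy hy0'
      refine ⟨ε k (r - t) • g, Submodule.smul_mem _ _ hg, ?_⟩
      rw [map_smul, dR_eq_sign_smul hdR q r t, smul_smul, ε_mul_self, one_smul])
  have hmem : ∀ (dga : ℕ → ℤ) (a : ℕ → A), (∀ i, a i ∈ RA.gr (dga i)) →
      f (fun i => a i) ∈ homY SX (q + 1) ((∑ i : Fin p, dga i) + r)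
        ⊓ LinearMap.ker (dR (q + 1) r) := by
    intro dga a ha
    refine ⟨fun ix x hx dgb b hb => ?_, ?_⟩
    · have := hf dga a ha ix x hx dgb b hb
      convert this using 2
      ring
    · change dR (q + 1) r (f _) = 0
      rw [← dXR_apply_eq_dR hR hdR, h0]
      rfl
  refine ⟨s.compMultilinearMap f, fun dga a ha ix x hx dgb b hb => ?_, ?_⟩
  · have := (hs _ _ (hmem dga a ha)).1 ix x hx dgb b hb
    change s (f _) x _ ∈ _
    convert this using 2
    ring
  · refine multilinear_ext_of_homogeneous RA.isInternal fun dga a ha => ?_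
    rw [dXR_apply_eq_dR hR hdR]
    exact (hs _ _ (hmem dga a ha)).2

end exactR

section exactL

variable {dXL : ∀ (p q : ℕ) (r : ℤ), XCoch k A B X p q →ₗ[k] XCoch k A B X (p + 1) q}
variable {dL : ∀ (p : ℕ) (r : ℤ), ZCoch k A X p →ₗ[k] ZCoch k A X (p + 1)}

/-- A cochain on `A^{⊗p} ⊗ X ⊗ B^{⊗q}` as a multilinear map in the variables from `B`. -/
def sliceB {p q : ℕ} (f : XCoch k A B X p q) :
    MultilinearMap k (fun _ : Fin q => B) (ZCoch k A X p) where
  toFun b :=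
    { toFun := fun a =>
        { toFun := fun x => f a x b
          map_add' := fun x y => by rw [map_add]; rfl
          map_smul' := fun c x => by rw [map_smul]; rfl }
      map_update_add' := fun a i x y => by ext z; simp
      map_update_smul' := fun a i c x => by ext z; simp }
  map_update_add' b i x y := by ext a z; simp
  map_update_smul' b i c x := by ext a z; simp

/-- The inverse of `sliceB`. -/
def unsliceB {p q : ℕ} (F : MultilinearMap k (fun _ : Fin q => B) (ZCoch k A X p)) :
    XCoch k A B X p q where
  toFun a :=
    { toFun := fun x =>
        { toFun := fun b => F b a x
          map_update_add' := fun a i x y => by simp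
          map_update_smul' := fun a i c x => by simp }
      map_add' := fun x y => by ext b; simp
      map_smul' := fun c x => by ext b; simp }
  map_update_add' b i x y := by ext a z; simp
  map_update_smul' b i c x := by ext a z; simp

theorem dXL_apply_eq_dL (hL : IsDXL k SX dXL) (hdL : IsDL k SX dL) (p q : ℕ) (r : ℤ)
    (f : XCoch k A B X p q) (b : Fin q → B) :
    sliceB (dXL p q r f) b = ε k q • dL p r (sliceB f b) := by
  obtain ⟨b, rfl⟩ := exists_seq b
  refine multilinear_ext_of_homogeneous RA.isInternal fun dga a ha => LinearMap.ext fun x => ?_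
  rw [smul_apply, LinearMap.smul_apply, hdL p r _ dga a ha]
  refine (hL p q r f dga a ha x b).trans ?_
  simp only [smul_add, Finset.smul_sum, ε_smul_smul]
  congr 1
  · congr 1
    · congr 2; ring
    · refine Finset.sum_congr rfl fun j _ => ?_
      congr 2; ring
  · congr 2; ring

/-- Precomposition of a cochain with operators on `A` and `X`. -/
def twistZ (σA : A →ₗ[k] A) (σX : X →ₗ[k] X) {p : ℕ} (f : ZCoch k A X p) : ZCoch k A X p :=
  (LinearMap.lcomp k X σX).compMultilinearMap (f.compLinearMap fun _ => σA)

theorem twistZ_apply (σA : A →ₗ[k] A) (σX : X →ₗ[k] X) {p : ℕ} (f : ZCoch k A X p)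
    (a : Fin p → A) (x : X) : twistZ σA σX f a x = f (fun i => σA (a i)) (σX x) := rfl

theorem dL_twistZ (hdL : IsDL k SX dL) {m r t : ℤ} (hm : Even m ↔ Even (r - t))
    {σA : A →ₗ[k] A} (hσA : ∀ i, ∀ a ∈ RA.gr i, σA a = ε k (m * i) • a)
    {σX : X →ₗ[k] X} (hσX : ∀ i, ∀ x ∈ SX.gr i, σX x = ε k (m * i) • x)
    (p : ℕ) (f : ZCoch k A X p) :
    dL p t (twistZ σA σX f) = ε k m • twistZ σA σX (dL p r f) := by
  refine multilinear_ext_of_homogeneous RA.isInternal fun dga a ha =>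
    linear_ext_of_homogeneous SX.isInternal fun ix x hx => ?_
  have hmul : ∀ i j, σA (a i * a j) = σA (a i) * σA (a j) := fun i j => by
    rw [hσA _ _ (RA.mul_mem (ha i) (ha j)), hσA _ _ (ha i), hσA _ _ (ha j), smul_mul_smul_comm,
      ε_mul_ε, mul_add]
  have hact : σX (SX.actL (a p) x) = SX.actL (σA (a p)) (σX x) := by
    rw [hσX _ _ (SX.actL_mem (ha p) hx), hσX _ _ hx, hσA _ _ (ha p), map_smul, map_smul,
      LinearMap.smul_apply, ε_smul_smul, mul_add]
    congr 2; ring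
  have hσa : ∀ i, σA (a i) ∈ RA.gr (dga i) := fun i => by
    rw [hσA _ _ (ha i)]; exact Submodule.smul_mem _ _ (ha i)
  rw [smul_apply, LinearMap.smul_apply, hdL p t _ dga a ha,
    twistZ_apply σA σX (dL p r f), hdL p r f dga (fun i => σA (a i)) hσa]
  simp only [twistZ_apply, smul_add, Finset.smul_sum, ε_smul_smul]
  congr 1
  · congr 1
    · rw [hσA _ _ (ha 0), map_smul, LinearMap.smul_apply, ε_smul_smul]
      congr 1
      refine ε_congr k ?_
      rw [Int.even_sub] at hm
      simp only [Int.even_add, Int.even_mul]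
      tauto
    · refine Finset.sum_congr rfl fun j _ => ?_
      congr 1
      · refine ε_congr k ?_
        grind
      · congr 2
        funext l
        split_ifs <;> simp [hmul]
  · rw [hact]
    congr 1
    refine ε_congr k ?_
    grind

theorem exists_dL_eq (hdL : IsDL k SX dL) (hex : ExactL k SX dL) {p : ℕ} (r : ℤ) {t : ℤ}
    {y : ZCoch k A X (p + 1)} (hy : y ∈ homZ SX (p + 1) t) (hy0 : dL (p + 1) r y = 0) :
    ∃ g ∈ homZ SX p t, dL p r g = y := by
  obtain ⟨σA, hσA⟩ := exists_sign RA.isInternal (r - t)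
  obtain ⟨σX, hσX⟩ := exists_sign SX.isInternal (r - t)
  have hmem : ∀ {p : ℕ} {f : ZCoch k A X p}, f ∈ homZ SX p t → twistZ σA σX f ∈ homZ SX p t := by
    intro p f hf dga a ha ix x hx
    refine hf dga (fun i => σA (a i)) (fun i => ?_) ix (σX x) ?_
    · rw [hσA _ _ (ha i)]; exact Submodule.smul_mem _ _ (ha i)
    · rw [hσX _ _ hx]; exact Submodule.smul_mem _ _ hx
  have hσA2 : ∀ a, σA (σA a) = a := LinearMap.congr_fun (f := σA ∘ₗ σA) (g := LinearMap.id)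
    (linear_ext_of_homogeneous RA.isInternal fun i a ha => by
      rw [LinearMap.comp_apply, hσA _ _ ha, map_smul, hσA _ _ ha, smul_smul, ε_mul_self, one_smul,
        LinearMap.id_apply])
  have hσX2 : ∀ a, σX (σX a) = a := LinearMap.congr_fun (f := σX ∘ₗ σX) (g := LinearMap.id)
    (linear_ext_of_homogeneous SX.isInternal fun i a ha => by
      rw [LinearMap.comp_apply, hσX _ _ ha, map_smul, hσX _ _ ha, smul_smul, ε_mul_self, one_smul,
        LinearMap.id_apply])
  obtain ⟨g, hg, hgy⟩ := hex.2 p t (twistZ σA σX y) (hmem hy) (by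
    rw [dL_twistZ hdL Iff.rfl hσA hσX, hy0]
    ext; simp [twistZ_apply])
  refine ⟨ε k (r - t) • twistZ σA σX g, Submodule.smul_mem _ _ (hmem hg), ?_⟩
  rw [map_smul, dL_twistZ hdL (r := t) (t := r) (by grind) hσA hσX, hgy, smul_smul,
    ε_mul_self, one_smul]
  ext a x
  simp only [twistZ_apply, hσA2, hσX2]

theorem exists_dXL_eq (hL : IsDXL k SX dXL) (hdL : IsDL k SX dL) (hex : ExactL k SX dL)
    {p q : ℕ} {r : ℤ} {f : XCoch k A B X (p + 1) q} (hf : IsHomogX k SX (p + 1) q r f)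
    (h0 : dXL (p + 1) q r f = 0) :
    ∃ g : XCoch k A B X p q, IsHomogX k SX p q r g ∧ dXL p q r g = f := by
  obtain ⟨s, hs⟩ := exists_graded_section (dL p r) (homZ SX p)
    (K := fun t => homZ SX (p + 1) t ⊓ LinearMap.ker (dL (p + 1) r))
    ((iSupIndep_homZ SX (p + 1)).mono fun t => inf_le_left)
    (fun t y hy => exists_dL_eq hdL hex r hy.1 hy.2)
  have hmem : ∀ (dgb : ℕ → ℤ) (b : ℕ → B), (∀ i, b i ∈ RB.gr (dgb i)) →
      sliceB f (fun i => b i) ∈ homZ SX (p + 1) ((∑ i : Fin q, dgb i) + r)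
        ⊓ LinearMap.ker (dL (p + 1) r) := by
    intro dgb b hb
    refine ⟨fun dga a ha ix x hx => ?_, ?_⟩
    · have := hf dga a ha ix x hx dgb b hb
      rw [add_assoc] at this
      exact this
    · change dL (p + 1) r (sliceB f _) = 0
      have h := dXL_apply_eq_dL hL hdL (p + 1) q r f (fun i => b i)
      rw [h0] at h
      rw [← one_smul k (dL _ _ _), ← ε_mul_self k q, ← smul_smul, ← h]
      exact smul_zero _
  refine ⟨ε k q • unsliceB (s.compMultilinearMap (sliceB f)),
    fun dga a ha ix x hx dgb b hb => ?_, ?_⟩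
  · have := (hs _ _ (hmem dgb b hb)).1 dga a ha ix x hx
    rw [← add_assoc] at this
    exact Submodule.smul_mem _ _ this
  · refine MultilinearMap.ext fun a => LinearMap.ext fun x =>
      multilinear_ext_of_homogeneous RB.isInternal fun dgb b hb => ?_
    have h := dXL_apply_eq_dL hL hdL p q r (ε k q • unsliceB (s.compMultilinearMap (sliceB f)))
      (fun i => b i)
    have h' : sliceB (ε k q • unsliceB (s.compMultilinearMap (sliceB f))) (fun i => b i)
      = ε k q • s (sliceB f (fun i => b i)) := rfl
    rw [h', map_smul (dL p r), smul_smul, ε_mul_self, one_smul, (hs _ _ (hmem dgb b hb)).2] at h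
    exact LinearMap.congr_fun (MultilinearMap.congr_fun h a) x

end exactL

/- ### Reduction of cochains to one row or one column -/

theorem IsHomogX.add {p q : ℕ} {r : ℤ} {f g : XCoch k A B X p q} (hf : IsHomogX k SX p q r f)
    (hg : IsHomogX k SX p q r g) : IsHomogX k SX p q r (f + g) :=
  fun dga a ha ix x hx dgb b hb =>
    add_mem (hf dga a ha ix x hx dgb b hb) (hg dga a ha ix x hx dgb b hb)

theorem IsHomogX.smul {p q : ℕ} {r : ℤ} {f : XCoch k A B X p q} (hf : IsHomogX k SX p q r f)
    (s : k) : IsHomogX k SX p q r (s • f) :=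
  fun dga a ha ix x hx dgb b hb => Submodule.smul_mem _ s (hf dga a ha ix x hx dgb b hb)

theorem isHomogX_zero (p q : ℕ) (r : ℤ) : IsHomogX k SX p q r 0 :=
  fun _ _ _ _ _ _ _ _ _ => zero_mem _

theorem TotHomogX.add {N : ℤ} {c c' : TotXCoch k A B X} (hc : TotHomogX k SX N c)
    (hc' : TotHomogX k SX N c') : TotHomogX k SX N (c + c') :=
  fun p q => (hc p q).add (hc' p q)

theorem TotFinSuppX.add {c c' : TotXCoch k A B X} (hc : TotFinSuppX k c)
    (hc' : TotFinSuppX k c') : TotFinSuppX k (c + c') := by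
  obtain ⟨n, hn⟩ := hc
  obtain ⟨n', hn'⟩ := hc'
  refine ⟨max n n', fun p q hpq => ?_⟩
  rw [Pi.add_apply, Pi.add_apply, hn p q (by omega), hn' p q (by omega), add_zero]

theorem TotFinSuppX.smul {c : TotXCoch k A B X} (hc : TotFinSuppX k c) (s : k) :
    TotFinSuppX k (s • c) := by
  obtain ⟨n, hn⟩ := hc
  exact ⟨n, fun p q hpq => by rw [Pi.smul_apply, Pi.smul_apply, hn p q hpq, smul_zero]⟩

section reduction

variable {dXL : ∀ (p q : ℕ) (r : ℤ), XCoch k A B X p q →ₗ[k] XCoch k A B X (p + 1) q}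
variable {dXR : ∀ (p q : ℕ) (r : ℤ), XCoch k A B X p q →ₗ[k] XCoch k A B X p (q + 1)}
variable {pdX : ∀ (p q : ℕ) (r : ℤ), XCoch k A B X p q →ₗ[k] XCoch k A B X p q}

theorem totDXonly_zero (N : ℤ) : TotDXonly k dXL dXR pdX N 0 = 0 := by
  funext p q
  rw [totDXonly_apply]
  rcases p with _ | p <;> rcases q with _ | q <;> simp [totL, totR]

theorem totDXonly_smul (N : ℤ) (s : k) (c : TotXCoch k A B X) :
    TotDXonly k dXL dXR pdX N (s • c) = s • TotDXonly k dXL dXR pdX N c := by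
  funext p q
  simp only [Pi.smul_apply, totDXonly_apply]
  rcases p with _ | p <;> rcases q with _ | q <;> simp [totL, totR]

/-- If every cochain whose differential vanishes at positive levels can be pushed down by one
level, it is cohomologous to a cochain supported at level zero. -/
theorem exists_reduction_of_step [CharZero k] (hL : IsDXL k SX dXL) (hR : IsDXR k SX dXR)
    (hP : IsPdX k SX pdX) {N : ℤ} (lev : ℕ → ℕ → ℕ) (hlev : ∀ p q, lev p q ≤ p + q)
    (step : ∀ (Q : ℕ) (c : TotXCoch k A B X), TotHomogX k SX N c → TotFinSuppX k c →
      (∀ p q, 0 < lev p q → TotDXonly k dXL dXR pdX N c p q = 0) →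
      (∀ p q, Q + 1 < lev p q → c p q = 0) →
      ∃ g : TotXCoch k A B X, TotHomogX k SX (N - 1) g ∧ TotFinSuppX k g ∧
        ∀ p q, Q < lev p q → (c + TotDXonly k dXL dXR pdX (N - 1) g) p q = 0)
    {c : TotXCoch k A B X} (hc : TotHomogX k SX N c) (hfin : TotFinSuppX k c)
    (hD : ∀ p q, 0 < lev p q → TotDXonly k dXL dXR pdX N c p q = 0) :
    ∃ g : TotXCoch k A B X, TotHomogX k SX (N - 1) g ∧ TotFinSuppX k g ∧
      ∀ p q, 0 < lev p q → (c + TotDXonly k dXL dXR pdX (N - 1) g) p q = 0 := by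
  have key : ∀ (Q : ℕ) (c : TotXCoch k A B X), TotHomogX k SX N c → TotFinSuppX k c →
      (∀ p q, 0 < lev p q → TotDXonly k dXL dXR pdX N c p q = 0) →
      (∀ p q, Q < lev p q → c p q = 0) →
      ∃ g : TotXCoch k A B X, TotHomogX k SX (N - 1) g ∧ TotFinSuppX k g ∧
        ∀ p q, 0 < lev p q → (c + TotDXonly k dXL dXR pdX (N - 1) g) p q = 0 := by
    intro Q
    induction Q with
    | zero =>
      intro c _ _ _ h
      refine ⟨0, fun p q => isHomogX_zero _ _ _, ⟨0, fun _ _ _ => rfl⟩, fun p q hpq => ?_⟩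
      rw [totDXonly_zero, add_zero, h p q hpq]
    | succ Q ih =>
      intro c hc hfin hD h
      obtain ⟨g, hg, hgfin, hcg⟩ := step Q c hc hfin hD h
      have hDg := hg.totDXonly hL hR hP
      have hDDg := totDXonly_totDXonly hL hR hP hg
      rw [sub_add_cancel] at hDg hDDg
      obtain ⟨g', hg', hgfin', hcg'⟩ := ih _ (hc.add hDg) (hfin.add (hgfin.totDXonly _))
        (fun p q hpq => by rw [totDXonly_add, hDDg, add_zero, hD p q hpq]) hcg
      refine ⟨g + g', hg.add hg', hgfin.add hgfin', fun p q hpq => ?_⟩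
      rw [totDXonly_add, ← add_assoc, hcg' p q hpq]
  obtain ⟨n, hn⟩ := hfin
  exact key n c hc ⟨n, hn⟩ hD fun p q hpq => hn p q (by have := hlev p q; omega)

theorem exists_reduction_right [CharZero k] (hL : IsDXL k SX dXL) (hR : IsDXR k SX dXR)
    (hP : IsPdX k SX pdX)
    (hex : ∀ {p q : ℕ} {r : ℤ} {f : XCoch k A B X p (q + 1)}, IsHomogX k SX p (q + 1) r f →
      dXR p (q + 1) r f = 0 → ∃ g : XCoch k A B X p q, IsHomogX k SX p q r g ∧ dXR p q r g = f)
    {N : ℤ} {c : TotXCoch k A B X} (hc : TotHomogX k SX N c) (hfin : TotFinSuppX k c)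
    (hD : ∀ p q, 0 < q → TotDXonly k dXL dXR pdX N c p q = 0) :
    ∃ g : TotXCoch k A B X, TotHomogX k SX (N - 1) g ∧ TotFinSuppX k g ∧
      ∀ p q, 0 < q → (c + TotDXonly k dXL dXR pdX (N - 1) g) p q = 0 := by
  refine exists_reduction_of_step hL hR hP (fun _ q => q) (fun p q => by omega) ?_ hc hfin hD
  intro Q c hc hfin hD hQ
  have hG : ∀ p, ∃ g : XCoch k A B X p Q, IsHomogX k SX p Q (N - 1 - p - Q - 1) g ∧
      dXR p Q (N - 1 - p - Q - 1) g = (-1 : k) • c p (Q + 1) ∧ (c p (Q + 1) = 0 → g = 0) := by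
    intro p
    by_cases h0 : c p (Q + 1) = 0
    · exact ⟨0, isHomogX_zero _ _ _, by rw [map_zero, h0, smul_zero], fun _ => rfl⟩
    · have e : N - 1 - p - Q - 1 = N - p - ((Q + 1 : ℕ) : ℤ) - 1 := by push_cast; ring
      have hd := hD p (Q + 1 + 1) (by omega)
      have hl : totL dXL N c p (Q + 1 + 1) = 0 := by
        rcases p with _ | p
        · rfl
        · rw [totL, hQ p _ (by omega), map_zero]
      rw [totDXonly_apply, hQ p _ (by omega), map_zero, hl, add_zero, zero_add, totR] at hd
      obtain ⟨g, hg, hgc⟩ := hex ((hc p (Q + 1)).smul (-1)) (by rw [map_smul, hd, smul_zero])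
      rw [e]
      exact ⟨g, hg, hgc, fun h => absurd h h0⟩
  choose G hG hGc hG0 using hG
  let g : TotXCoch k A B X := fun p => Function.update (fun _ => 0) Q (G p)
  have hgQ : ∀ p, g p Q = G p := fun p => Function.update_self ..
  have hgne : ∀ p q, q ≠ Q → g p q = 0 := fun p q hq => Function.update_of_ne hq ..
  refine ⟨g, fun p q => ?_, ?_, fun p q hpq => ?_⟩
  · by_cases hq : q = Q
    · subst hq; rw [hgQ]; exact hG p
    · rw [hgne p q hq]; exact isHomogX_zero _ _ _
  · obtain ⟨n, hn⟩ := hfin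
    refine ⟨n + Q, fun p q hpq => ?_⟩
    by_cases hq : q = Q
    · subst hq; rw [hgQ]; exact hG0 p (hn _ _ (by omega))
    · exact hgne p q hq
  · have hl : totL dXL (N - 1) g p q = 0 := by
      rcases p with _ | p
      · rfl
      · rw [totL, hgne p q (by omega), map_zero]
    rw [Pi.add_apply, Pi.add_apply, totDXonly_apply, hgne p q (by omega), map_zero, hl, add_zero,
      zero_add]
    obtain ⟨q, rfl⟩ : ∃ q', q = q' + 1 := ⟨q - 1, by omega⟩
    rw [totR]
    by_cases hq : q = Q
    · subst hq; rw [hgQ, hGc]; ext; simp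
    · rw [hgne p q hq, map_zero, add_zero, hQ p _ (by omega)]

theorem exists_reduction_left [CharZero k] (hL : IsDXL k SX dXL) (hR : IsDXR k SX dXR)
    (hP : IsPdX k SX pdX)
    (hex : ∀ {p q : ℕ} {r : ℤ} {f : XCoch k A B X (p + 1) q}, IsHomogX k SX (p + 1) q r f →
      dXL (p + 1) q r f = 0 → ∃ g : XCoch k A B X p q, IsHomogX k SX p q r g ∧ dXL p q r g = f)
    {N : ℤ} {c : TotXCoch k A B X} (hc : TotHomogX k SX N c) (hfin : TotFinSuppX k c)
    (hD : ∀ p q, 0 < p → TotDXonly k dXL dXR pdX N c p q = 0) :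
    ∃ g : TotXCoch k A B X, TotHomogX k SX (N - 1) g ∧ TotFinSuppX k g ∧
      ∀ p q, 0 < p → (c + TotDXonly k dXL dXR pdX (N - 1) g) p q = 0 := by
  refine exists_reduction_of_step hL hR hP (fun p _ => p) (fun p q => by omega) ?_ hc hfin hD
  intro P c hc hfin hD hQ
  have hG : ∀ q, ∃ g : XCoch k A B X P q, IsHomogX k SX P q (N - 1 - P - q - 1) g ∧
      dXL P q (N - 1 - P - q - 1) g = (-1 : k) • c (P + 1) q ∧ (c (P + 1) q = 0 → g = 0) := by
    intro q
    by_cases h0 : c (P + 1) q = 0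
    · exact ⟨0, isHomogX_zero _ _ _, by rw [map_zero, h0, smul_zero], fun _ => rfl⟩
    · have e : N - 1 - P - q - 1 = N - ((P + 1 : ℕ) : ℤ) - q - 1 := by push_cast; ring
      have hd := hD (P + 1 + 1) q (by omega)
      have hr : totR dXR N c (P + 1 + 1) q = 0 := by
        rcases q with _ | q
        · rfl
        · rw [totR, hQ _ q (by omega), map_zero]
      rw [totDXonly_apply, hQ _ q (by omega), map_zero, hr, add_zero, zero_add, totL] at hd
      obtain ⟨g, hg, hgc⟩ := hex ((hc (P + 1) q).smul (-1)) (by rw [map_smul, hd, smul_zero])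
      rw [e]
      exact ⟨g, hg, hgc, fun h => absurd h h0⟩
  choose G hG hGc hG0 using hG
  let g : TotXCoch k A B X := Function.update (fun _ _ => 0) P G
  have hgP : ∀ q, g P q = G q := fun q => congrFun (Function.update_self ..) q
  have hgne : ∀ p q, p ≠ P → g p q = 0 := fun p q hp => by
    simp only [g, Function.update_of_ne hp]
  refine ⟨g, fun p q => ?_, ?_, fun p q hpq => ?_⟩
  · by_cases hp : p = P
    · subst hp; rw [hgP]; exact hG q
    · rw [hgne p q hp]; exact isHomogX_zero _ _ _
  · obtain ⟨n, hn⟩ := hfin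
    refine ⟨n + P, fun p q hpq => ?_⟩
    by_cases hp : p = P
    · subst hp; rw [hgP]; exact hG0 q (hn _ _ (by omega))
    · exact hgne p q hp
  · have hr : totR dXR (N - 1) g p q = 0 := by
      rcases q with _ | q
      · rfl
      · rw [totR, hgne p q (by omega), map_zero]
    rw [Pi.add_apply, Pi.add_apply, totDXonly_apply, hgne p q (by omega), map_zero, hr, add_zero,
      zero_add]
    obtain ⟨p, rfl⟩ : ∃ p', p = p' + 1 := ⟨p - 1, by omega⟩
    rw [totL]
    by_cases hp : p = P
    · subst hp; rw [hgP, hGc]; ext; simp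
    · rw [hgne p q hp, map_zero, add_zero, hQ _ q (by omega)]

end reduction

/- ### Embeddings of Hochschild complexes with coefficients -/

section embedding

variable {dXL : ∀ (p q : ℕ) (r : ℤ), XCoch k A B X p q →ₗ[k] XCoch k A B X (p + 1) q}
variable {dXR : ∀ (p q : ℕ) (r : ℤ), XCoch k A B X p q →ₗ[k] XCoch k A B X p (q + 1)}
variable {pdX : ∀ (p q : ℕ) (r : ℤ), XCoch k A B X p q →ₗ[k] XCoch k A B X p q}
variable {C : Type} [Ring C] [Algebra k C] {RC : DGAlgebra k C} {St : DGBimod k RC M}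
variable {dHM : ∀ (p : ℕ) (r : ℤ), MCoch k C M p →ₗ[k] MCoch k C M (p + 1)}
variable {pdM : ∀ (p : ℕ) (r : ℤ), MCoch k C M p →ₗ[k] MCoch k C M p}

theorem totDM_smul (n : ℤ) (s : k) (c : TotMCoch k C M) :
    TotDM k dHM pdM n (s • c) = s • TotDM k dHM pdM n c := by
  funext p
  rcases p with _ | p <;> simp [TotDM]

theorem totDM_zero_apply (n : ℤ) (c : TotMCoch k C M) :
    TotDM k dHM pdM n c 0 = pdM 0 (n - (0 : ℕ)) (c 0) := by
  simp [TotDM]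

theorem totDM_succ_apply (n : ℤ) (c : TotMCoch k C M) (p : ℕ) :
    TotDM k dHM pdM n c (p + 1)
      = pdM (p + 1) (n - (p + 1 : ℕ)) (c (p + 1)) + dHM p (n - p) (c p) := by
  simp [TotDM]

theorem IsHomogM.smul {p : ℕ} {r : ℤ} {f : MCoch k C M p} (hf : IsHomogM k St p r f) (s : k) :
    IsHomogM k St p r (s • f) :=
  fun dg a ha => Submodule.smul_mem _ s (hf dg a ha)

/-- A family of embeddings `F` of a Hochschild complex with coefficients, anticommuting with the
differentials, induces bijections on cohomology as soon as every cochain whose differential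
satisfies the vanishing conditions `bad` defining the image is cohomologous to one in the image. -/
theorem quasiIso_of_reduction [CharZero k] (hL : IsDXL k SX dXL) (hR : IsDXR k SX dXR)
    (hP : IsPdX k SX pdX) (F : ℤ → TotMCoch k C M → TotXCoch k A B X) (bad : ℕ → ℕ → Prop)
    (hF_smul : ∀ m (s : k) α, F m (s • α) = s • F m α)
    (hF_inj : ∀ m α β, F m α = F m β → α = β)
    (hF_bad : ∀ m α p q, bad p q → F m α p q = 0)
    (hF_D : ∀ m α, TotHomogM k St m α →
      TotDXonly k dXL dXR pdX (m + 1) (F m α) = (-1 : k) • F (m + 1) (TotDM k dHM pdM m α))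
    (hF_red : ∀ (N : ℤ) (c : TotXCoch k A B X), TotHomogX k SX N c → TotFinSuppX k c →
      (∀ p q, bad p q → TotDXonly k dXL dXR pdX N c p q = 0) →
      ∃ g : TotXCoch k A B X, TotHomogX k SX (N - 1) g ∧ TotFinSuppX k g ∧
        ∃ α : TotMCoch k C M, TotHomogM k St (N - 1) α ∧ TotFinSuppM k α ∧
          c + TotDXonly k dXL dXR pdX (N - 1) g = F (N - 1) α) :
    (∀ (n : ℤ) (cx : TotXCoch k A B X),
        TotHomogX k SX n cx → TotFinSuppX k cx → TotXonlyCocycle k dXL dXR pdX n cx →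
        ∃ α : TotMCoch k C M,
          TotHomogM k St (n - 1) α ∧ TotFinSuppM k α ∧ TotIsCocycleM k dHM pdM (n - 1) α ∧
          TotXonlyCoboundary k SX dXL dXR pdX n (fun p q => cx p q - F (n - 1) α p q))
      ∧ (∀ (m : ℤ) (α : TotMCoch k C M),
        TotHomogM k St m α → TotFinSuppM k α → TotIsCocycleM k dHM pdM m α →
        TotXonlyCoboundary k SX dXL dXR pdX (m + 1) (F m α) →
        TotIsCoboundaryM k St dHM pdM m α) := by
  have hF_zero : ∀ m, F m 0 = 0 := fun m => by
    have h := hF_smul m 0 0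
    rwa [zero_smul, zero_smul] at h
  have hDDg : ∀ {N : ℤ} {g : TotXCoch k A B X}, TotHomogX k SX (N - 1) g →
      TotDXonly k dXL dXR pdX N (TotDXonly k dXL dXR pdX (N - 1) g) = 0 := by
    intro N g hg
    have h := totDXonly_totDXonly hL hR hP hg
    rwa [sub_add_cancel] at h
  constructor
  · intro n c hc hfin hcoc
    obtain ⟨g, hg, hgfin, α, hα, hαfin, e⟩ := hF_red n c hc hfin fun p q _ => hcoc p q
    refine ⟨α, hα, hαfin, fun p => ?_, (-1 : k) • g, fun p q => (hg p q).smul _, hgfin.smul _,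
      fun p q => ?_⟩
    · have h := hF_D (n - 1) α hα
      rw [sub_add_cancel, ← e, totDXonly_add, hDDg hg, add_zero] at h
      have h0 : TotDXonly k dXL dXR pdX n c = 0 := funext fun p => funext fun q => hcoc p q
      rw [h0] at h
      have h1 : F n (TotDM k dHM pdM (n - 1) α) = F n 0 := by
        rw [hF_zero, ← one_smul k (F n _), show (1 : k) = (-1) * (-1) by norm_num, ← smul_smul, ← h,
          smul_zero]
      exact congrFun (hF_inj n _ _ h1) p
    · rw [← e, totDXonly_smul]
      ext
      simp
  · rintro m α hα hαfin - ⟨b, hb, hbfin, hαb⟩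
    have hFb : F m α = TotDXonly k dXL dXR pdX (m + 1 - 1) b :=
      funext fun p => funext fun q => hαb p q
    obtain ⟨g, hg, hgfin, β, hβ, ⟨n, hn⟩, e⟩ := hF_red _ b hb hbfin fun p q hpq => by
      rw [← hFb, hF_bad m α p q hpq]
    have h := hF_D _ β hβ
    rw [sub_add_cancel, ← e, totDXonly_add, hDDg hg, add_zero, ← hFb, ← hF_smul, ← totDM_smul] at h
    rw [add_sub_cancel_right] at h hβ
    refine ⟨(-1 : k) • β, fun p => (hβ p).smul _, ⟨n, fun p hp => ?_⟩, fun p => ?_⟩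
    · rw [Pi.smul_apply, hn p hp, smul_zero]
    · exact congrFun (hF_inj m _ _ h) p

end embedding

/- ### The embedding `Φ` -/

section Phi

variable {dXL : ∀ (p q : ℕ) (r : ℤ), XCoch k A B X p q →ₗ[k] XCoch k A B X (p + 1) q}
variable {dXR : ∀ (p q : ℕ) (r : ℤ), XCoch k A B X p q →ₗ[k] XCoch k A B X p (q + 1)}
variable {pdX : ∀ (p q : ℕ) (r : ℤ), XCoch k A B X p q →ₗ[k] XCoch k A B X p q}
variable {E : Type} [AddCommGroup E] [Module k E] {EM : EndBModel k SX E}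
variable {dHE : ∀ (p : ℕ) (r : ℤ), MCoch k A E p →ₗ[k] MCoch k A E (p + 1)}
variable {pdE : ∀ (p : ℕ) (r : ℤ), MCoch k A E p →ₗ[k] MCoch k A E p}

theorem PhiMap_apply (p : ℕ) (r : ℤ) (f : MCoch k A E p) (a : Fin p → A) (x : X)
    (b : Fin 0 → B) : PhiMap k SX EM p r f a x b = ε k r • EM.toEnd (f a) x := rfl

theorem PhiMap_smul (p : ℕ) (r : ℤ) (s : k) (f : MCoch k A E p) :
    PhiMap k SX EM p r (s • f) = s • PhiMap k SX EM p r f := by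
  ext a x b
  simp only [PhiMap_apply, smul_apply, LinearMap.smul_apply, map_smul]
  rw [smul_comm]

theorem PhiMap_add (p : ℕ) (r : ℤ) (f g : MCoch k A E p) :
    PhiMap k SX EM p r (f + g) = PhiMap k SX EM p r f + PhiMap k SX EM p r g := by
  ext a x b
  simp only [PhiMap_apply, add_apply, LinearMap.add_apply, map_add, smul_add]

theorem PhiMap_injective (p : ℕ) (r : ℤ) : Function.Injective (PhiMap k SX EM p r) := by
  intro f g h
  ext a
  refine EM.inj (LinearMap.ext fun x => ?_)
  have h' := congrArg (fun F : XCoch k A B X p 0 => F a x Fin.elim0) h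
  simp only [PhiMap_apply] at h'
  rw [← one_smul k (EM.toEnd (f a) x), ← ε_mul_self k r, ← smul_smul, h', smul_smul, ε_mul_self,
    one_smul]

theorem pdX_PhiMap (hP : IsPdX k SX pdX) (hpdE : IsIntDiffM k EM.SE pdE) {p : ℕ} {r : ℤ}
    {f : MCoch k A E p} (hf : IsHomogM k EM.SE p r f) :
    pdX p 0 r (PhiMap k SX EM p r f) = (-1 : k) • PhiMap k SX EM p (r + 1) (pdE p r f) := by
  refine xcoch_ext SX fun dga a ha ix x hx dgb b hb => ?_
  rw [hP p 0 r _ dga a ha ix x hx dgb b hb]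
  simp only [smul_apply, LinearMap.smul_apply, PhiMap_apply]
  rw [hpdE p r f dga a ha, map_sub, LinearMap.sub_apply, EM.d_eq _ (hf dga a ha)]
  simp only [map_smul, map_sum, LinearMap.smul_apply, LinearMap.sum_apply, Finset.univ_eq_empty,
    Finset.sum_empty, add_zero, ε_succ, neg_smul, one_smul, neg_neg, smul_sub, smul_add,
    Finset.smul_sum, ε_smul_smul, ← Fin.sum_univ_eq_sum_range (fun i => dga i)]
  rw [sub_add_eq_sub_sub, sub_right_comm]
  congr 1
  refine Finset.sum_congr rfl fun i _ => ?_
  rw [add_comm (∑ j : Fin i, dga j)]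

theorem dXL_PhiMap (hL : IsDXL k SX dXL) (hdHE : IsHochDiffM k EM.SE dHE) (p : ℕ) (r : ℤ)
    (f : MCoch k A E p) :
    dXL p 0 r (PhiMap k SX EM p r f) = (-1 : k) • PhiMap k SX EM (p + 1) r (dHE p r f) := by
  refine xcoch_ext SX fun dga a ha ix x hx dgb b hb => ?_
  rw [hL p 0 r _ dga a ha x b]
  simp only [smul_apply, LinearMap.smul_apply, PhiMap_apply]
  rw [hdHE p r f dga a ha]
  simp only [map_add, map_sum, map_smul, LinearMap.add_apply, LinearMap.sum_apply,
    LinearMap.smul_apply, EM.actL_eq, EM.actR_eq, smul_add, Finset.smul_sum, ε_smul_smul, neg_smul,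
    one_smul, neg_ε_smul]
  congr 1
  · congr 1
    · congr 1
      refine ε_congr k ?_
      grind
    · refine Finset.sum_congr rfl fun i _ => ?_
      congr 1
      refine ε_congr k ?_
      grind
  · congr 1
    refine ε_congr k ?_
    grind

theorem dXR_PhiMap (hR : IsDXR k SX dXR) {p : ℕ} {r : ℤ}
    {f : MCoch k A E p} (hf : IsHomogM k EM.SE p r f) :
    dXR p 0 r (PhiMap k SX EM p r f) = 0 := by
  refine xcoch_ext SX fun dga a ha ix x hx dgb b hb => ?_
  rw [hR p 0 r _ a x b]
  simp only [PhiMap_apply, EM.rlin (hf dga a ha), Finset.univ_eq_empty,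
    Finset.sum_empty, add_zero, map_smul, ε_smul_smul]
  change _ = (0 : X)
  rw [← neg_add_cancel (ε k (r + r) • SX.actR (b 0) (EM.toEnd (f fun i => a i) x)), neg_ε_smul]
  congr 2
  refine ε_congr k ?_
  grind

theorem totDXonly_PhiTot (hL : IsDXL k SX dXL) (hR : IsDXR k SX dXR) (hP : IsPdX k SX pdX)
    (hdHE : IsHochDiffM k EM.SE dHE) (hpdE : IsIntDiffM k EM.SE pdE) (m : ℤ) (α : TotMCoch k A E)
    (hα : TotHomogM k EM.SE m α) :
    TotDXonly k dXL dXR pdX (m + 1) (PhiTot k SX EM m α)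
      = (-1 : k) • PhiTot k SX EM (m + 1) (TotDM k dHE pdE m α) := by
  have e : ∀ p : ℕ, m + 1 - p - (0 : ℕ) - 1 = m - p := fun p => by push_cast; ring
  funext p q
  rw [totDXonly_apply, Pi.smul_apply, Pi.smul_apply]
  rcases q with _ | _ | q
  · rw [e]
    change pdX p 0 (m - p) (PhiMap k SX EM p (m - p) (α p)) + _ + 0
      = (-1 : k) • PhiMap k SX EM p (m + 1 - p) _
    rw [pdX_PhiMap hP hpdE (hα p), add_zero]
    rcases p with _ | p
    · rw [totDM_zero_apply, totL, add_zero, sub_add_eq_add_sub]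
    · rw [totDM_succ_apply, totL, e, PhiMap_add, smul_add, sub_add_eq_add_sub]
      change _ + dXL p 0 (m - p) (PhiMap k SX EM p (m - p) (α p)) = _
      rw [dXL_PhiMap hL hdHE, show m + 1 - ((p + 1 : ℕ) : ℤ) = m - p by push_cast; ring]
  · change pdX p 1 _ 0 + _ + dXR p 0 _ (PhiMap k SX EM p (m - p) (α p)) = (-1 : k) • 0
    rw [e, dXR_PhiMap hR (hα p)]
    rcases p with _ | p
    · simp [totL]
    · simp [totL, PhiTot]
  · rcases p with _ | p <;> simp [totL, totR, PhiTot]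

theorem exists_PhiMap_eq (hR : IsDXR k SX dXR) {p : ℕ} {r : ℤ} {f : XCoch k A B X p 0}
    (hf : IsHomogX k SX p 0 r f) (h0 : dXR p 0 r f = 0) :
    ∃ α : MCoch k A E p, IsHomogM k EM.SE p r α ∧ PhiMap k SX EM p r α = f := by
  obtain ⟨ρ, hρ⟩ := LinearMap.exists_leftInverse_of_injective EM.toEnd
    (LinearMap.ker_eq_bot.mpr EM.inj)
  let ev : YCoch k B X 0 →ₗ[k] X →ₗ[k] X :=
    { toFun := fun φ =>
        { toFun := fun x => φ x Fin.elim0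
          map_add' := fun x y => by rw [map_add]; rfl
          map_smul' := fun c x => by rw [map_smul]; rfl }
      map_add' := fun _ _ => rfl
      map_smul' := fun _ _ => rfl }
  have key : ∀ (dga : ℕ → ℤ) (a : ℕ → A), (∀ i, a i ∈ RA.gr (dga i)) →
      ∃ e ∈ EM.SE.gr ((∑ i : Fin p, dga i) + r), EM.toEnd e = ev (f (fun i => a i)) := by
    intro dga a ha
    refine EM.surj _ _ (fun b x => ?_) (fun i x hx => ?_)
    · have h := hR p 0 r f a x (fun _ => b)
      rw [h0] at h
      change (0 : X) = _ at h
      rw [Finset.univ_eq_empty, Finset.sum_empty, add_zero,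
        show ε k (((0 : ℕ) : ℤ) + r - 1) = -ε k r by
          rw [← ε_succ]; exact ε_congr k (by grind), neg_smul, eq_comm, neg_add_eq_zero] at h
      have h' := congrArg (fun y => ε k r • y) h
      simp only [smul_smul, ε_mul_self, one_smul] at h'
      change f _ _ Fin.elim0 = SX.actR b (f _ _ Fin.elim0)
      rw [Subsingleton.elim (Fin.elim0 : Fin 0 → B) (fun _ => b)]
      exact h'
    · have h := hf dga a ha i x hx (fun _ => 0) (fun _ => 0) (fun _ => zero_mem _)
      change f _ x Fin.elim0 ∈ _
      rw [Subsingleton.elim (Fin.elim0 : Fin 0 → B) (fun _ => 0)]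
      convert h using 2
      simp
      ring
  have hρe : ∀ e, ρ (EM.toEnd e) = e := LinearMap.congr_fun hρ
  refine ⟨ε k r • (ρ ∘ₗ ev).compMultilinearMap f, fun dga a ha => ?_, ?_⟩
  · obtain ⟨e, he, hef⟩ := key dga a ha
    refine Submodule.smul_mem _ _ ?_
    change ρ (ev (f _)) ∈ _
    rwa [← hef, hρe]
  · refine multilinear_ext_of_homogeneous RA.isInternal fun dga a ha => ?_
    obtain ⟨e, he, hef⟩ := key dga a ha
    ext x b
    rw [PhiMap_apply, smul_apply, map_smul, LinearMap.smul_apply, smul_smul, ε_mul_self, one_smul]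
    change EM.toEnd (ρ (ev (f _))) x = _
    rw [← hef, hρe, hef, Subsingleton.elim b Fin.elim0]
    rfl

theorem exists_reduction_PhiTot [CharZero k] (hL : IsDXL k SX dXL) (hR : IsDXR k SX dXR)
    (hP : IsPdX k SX pdX)
    {dR : ∀ (q : ℕ) (r : ℤ), YCoch k B X q →ₗ[k] YCoch k B X (q + 1)} (hdR : IsDR k SX dR)
    (hex : ExactR k SX dR) (N : ℤ) (c : TotXCoch k A B X) (hc : TotHomogX k SX N c)
    (hfin : TotFinSuppX k c) (hD : ∀ p q, 0 < q → TotDXonly k dXL dXR pdX N c p q = 0) :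
    ∃ g : TotXCoch k A B X, TotHomogX k SX (N - 1) g ∧ TotFinSuppX k g ∧
      ∃ α : TotMCoch k A E, TotHomogM k EM.SE (N - 1) α ∧ TotFinSuppM k α ∧
        c + TotDXonly k dXL dXR pdX (N - 1) g = PhiTot k SX EM (N - 1) α := by
  obtain ⟨g, hg, hgfin, hcg⟩ := exists_reduction_right hL hR hP
    (fun hf h0 => exists_dXR_eq hR hdR hex hf h0) hc hfin hD
  have hDg := hg.totDXonly hL hR hP
  have hDDg := totDXonly_totDXonly hL hR hP hg
  rw [sub_add_cancel] at hDg hDDg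
  obtain ⟨n, hn⟩ := hfin.add (hgfin.totDXonly (dXL := dXL) (dXR := dXR) (pdX := pdX) (N - 1))
  have hc' := hc.add hDg
  have hD' : ∀ p, TotDXonly k dXL dXR pdX N (c + TotDXonly k dXL dXR pdX (N - 1) g) p 1 = 0 :=
    fun p => by rw [totDXonly_add, hDDg, add_zero, hD p 1 one_pos]
  obtain ⟨c', hcc'⟩ : ∃ c', c' = c + TotDXonly k dXL dXR pdX (N - 1) g := ⟨_, rfl⟩
  rw [← hcc'] at hcg hn hc' hD'
  have e : ∀ p : ℕ, N - p - (0 : ℕ) - 1 = N - 1 - p := fun p => by push_cast; ring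
  have hα : ∀ p, ∃ α : MCoch k A E p, IsHomogM k EM.SE p (N - 1 - p) α ∧
      PhiMap k SX EM p (N - 1 - p) α = c' p 0 := by
    intro p
    have h := hD' p
    have hl : totL dXL N c' p 1 = 0 := by
      rcases p with _ | p
      · rfl
      · rw [totL, hcg p 1 one_pos, map_zero]
    rw [totDXonly_apply, hcg p 1 one_pos, map_zero, hl, add_zero, zero_add, totR] at h
    rw [← e]
    exact exists_PhiMap_eq hR (hc' p 0) h
  choose α hα hαc using hα
  refine ⟨g, hg, hgfin, α, hα, ⟨n, fun p hp => ?_⟩, ?_⟩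
  · refine PhiMap_injective (SX := SX) (EM := EM) p (N - 1 - p) ?_
    rw [hαc, hn p 0 (by omega), ← zero_smul k (0 : MCoch k A E p), PhiMap_smul, zero_smul]
  · rw [← hcc']
    funext p q
    rcases q with _ | q
    · exact (hαc p).symm
    · exact hcg p (q + 1) (by omega)

theorem PhiTot_smul (m : ℤ) (s : k) (α : TotMCoch k A E) :
    PhiTot k SX EM m (s • α) = s • PhiTot k SX EM m α := by
  funext p q
  rcases q with _ | q
  · exact PhiMap_smul p (m - p) s (α p)
  · exact (smul_zero s).symm

theorem PhiTot_injective (m : ℤ) : Function.Injective (PhiTot k SX EM m) := fun α β h =>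
  funext fun p => PhiMap_injective p (m - p) (congrFun (congrFun h p) 0)

theorem PhiTot_apply_of_pos (m : ℤ) (α : TotMCoch k A E) (p : ℕ) {q : ℕ} (hq : 0 < q) :
    PhiTot k SX EM m α p q = 0 := by
  obtain ⟨q, rfl⟩ := Nat.exists_eq_succ_of_ne_zero hq.ne'
  rfl

end Phi

/- ### The embedding `Ψ` -/

section Psi

variable {dXL : ∀ (p q : ℕ) (r : ℤ), XCoch k A B X p q →ₗ[k] XCoch k A B X (p + 1) q}
variable {dXR : ∀ (p q : ℕ) (r : ℤ), XCoch k A B X p q →ₗ[k] XCoch k A B X p (q + 1)}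
variable {pdX : ∀ (p q : ℕ) (r : ℤ), XCoch k A B X p q →ₗ[k] XCoch k A B X p q}
variable {E : Type} [AddCommGroup E] [Module k E] {EM : EndAModel k SX E}
variable {dHE : ∀ (q : ℕ) (r : ℤ), MCoch k B E q →ₗ[k] MCoch k B E (q + 1)}
variable {pdE : ∀ (q : ℕ) (r : ℤ), MCoch k B E q →ₗ[k] MCoch k B E q}
variable {Psi : ∀ (q : ℕ) (r : ℤ), MCoch k B E q →ₗ[k] XCoch k A B X 0 q}

theorem ε_eq_of_eq_add_two_mul {m n : ℤ} (t : ℤ) (h : m = n + 2 * t) : ε k m = ε k n :=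
  ε_congr k (by rw [h]; simp [Int.even_add])

theorem sum_range_merge (d : ℕ → ℤ) {q j : ℕ} (hj : j < q) :
    (∑ l ∈ Finset.range q, if l < j then d l else if l = j then d j + d (j + 1) else d (l + 1))
      = ∑ l ∈ Finset.range (q + 1), d l := by
  induction q with
  | zero => omega
  | succ q ih =>
    rw [Finset.sum_range_succ, Finset.sum_range_succ _ (q + 1)]
    rcases Nat.lt_succ_iff_lt_or_eq.mp hj with h | rfl
    · rw [ih h, if_neg (by omega), if_neg (by omega)]
    · rw [if_neg (lt_irrefl _), if_pos rfl, Finset.sum_range_succ _ j, add_assoc]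
      congr 1
      exact Finset.sum_congr rfl fun l hl => if_pos (Finset.mem_range.mp hl)

theorem sum_range_ite_add_one (d : ℕ → ℤ) {q j : ℕ} (hj : j < q) :
    (∑ l ∈ Finset.range q, if l = j then d j + 1 else d l) = ∑ l ∈ Finset.range q, d l + 1 := by
  have h : ∀ l, (if l = j then d j + 1 else d l) = d l + if l = j then 1 else 0 := fun l => by
    split_ifs with h
    · rw [h]
    · rw [add_zero]
  simp only [h, Finset.sum_add_distrib, Finset.sum_ite_eq', Finset.mem_range, hj, if_true]

theorem prod_ε (n : ℕ) (d : ℕ → ℤ) :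
    ∏ j : Fin n, ε k (d j) = ε k (∑ j ∈ Finset.range n, d j) := by
  induction n with
  | zero => simp [ε_zero]
  | succ n ih =>
    rw [Fin.prod_univ_castSucc, Finset.sum_range_succ, ← ε_mul_ε, ← ih]
    rfl

theorem Psi_apply (hPsi : IsPsi k SX EM Psi) {q : ℕ} {r : ℤ} {f : MCoch k B E q} {a : Fin 0 → A}
    {ix : ℤ} {x : X} (hx : x ∈ SX.gr ix) {dgb : ℕ → ℤ} {b : ℕ → B}
    (hb : ∀ j, b j ∈ RB.gr (dgb j)) :
    Psi q r f a x (fun j => b j) = ε k ((q : ℤ) + r - 1 + ix * ∑ j ∈ Finset.range q, dgb j) •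
      EM.toEnd (f (fun j => b j)) x := by
  rw [hPsi q r f a ix x hx dgb b hb, ε_mul_ε]

theorem Psi_injective (hPsi : IsPsi k SX EM Psi) (q : ℕ) (r : ℤ) :
    Function.Injective (Psi q r) := by
  intro f g h
  refine multilinear_ext_of_homogeneous RB.isInternal fun dgb b hb => ?_
  refine EM.inj (linear_ext_of_homogeneous SX.isInternal fun ix x hx => ?_)
  have h' := congrArg (fun F : XCoch k A B X 0 q => F Fin.elim0 x (fun j => b j)) h
  simp only [Psi_apply hPsi hx hb] at h'
  rw [← ε_smul_self k _ (EM.toEnd (f _) x), h', ε_smul_self]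

theorem mem_gr_apply {q : ℕ} {r : ℤ} {f : MCoch k B E q} (hf : IsHomogM k EM.SE q r f)
    {dgb : ℕ → ℤ} {b : ℕ → B} (hb : ∀ j, b j ∈ RB.gr (dgb j)) :
    f (fun j => b j) ∈ EM.SE.gr (∑ j ∈ Finset.range q, dgb j + r) := by
  rw [Finset.sum_range]
  exact hf dgb b hb

theorem dXL_Psi (hL : IsDXL k SX dXL) (hPsi : IsPsi k SX EM Psi) {q : ℕ} {r : ℤ}
    {f : MCoch k B E q} (hf : IsHomogM k EM.SE q r f) : dXL 0 q r (Psi q r f) = 0 := by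
  refine xcoch_ext SX fun dga a ha ix x hx dgb b hb => ?_
  rw [hL 0 q r _ dga a ha x b, Psi_apply hPsi hx hb, Psi_apply hPsi (SX.actL_mem (ha 0) hx) hb,
    EM.llin (mem_gr_apply hf hb) (ha 0)]
  simp only [Finset.univ_eq_empty, Finset.sum_empty, add_zero, map_smul, ε_smul_smul]
  change _ = (0 : X)
  rw [add_eq_zero_iff_eq_neg, neg_ε_smul]
  congr 1
  refine ε_eq_of_eq_add_two_mul (-(dga 0 * ∑ j ∈ Finset.range q, dgb j) - 1) ?_
  push_cast
  ring

theorem dXR_Psi (hR : IsDXR k SX dXR) (hPsi : IsPsi k SX EM Psi) (hdHE : IsHochDiffM k EM.SE dHE)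
    {q : ℕ} {r : ℤ} {f : MCoch k B E q} (hf : IsHomogM k EM.SE q r f) :
    dXR 0 q r (Psi q r f) = (-1 : k) • Psi (q + 1) r (dHE q r f) := by
  refine xcoch_ext SX fun dga a ha ix x hx dgb b hb => ?_
  rw [hR 0 q r _ a x b]
  simp only [smul_apply, LinearMap.smul_apply]
  rw [Psi_apply hPsi (SX.actR_mem (hb 0) hx) (b := fun j => b (j + 1)) fun j => hb (j + 1),
    Psi_apply hPsi hx hb, Psi_apply hPsi hx hb, hdHE q r f dgb b hb]
  simp only [map_add, map_sum, map_smul, LinearMap.add_apply, LinearMap.sum_apply,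
    LinearMap.smul_apply, smul_add, Finset.smul_sum]
  rw [EM.actL_eq (b 0) _ x (hb 0)
      (mem_gr_apply hf (b := fun j => b (j + 1)) fun j => hb (j + 1)) hx,
    EM.actR_eq (b q) _ x (hb q) hx]
  simp only [ε_smul_smul, neg_smul, one_smul, neg_ε_smul]
  congr 1
  · congr 1
    · congr 1
      rw [Finset.sum_range_succ' dgb q]
      refine ε_eq_of_eq_add_two_mul (-1 - ix * dgb 0 - r * dgb 0) ?_
      push_cast
      ring
    · refine Finset.sum_congr rfl fun j _ => ?_
      rw [Psi_apply hPsi hx (dgb := fun l => if l < (j : ℕ) then dgb l else if l = j then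
        dgb j + dgb (j + 1) else dgb (l + 1)) (b := fun l => if l < (j : ℕ) then b l else
          if l = j then b j * b (j + 1) else b (l + 1)), sum_range_merge dgb j.2, ε_smul_smul]
      · congr 1
        refine ε_eq_of_eq_add_two_mul (-1) ?_
        push_cast
        ring
      · intro l
        split_ifs
        exacts [hb l, RB.mul_mem (hb _) (hb _), hb _]
  · congr 1
    rw [Finset.sum_range_succ dgb q]
    refine ε_eq_of_eq_add_two_mul (-1 - ix * dgb q) ?_
    push_cast
    ring

theorem pdX_Psi (hP : IsPdX k SX pdX) (hPsi : IsPsi k SX EM Psi) (hpdE : IsIntDiffM k EM.SE pdE)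
    {q : ℕ} {r : ℤ} {f : MCoch k B E q} (hf : IsHomogM k EM.SE q r f) :
    pdX 0 q r (Psi q r f) = (-1 : k) • Psi q (r + 1) (pdE q r f) := by
  refine xcoch_ext SX fun dga a ha ix x hx dgb b hb => ?_
  rw [hP 0 q r _ dga a ha ix x hx dgb b hb]
  simp only [smul_apply, LinearMap.smul_apply]
  rw [Psi_apply hPsi hx hb, Psi_apply hPsi (SX.dX_mem hx) hb, Psi_apply hPsi hx hb,
    hpdE q r f dgb b hb, map_sub, LinearMap.sub_apply, EM.d_eq _ (mem_gr_apply hf hb)]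
  simp only [map_sum, map_smul, LinearMap.sum_apply, LinearMap.smul_apply, smul_add, smul_sub,
    Finset.smul_sum, Finset.univ_eq_empty, Finset.sum_empty, zero_add, ε_smul_smul,
    Finset.range_zero]
  rw [sub_add_eq_sub_sub]
  simp only [sub_eq_add_neg, ← Finset.sum_neg_distrib, neg_smul, one_smul, neg_ε_smul]
  congr 1
  · congr 1
    · congr 1
      refine ε_congr k ?_
      grind
    · congr 1
      refine ε_congr k ?_
      simp only [Int.even_add, Int.even_mul, Int.not_even_one]
      tauto
  · refine Finset.sum_congr rfl fun j _ => ?_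
    rw [Psi_apply hPsi hx (dgb := fun l => if l = (j : ℕ) then dgb j + 1 else dgb l)
      (b := fun l => if l = (j : ℕ) then RB.d (b j) else b l), sum_range_ite_add_one dgb j.2,
      ε_smul_smul]
    · congr 1
      refine ε_eq_of_eq_add_two_mul (ix - 1) ?_
      ring
    · intro l
      split_ifs
      exacts [RB.d_mem (hb _), hb _]

theorem totDXonly_PsiTot (hL : IsDXL k SX dXL) (hR : IsDXR k SX dXR) (hP : IsPdX k SX pdX)
    (hPsi : IsPsi k SX EM Psi) (hdHE : IsHochDiffM k EM.SE dHE) (hpdE : IsIntDiffM k EM.SE pdE)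
    (m : ℤ) (β : TotMCoch k B E) (hβ : TotHomogM k EM.SE m β) :
    TotDXonly k dXL dXR pdX (m + 1) (PsiTot k Psi m β)
      = (-1 : k) • PsiTot k Psi (m + 1) (TotDM k dHE pdE m β) := by
  have e : ∀ q : ℕ, m + 1 - (0 : ℕ) - q - 1 = m - q := fun q => by push_cast; ring
  funext p q
  rw [totDXonly_apply, Pi.smul_apply, Pi.smul_apply]
  rcases p with _ | _ | p
  · rw [e]
    change pdX 0 q (m - q) (Psi q (m - q) (β q)) + 0 + _ = (-1 : k) • Psi q (m + 1 - q) _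
    rw [pdX_Psi hP hPsi hpdE (hβ q), add_zero]
    rcases q with _ | q
    · rw [totDM_zero_apply, totR, add_zero, sub_add_eq_add_sub]
    · rw [totDM_succ_apply, totR, e, map_add, smul_add, sub_add_eq_add_sub]
      change _ + dXR 0 q (m - q) (Psi q (m - q) (β q)) = _
      rw [dXR_Psi hR hPsi hdHE (hβ q), show m + 1 - ((q + 1 : ℕ) : ℤ) = m - q by push_cast; ring]
  · change pdX 1 q _ 0 + dXL 0 q _ (Psi q (m - q) (β q)) + _ = (-1 : k) • 0
    rw [e, dXL_Psi hL hPsi (hβ q)]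
    rcases q with _ | q
    · simp [totR]
    · simp [totR, PsiTot]
  · rcases q with _ | q <;> simp [totL, totR, PsiTot]

/-- Twisting a cochain by the sign `(-1)^{|x|(|b₁|+⋯+|b_q|)}`. -/
theorem exists_sign_twist (SX : ABBimod k RA RB X) {q : ℕ} (f : XCoch k A B X 0 q) :
    ∃ F : MultilinearMap k (fun _ : Fin q => B) (X →ₗ[k] X),
      ∀ (ix : ℤ) (x : X), x ∈ SX.gr ix → ∀ (dgb : ℕ → ℤ) (b : ℕ → B),
        (∀ j, b j ∈ RB.gr (dgb j)) → F (fun j => b j) x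
          = ε k (ix * ∑ j ∈ Finset.range q, dgb j) • f Fin.elim0 x (fun j => b j) := by
  choose σ hσ using fun i => exists_sign RB.isInternal i
  obtain ⟨G, hG⟩ := exists_linearMap_of_pieces SX.isInternal.submodule_iSupIndep
    (fun i => MultilinearMap.compLinearMapₗ (fun _ : Fin q => σ i) ∘ₗ f Fin.elim0 ∘ₗ
      (SX.gr i).subtype)
  let evA : ZCoch k A X 0 →ₗ[k] X →ₗ[k] X :=
    { toFun := fun φ => φ Fin.elim0
      map_add' := fun _ _ => rfl
      map_smul' := fun _ _ => rfl }
  refine ⟨evA.compMultilinearMap (sliceB (MultilinearMap.constOfIsEmpty k _ G)),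
    fun ix x hx dgb b hb => ?_⟩
  change G x (fun j => b j) = _
  rw [hG ix ⟨x, hx⟩]
  change f Fin.elim0 x (fun j => σ ix (b j)) = _
  rw [funext fun j : Fin q => hσ ix _ _ (hb j), MultilinearMap.map_smul_univ,
    prod_ε q fun j => ix * dgb j, Finset.mul_sum]

theorem exists_Psi_eq (hL : IsDXL k SX dXL) (hPsi : IsPsi k SX EM Psi) {q : ℕ} {r : ℤ}
    {f : XCoch k A B X 0 q} (hf : IsHomogX k SX 0 q r f) (h0 : dXL 0 q r f = 0) :
    ∃ β : MCoch k B E q, IsHomogM k EM.SE q r β ∧ Psi q r β = f := by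
  obtain ⟨ρ, hρ⟩ := LinearMap.exists_leftInverse_of_injective EM.toEnd
    (LinearMap.ker_eq_bot.mpr EM.inj)
  have hρe : ∀ e, ρ (EM.toEnd e) = e := LinearMap.congr_fun hρ
  obtain ⟨F, hF⟩ := exists_sign_twist SX f
  have key : ∀ (dgb : ℕ → ℤ) (b : ℕ → B), (∀ j, b j ∈ RB.gr (dgb j)) →
      ∃ e ∈ EM.SE.gr ((∑ j : Fin q, dgb j) + r), EM.toEnd e = F (fun j => b j) := by
    intro dgb b hb
    refine EM.surj _ _ (fun i a x ha => ?_) (fun i x hx => ?_)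
    · refine LinearMap.congr_fun (f := F (fun j => b j) ∘ₗ SX.actL a)
        (g := ε k ((∑ j : Fin q, dgb j + r) * i) • (SX.actL a ∘ₗ F (fun j => b j)))
        (linear_ext_of_homogeneous SX.isInternal fun ix x hx => ?_) x
      rw [LinearMap.smul_apply, LinearMap.comp_apply, LinearMap.comp_apply,
        hF _ _ (SX.actL_mem ha hx) dgb b hb, hF _ _ hx dgb b hb, map_smul, ε_smul_smul]
      have h := hL 0 q r f (fun _ => i) (fun _ => a) (fun _ => ha) x b
      rw [h0] at h
      change (0 : X) = _ at h
      rw [Finset.univ_eq_empty, Finset.sum_empty, add_zero, eq_comm, add_comm,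
        add_eq_zero_iff_eq_neg, neg_ε_smul] at h
      have h' := congrArg (fun y => ε k ((q : ℤ) + r + 1) • y) h
      simp only [ε_smul_self, ε_smul_smul] at h'
      rw [Subsingleton.elim (Fin.elim0 : Fin 0 → A) (fun _ => a), h', ε_smul_smul,
        ← Finset.sum_range]
      congr 1
      refine ε_eq_of_eq_add_two_mul ((q : ℤ) + r + 1) ?_
      push_cast
      ring
    · have h := hf (fun _ => 0) (fun _ => 0) (fun _ => zero_mem _) i x hx dgb b hb
      rw [hF _ _ hx dgb b hb, Subsingleton.elim (Fin.elim0 : Fin 0 → A) (fun _ => 0)]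
      refine Submodule.smul_mem _ _ ?_
      convert h using 2
      simp
      ring
  refine ⟨ε k ((q : ℤ) + r - 1) • ρ.compMultilinearMap F, fun dgb b hb => ?_, ?_⟩
  · obtain ⟨e, he, hef⟩ := key dgb b hb
    refine Submodule.smul_mem _ _ ?_
    change ρ (F _) ∈ _
    rwa [← hef, hρe]
  · refine xcoch_ext SX fun dga a ha ix x hx dgb b hb => ?_
    obtain ⟨e, he, hef⟩ := key dgb b hb
    rw [Psi_apply hPsi hx hb, smul_apply, map_smul, LinearMap.smul_apply, ε_smul_smul]
    change _ • EM.toEnd (ρ (F _)) x = _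
    rw [← hef, hρe, hef, hF _ _ hx dgb b hb, ε_smul_smul,
      Subsingleton.elim (Fin.elim0 : Fin 0 → A) (fun i => a i)]
    refine (congrArg (· • _) (ε_eq_of_eq_add_two_mul (n := 0)
      ((q : ℤ) + r - 1 + ix * ∑ j ∈ Finset.range q, dgb j) ?_)).trans ?_
    · ring
    · rw [ε_zero, one_smul]

theorem exists_reduction_PsiTot [CharZero k] (hL : IsDXL k SX dXL) (hR : IsDXR k SX dXR)
    (hP : IsPdX k SX pdX) (hPsi : IsPsi k SX EM Psi)
    {dL : ∀ (p : ℕ) (r : ℤ), ZCoch k A X p →ₗ[k] ZCoch k A X (p + 1)} (hdL : IsDL k SX dL)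
    (hex : ExactL k SX dL) (N : ℤ) (c : TotXCoch k A B X) (hc : TotHomogX k SX N c)
    (hfin : TotFinSuppX k c) (hD : ∀ p q, 0 < p → TotDXonly k dXL dXR pdX N c p q = 0) :
    ∃ g : TotXCoch k A B X, TotHomogX k SX (N - 1) g ∧ TotFinSuppX k g ∧
      ∃ β : TotMCoch k B E, TotHomogM k EM.SE (N - 1) β ∧ TotFinSuppM k β ∧
        c + TotDXonly k dXL dXR pdX (N - 1) g = PsiTot k Psi (N - 1) β := by
  obtain ⟨g, hg, hgfin, hcg⟩ := exists_reduction_left hL hR hP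
    (fun hf h0 => exists_dXL_eq hL hdL hex hf h0) hc hfin hD
  have hDg := hg.totDXonly hL hR hP
  have hDDg := totDXonly_totDXonly hL hR hP hg
  rw [sub_add_cancel] at hDg hDDg
  obtain ⟨n, hn⟩ := hfin.add (hgfin.totDXonly (dXL := dXL) (dXR := dXR) (pdX := pdX) (N - 1))
  have hc' := hc.add hDg
  have hD' : ∀ q, TotDXonly k dXL dXR pdX N (c + TotDXonly k dXL dXR pdX (N - 1) g) 1 q = 0 :=
    fun q => by rw [totDXonly_add, hDDg, add_zero, hD 1 q one_pos]
  obtain ⟨c', hcc'⟩ : ∃ c', c' = c + TotDXonly k dXL dXR pdX (N - 1) g := ⟨_, rfl⟩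
  rw [← hcc'] at hcg hn hc' hD'
  have e : ∀ q : ℕ, N - (0 : ℕ) - q - 1 = N - 1 - q := fun q => by push_cast; ring
  have hβ : ∀ q, ∃ β : MCoch k B E q, IsHomogM k EM.SE q (N - 1 - q) β ∧
      Psi q (N - 1 - q) β = c' 0 q := by
    intro q
    have h := hD' q
    have hr : totR dXR N c' 1 q = 0 := by
      rcases q with _ | q
      · rfl
      · rw [totR, hcg 1 q one_pos, map_zero]
    rw [totDXonly_apply, hcg 1 q one_pos, map_zero, hr, add_zero, zero_add, totL] at h
    rw [← e]
    exact exists_Psi_eq hL hPsi (hc' 0 q) h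
  choose β hβ hβc using hβ
  refine ⟨g, hg, hgfin, β, hβ, ⟨n, fun q hq => ?_⟩, ?_⟩
  · refine Psi_injective hPsi q (N - 1 - q) ?_
    rw [hβc, hn 0 q (by omega), map_zero]
  · rw [← hcc']
    funext p q
    rcases p with _ | p
    · exact (hβc q).symm
    · exact hcg (p + 1) q (by omega)

theorem PsiTot_smul (m : ℤ) (s : k) (β : TotMCoch k B E) :
    PsiTot k Psi m (s • β) = s • PsiTot k Psi m β := by
  funext p q
  rcases p with _ | p
  · exact map_smul (Psi q (m - q)) s (β q)
  · exact (smul_zero s).symm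

theorem PsiTot_injective (hPsi : IsPsi k SX EM Psi) (m : ℤ) :
    Function.Injective (PsiTot k Psi m) := fun α β h =>
  funext fun q => Psi_injective hPsi q (m - q) (congrFun (congrFun h 0) q)

theorem PsiTot_apply_of_pos (m : ℤ) (β : TotMCoch k B E) {p : ℕ} (hp : 0 < p) (q : ℕ) :
    PsiTot k Psi m β p q = 0 := by
  obtain ⟨p, rfl⟩ := Nat.exists_eq_succ_of_ne_zero hp.ne'
  rfl

end Psi

end Reduction

/-- Let `A`, `B` be dg algebras over a field `k` of
characteristic zero and `X` a dg `A`-`B`-bimodule.  If the partial Hochschild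
sequence `0 → Hom_{B^op}(X,X) ↪ Hom(X,X) → Hom(X⊗B,X) → ⋯` is exact, then the
embedding `Φ : Hoch_⊕^•(A, Hom_{B^op}(X,X))[-1] → Hoch_⊕^•(A,X,B)` is a
quasi-isomorphism; similarly, if `0 → Hom_A(X,X) ↪ Hom(X,X) → Hom(A⊗X,X) → ⋯`
is exact, then `Ψ : Hoch_⊕^•(B, Hom_A(X,X))[-1] → Hoch_⊕^•(A,X,B)` is a
quasi-isomorphism. -/
theorem statement9
    (k : Type) [Field k] [CharZero k]
    (A : Type) [Ring A] [Algebra k A] (B : Type) [Ring B] [Algebra k B]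
    (X : Type) [AddCommGroup X] [Module k X]
    (E : Type) [AddCommGroup E] [Module k E]
    (E' : Type) [AddCommGroup E'] [Module k E']
    (RA : KD.DGAlgebra k A) (RB : KD.DGAlgebra k B) (SX : KD.ABBimod k RA RB X)
    -- models for `Hom_{B^op}(X,X)` and `Hom_A(X,X)`:
    (EM : KD.EndBModel k SX E) (EM' : KD.EndAModel k SX E')
    -- the structure operators of the complex `Hoch_⊕(A,X,B)`:
    (dXL : ∀ (p q : ℕ) (r : ℤ), KD.XCoch k A B X p q →ₗ[k] KD.XCoch k A B X (p + 1) q)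
    (dXR : ∀ (p q : ℕ) (r : ℤ), KD.XCoch k A B X p q →ₗ[k] KD.XCoch k A B X p (q + 1))
    (pdX : ∀ (p q : ℕ) (r : ℤ), KD.XCoch k A B X p q →ₗ[k] KD.XCoch k A B X p q)
    (hdXL : KD.IsDXL k SX dXL) (hdXR : KD.IsDXR k SX dXR) (hpdX : KD.IsPdX k SX pdX)
    -- the structure operators of the complexes with values in the Hom-bimodules:
    (dHE : ∀ (p : ℕ) (r : ℤ), KD.MCoch k A E p →ₗ[k] KD.MCoch k A E (p + 1))
    (pdE : ∀ (p : ℕ) (r : ℤ), KD.MCoch k A E p →ₗ[k] KD.MCoch k A E p)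
    (hdHE : KD.IsHochDiffM k EM.SE dHE) (hpdE : KD.IsIntDiffM k EM.SE pdE)
    (dHE' : ∀ (q : ℕ) (r : ℤ), KD.MCoch k B E' q →ₗ[k] KD.MCoch k B E' (q + 1))
    (pdE' : ∀ (q : ℕ) (r : ℤ), KD.MCoch k B E' q →ₗ[k] KD.MCoch k B E' q)
    (hdHE' : KD.IsHochDiffM k EM'.SE dHE') (hpdE' : KD.IsIntDiffM k EM'.SE pdE')
    -- the map `Ψ`:
    (Psi : ∀ (q : ℕ) (r : ℤ), KD.MCoch k B E' q →ₗ[k] KD.XCoch k A B X 0 q)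
    (hPsi : KD.IsPsi k SX EM' Psi)
    -- the partial Hochschild differentials of the two sequences:
    (dR : ∀ (q : ℕ) (r : ℤ), KD.YCoch k B X q →ₗ[k] KD.YCoch k B X (q + 1))
    (dL : ∀ (p : ℕ) (r : ℤ), KD.ZCoch k A X p →ₗ[k] KD.ZCoch k A X (p + 1))
    (hdR : KD.IsDR k SX dR) (hdL : KD.IsDL k SX dL) :
    -- first half: exactness of the right sequence makes `Φ` a quasi-isomorphism
    (KD.ExactR k SX dR →
      -- `Φ` is surjective on cohomology:
      (∀ (n : ℤ) (cx : KD.TotXCoch k A B X),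
        KD.TotHomogX k SX n cx → KD.TotFinSuppX k cx →
        KD.TotXonlyCocycle k dXL dXR pdX n cx →
        ∃ α : KD.TotMCoch k A E,
          KD.TotHomogM k EM.SE (n - 1) α ∧ KD.TotFinSuppM k α ∧
          KD.TotIsCocycleM k dHE pdE (n - 1) α ∧
          KD.TotXonlyCoboundary k SX dXL dXR pdX n
            (fun p q => cx p q - KD.PhiTot k SX EM (n - 1) α p q))
      ∧ -- `Φ` is injective on cohomology:
      (∀ (m : ℤ) (α : KD.TotMCoch k A E),
        KD.TotHomogM k EM.SE m α → KD.TotFinSuppM k α →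
        KD.TotIsCocycleM k dHE pdE m α →
        KD.TotXonlyCoboundary k SX dXL dXR pdX (m + 1) (KD.PhiTot k SX EM m α) →
        KD.TotIsCoboundaryM k EM.SE dHE pdE m α))
    ∧ -- second half: exactness of the left sequence makes `Ψ` a quasi-isomorphism
    (KD.ExactL k SX dL →
      (∀ (n : ℤ) (cx : KD.TotXCoch k A B X),
        KD.TotHomogX k SX n cx → KD.TotFinSuppX k cx →
        KD.TotXonlyCocycle k dXL dXR pdX n cx →
        ∃ β : KD.TotMCoch k B E',
          KD.TotHomogM k EM'.SE (n - 1) β ∧ KD.TotFinSuppM k β ∧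
          KD.TotIsCocycleM k dHE' pdE' (n - 1) β ∧
          KD.TotXonlyCoboundary k SX dXL dXR pdX n
            (fun p q => cx p q - KD.PsiTot k Psi (n - 1) β p q))
      ∧ (∀ (m : ℤ) (β : KD.TotMCoch k B E'),
        KD.TotHomogM k EM'.SE m β → KD.TotFinSuppM k β →
        KD.TotIsCocycleM k dHE' pdE' m β →
        KD.TotXonlyCoboundary k SX dXL dXR pdX (m + 1) (KD.PsiTot k Psi m β) →
        KD.TotIsCoboundaryM k EM'.SE dHE' pdE' m β)) := by
  exact ⟨fun hex => quasiIso_of_reduction hdXL hdXR hpdX (PhiTot k SX EM) (fun _ q => 0 < q)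
      PhiTot_smul (fun m _ _ h => PhiTot_injective m h)
      (fun m α p _ hq => PhiTot_apply_of_pos m α p hq)
      (totDXonly_PhiTot hdXL hdXR hpdX hdHE hpdE)
      (exists_reduction_PhiTot hdXL hdXR hpdX hdR hex),
    fun hex => quasiIso_of_reduction hdXL hdXR hpdX (PsiTot k Psi) (fun p _ => 0 < p)
      PsiTot_smul (fun m _ _ h => PsiTot_injective hPsi m h)
      (fun m β _ q hp => PsiTot_apply_of_pos m β hp q)
      (totDXonly_PsiTot hdXL hdXR hpdX hPsi hdHE' hpdE')
      (exists_reduction_PsiTot hdXL hdXR hpdX hPsi hdL hex)⟩
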